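/- Let B ⊂ ℝ² be the open unit ball, and let b, C, A > 0 and 1/2 < s ≤ 1. Let (u_i) be a sequence of functions that are C² on B and continuous on the closed ball, and let (V_i) be functions on the closed ball with 0 ≤ V_i ≤ b and |V_i(x) − V_i(y)| ≤ A|x − y|^s for all x, y, such that −Δu_i = V_i e^{u_i} in B, u_i = 0 on ∂B, ∫_B e^{u_i} dy ≤ C, and sup_B u_i → +∞. Then there exist a subsequence (still denoted (u_i), (V_i)), a function u on B, a continuous function V on the closed ball with V_i → V uniformly along the subsequence, an integer m ≥ 1, and points x_1, …, x_m on the boundary ∂B (not necessarily distinct) such that V_i e^{u_i} converges weakly to V e^{u} + Σ_{j=1}^m 8π δ_{x_j}: for every continuous function f on the closed unit ball, ∫_B f V_i e^{u_i} dy → ∫_B f V e^{u} dy + 8π Σ_{j=1}^m f(x_j). -/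

import Mathlib

open MeasureTheory Metric Real Filter Topology

/-- The Laplacian on `ℝ²`: `Δu = ∂²u/∂x₁² + ∂²u/∂x₂²`. -/
noncomputable def lap (u : EuclideanSpace ℝ (Fin 2) → ℝ) (x : EuclideanSpace ℝ (Fin 2)) : ℝ :=
  ∑ i : Fin 2,
    fderiv ℝ (fun y => fderiv ℝ u y (EuclideanSpace.single i 1)) x (EuclideanSpace.single i 1)

/-- The Euclidean plane. -/
abbrev Plane := EuclideanSpace ℝ (Fin 2)

lemma volume_real_ball_plane (x : Plane) {r : ℝ} (hr : 0 ≤ r) :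
    volume.real (ball x r) = π * r ^ 2 := by
  rw [Measure.real, EuclideanSpace.volume_ball_fin_two]
  simp [ENNReal.toReal_mul, hr, mul_comm, pi_pos.le]

lemma setIntegral_ball_radial (f : ℝ → ℝ) (r : ℝ) :
    ∫ y in ball (0 : Plane) r, f ‖y‖ = 2 * π * ∫ t in Set.Ioo 0 r, t * f t := by
  rw [← integral_indicator measurableSet_ball]
  have h1 : ∀ y : Plane, (ball (0 : Plane) r).indicator (fun y => f ‖y‖) y
      = (Set.Iio r).indicator f ‖y‖ := by
    intro y; simp [Set.indicator]
  simp_rw [h1]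
  rw [integral_fun_norm_addHaar volume ((Set.Iio r).indicator f), volume_real_ball_plane 0
      zero_le_one]
  have h2 : ∀ t : ℝ, t ^ (Module.finrank ℝ Plane - 1) • (Set.Iio r).indicator f t
      = (Set.Iio r).indicator (fun t => t * f t) t := by
    intro t; simp [Set.indicator]
  simp_rw [h2]
  rw [setIntegral_indicator measurableSet_Iio]
  simp [Set.Ioi_inter_Iio]; ring

lemma setIntegral_ball_sub (g : Plane → ℝ) (x : Plane) (r : ℝ) :
    ∫ y in ball x r, g (x - y) = ∫ y in ball (0 : Plane) r, g y := by
  rw [← integral_indicator measurableSet_ball, ← integral_indicator measurableSet_ball,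
    ← integral_sub_left_eq_self _ volume x]
  congr 1; ext y; simp [Set.indicator, dist_eq_norm]

lemma integrableOn_inv_norm_zero (r : ℝ) :
    IntegrableOn (fun y : Plane => ‖y‖⁻¹) (ball 0 r) := by
  rw [integrableOn_fun_norm_addHaar volume (f := fun t => t⁻¹)]
  refine (integrableOn_const (C := (1 : ℝ)) (by simp)).congr_fun ?_ measurableSet_Ioo
  intro t ht
  simp [ht.1.ne']

lemma integrableOn_inv_norm_sub_ball (x : Plane) (r : ℝ) :
    IntegrableOn (fun y : Plane => ‖x - y‖⁻¹) (ball x r) := by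
  have h := integrableOn_inv_norm_zero r
  rw [← integrable_indicator_iff measurableSet_ball] at h ⊢
  refine (h.comp_sub_left x).congr (Eventually.of_forall fun y => ?_)
  simp [Set.indicator, dist_eq_norm, norm_sub_rev]

lemma integral_inv_norm_sub_ball (x : Plane) {r : ℝ} (hr : 0 ≤ r) :
    ∫ y in ball x r, ‖x - y‖⁻¹ = 2 * π * r := by
  rw [setIntegral_ball_sub (fun y => ‖y‖⁻¹), setIntegral_ball_radial (fun t => t⁻¹)]
  congr 1
  rw [setIntegral_congr_fun (g := fun _ => (1 : ℝ)) measurableSet_Ioo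
    (fun t ht => by simp [ht.1.ne'])]
  simp [hr]

lemma ball_one_subset_ball_two {x : Plane} (hx : x ∈ ball (0 : Plane) 1) :
    ball (0 : Plane) 1 ⊆ ball x 2 := by
  intro y hy
  rw [mem_ball, dist_eq_norm] at *
  simp only [sub_zero] at *
  calc ‖y - x‖ ≤ ‖y‖ + ‖x‖ := norm_sub_le _ _
    _ < 2 := by linarith

lemma integrableOn_inv_norm_sub {x : Plane} (hx : x ∈ ball (0 : Plane) 1) :
    IntegrableOn (fun y : Plane => ‖x - y‖⁻¹) (ball 0 1) :=
  (integrableOn_inv_norm_sub_ball x 2).mono_set (ball_one_subset_ball_two hx)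

lemma integral_inv_norm_sub_le {x : Plane} (hx : x ∈ ball (0 : Plane) 1) :
    ∫ y in ball (0 : Plane) 1, ‖x - y‖⁻¹ ≤ 4 * π := by
  calc _ ≤ ∫ y in ball x 2, ‖x - y‖⁻¹ :=
        setIntegral_mono_set (integrableOn_inv_norm_sub_ball x 2)
          (Eventually.of_forall fun y => by positivity)
          (ball_one_subset_ball_two hx).eventuallyLE
    _ = 4 * π := by rw [integral_inv_norm_sub_ball x zero_le_two]; ring

/-- Mass of the approximate identity on a ball. -/
lemma integral_approx_identity_ball (x : Plane) {r ε : ℝ} (hr : 0 ≤ r) (hε : 0 < ε) :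
    ∫ y in ball x r, ε ^ 2 / (‖x - y‖ ^ 2 + ε ^ 2) ^ 2 = π * (1 - ε ^ 2 / (r ^ 2 + ε ^ 2)) := by
  rw [setIntegral_ball_sub (fun y => ε ^ 2 / (‖y‖ ^ 2 + ε ^ 2) ^ 2),
    setIntegral_ball_radial (fun t => ε ^ 2 / (t ^ 2 + ε ^ 2) ^ 2), ← integral_Ioc_eq_integral_Ioo,
    ← intervalIntegral.integral_of_le hr]
  have hpos : ∀ t : ℝ, 0 < t ^ 2 + ε ^ 2 := fun t => by positivity
  have hder : ∀ t ∈ Set.uIcc 0 r, HasDerivAt (fun t : ℝ => -(ε ^ 2 / 2) / (t ^ 2 + ε ^ 2))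
      (t * (ε ^ 2 / (t ^ 2 + ε ^ 2) ^ 2)) t := by
    intro t _
    have h1 : HasDerivAt (fun t : ℝ => t ^ 2 + ε ^ 2) (2 * t) t := by
      simpa using (hasDerivAt_pow 2 t).add_const (ε ^ 2)
    refine ((hasDerivAt_const t (-(ε ^ 2 / 2))).div h1 (hpos t).ne').congr_deriv ?_
    have := (hpos t).ne'
    field_simp
    ring
  rw [intervalIntegral.integral_eq_sub_of_hasDerivAt hder]
  · have := hpos r
    field_simp
    ring
  · apply ContinuousOn.intervalIntegrable
    apply Continuous.continuousOn
    refine continuous_id.mul (continuous_const.div (by fun_prop) fun t => (pow_pos (hpos t) 2).ne')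

/-- In complex notation, `|1 - x ȳ|²`. -/
noncomputable def imageSq (x y : Plane) : ℝ := 1 - 2 * inner ℝ x y + ‖x‖ ^ 2 * ‖y‖ ^ 2

/-- Regularised Green function of the unit disc; `ε = 0` is the Green function itself. -/
noncomputable def green (ε : ℝ) (x y : Plane) : ℝ :=
  (4 * π)⁻¹ * (log (imageSq x y + ε ^ 2) - log (‖x - y‖ ^ 2 + ε ^ 2))

/-- Gradient of `green ε` in the first variable. -/
noncomputable def gradGreen (ε : ℝ) (x y : Plane) : Plane :=
  (2 * π)⁻¹ • ((imageSq x y + ε ^ 2)⁻¹ • (‖y‖ ^ 2 • x - y)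
    - (‖x - y‖ ^ 2 + ε ^ 2)⁻¹ • (x - y))

/-- Second derivative of `green ε` in the first variable along `e`. -/
noncomputable def hessGreen (ε : ℝ) (e x y : Plane) : ℝ :=
  (2 * π)⁻¹ * (‖y‖ ^ 2 * ‖e‖ ^ 2 / (imageSq x y + ε ^ 2)
    - 2 * inner ℝ (‖y‖ ^ 2 • x - y) e ^ 2 / (imageSq x y + ε ^ 2) ^ 2
    - (‖e‖ ^ 2 / (‖x - y‖ ^ 2 + ε ^ 2)
      - 2 * inner ℝ (x - y) e ^ 2 / (‖x - y‖ ^ 2 + ε ^ 2) ^ 2))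

lemma norm_lt_one_of_mem {x : Plane} (hx : x ∈ ball (0 : Plane) 1) : ‖x‖ < 1 := by
  simpa using hx

lemma imageSq_eq (x y : Plane) :
    imageSq x y = ‖x - y‖ ^ 2 + (1 - ‖x‖ ^ 2) * (1 - ‖y‖ ^ 2) := by
  rw [imageSq, norm_sub_sq_real]; ring

lemma imageSq_comm (x y : Plane) : imageSq x y = imageSq y x := by
  rw [imageSq, imageSq, real_inner_comm]; ring

lemma sq_le_imageSq (x y : Plane) : (1 - ‖x‖ * ‖y‖) ^ 2 ≤ imageSq x y := by
  rw [imageSq]; nlinarith [real_inner_le_norm x y]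

lemma imageSq_nonneg (x y : Plane) : 0 ≤ imageSq x y := (sq_nonneg _).trans (sq_le_imageSq x y)

lemma one_sub_sq_le_imageSq {x y : Plane} (hx : ‖x‖ ≤ 1) (hy : ‖y‖ ≤ 1) :
    (1 - ‖x‖) ^ 2 ≤ imageSq x y := by
  refine le_trans ?_ (sq_le_imageSq x y)
  have := mul_le_of_le_one_right (norm_nonneg x) hy
  gcongr

lemma imageSq_pos {x y : Plane} (hx : ‖x‖ < 1) (hy : ‖y‖ ≤ 1) : 0 < imageSq x y :=
  (pow_pos (by linarith) 2).trans_le (one_sub_sq_le_imageSq hx.le hy)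

lemma dist_sq_le_imageSq {x y : Plane} (hx : ‖x‖ ≤ 1) (hy : ‖y‖ ≤ 1) :
    ‖x - y‖ ^ 2 ≤ imageSq x y := by
  rw [imageSq_eq]
  have h1 : 0 ≤ 1 - ‖x‖ ^ 2 := by nlinarith [norm_nonneg x]
  have h2 : 0 ≤ 1 - ‖y‖ ^ 2 := by nlinarith [norm_nonneg y]
  nlinarith [mul_nonneg h1 h2]

lemma norm_sq_smul_sub_sq (x y : Plane) :
    ‖‖y‖ ^ 2 • x - y‖ ^ 2 = ‖y‖ ^ 2 * imageSq x y := by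
  rw [norm_sub_sq_real, norm_smul, inner_smul_left, imageSq]
  simp; ring

lemma norm_sq_smul_sub (x y : Plane) : ‖‖y‖ ^ 2 • x - y‖ = ‖y‖ * √(imageSq x y) := by
  rw [← sqrt_sq (norm_nonneg (‖y‖ ^ 2 • x - y)), norm_sq_smul_sub_sq, sqrt_mul (sq_nonneg _),
    sqrt_sq (norm_nonneg y)]

lemma norm_le_sqrt_imageSq {x y : Plane} (hx : ‖x‖ ≤ 1) (hy : ‖y‖ ≤ 1) :
    ‖x - y‖ ≤ √(imageSq x y) := le_sqrt_of_sq_le (dist_sq_le_imageSq hx hy)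

lemma inv_add_sq_mul_le {t s ε : ℝ} (ht : 0 < t) (hts : t ≤ s) :
    (s ^ 2 + ε ^ 2)⁻¹ * s ≤ t⁻¹ := by
  have hs := ht.trans_le hts
  rw [inv_mul_le_iff₀ (by positivity), ← div_eq_mul_inv, le_div_iff₀ ht]
  nlinarith [sq_nonneg ε]

lemma norm_gradGreen_le (ε : ℝ) {x y : Plane} (hx : ‖x‖ ≤ 1) (hy : ‖y‖ ≤ 1) (hxy : x ≠ y) :
    ‖gradGreen ε x y‖ ≤ π⁻¹ * ‖x - y‖⁻¹ := by
  have hd : 0 < ‖x - y‖ := norm_pos_iff.2 (sub_ne_zero.2 hxy)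
  have hs := norm_le_sqrt_imageSq hx hy
  have h1 : ‖(imageSq x y + ε ^ 2)⁻¹ • (‖y‖ ^ 2 • x - y)‖ ≤ ‖x - y‖⁻¹ := by
    have := inv_add_sq_mul_le (ε := ε) hd hs
    rw [sq_sqrt (imageSq_nonneg x y)] at this
    have hp := imageSq_nonneg x y
    rw [norm_smul, norm_sq_smul_sub, norm_of_nonneg (by positivity)]
    refine le_trans ?_ this
    gcongr
    exact mul_le_of_le_one_left (sqrt_nonneg _) hy
  have h2 : ‖(‖x - y‖ ^ 2 + ε ^ 2)⁻¹ • (x - y)‖ ≤ ‖x - y‖⁻¹ := by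
    rw [norm_smul, norm_of_nonneg (by positivity)]
    exact inv_add_sq_mul_le hd le_rfl
  rw [gradGreen, norm_smul, norm_of_nonneg (by positivity)]
  calc (2 * π)⁻¹ * _ ≤ (2 * π)⁻¹ * (‖x - y‖⁻¹ + ‖x - y‖⁻¹) := by
        gcongr; exact (norm_sub_le _ _).trans (add_le_add h1 h2)
    _ = _ := by field_simp; ring

lemma inv_sub_inv_mul_le {t s ε : ℝ} (ht : 0 < t) (hts : t ≤ s) :
    ((s ^ 2)⁻¹ - (s ^ 2 + ε ^ 2)⁻¹) * s ≤ ε ^ 2 / (t * (t ^ 2 + ε ^ 2)) := by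
  have hs := ht.trans_le hts
  have : ((s ^ 2)⁻¹ - (s ^ 2 + ε ^ 2)⁻¹) * s = ε ^ 2 / (s * (s ^ 2 + ε ^ 2)) := by
    field_simp; ring
  rw [this]; gcongr

lemma norm_gradGreen_sub_le (ε : ℝ) {x y : Plane} (hx : ‖x‖ ≤ 1) (hy : ‖y‖ ≤ 1) (hxy : x ≠ y) :
    ‖gradGreen ε x y - gradGreen 0 x y‖
      ≤ π⁻¹ * (ε ^ 2 / (‖x - y‖ * (‖x - y‖ ^ 2 + ε ^ 2))) := by
  have hd : 0 < ‖x - y‖ := norm_pos_iff.2 (sub_ne_zero.2 hxy)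
  have hs := norm_le_sqrt_imageSq hx hy
  have hp : 0 < imageSq x y := (pow_pos hd 2).trans_le (dist_sq_le_imageSq hx hy)
  have key : ∀ t : ℝ, 0 < t → 0 ≤ t⁻¹ - (t + ε ^ 2)⁻¹ := fun t ht => by
    rw [sub_nonneg]; exact inv_anti₀ ht (by nlinarith [sq_nonneg ε])
  have h1 : ‖((imageSq x y)⁻¹ - (imageSq x y + ε ^ 2)⁻¹) • (‖y‖ ^ 2 • x - y)‖
      ≤ ε ^ 2 / (‖x - y‖ * (‖x - y‖ ^ 2 + ε ^ 2)) := by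
    have := inv_sub_inv_mul_le (ε := ε) hd hs
    rw [sq_sqrt hp.le] at this
    rw [norm_smul, norm_sq_smul_sub, norm_of_nonneg (key _ hp)]
    refine le_trans ?_ this
    have := key _ hp
    gcongr
    exact mul_le_of_le_one_left (sqrt_nonneg _) hy
  have h2 : ‖((‖x - y‖ ^ 2)⁻¹ - (‖x - y‖ ^ 2 + ε ^ 2)⁻¹) • (x - y)‖
      ≤ ε ^ 2 / (‖x - y‖ * (‖x - y‖ ^ 2 + ε ^ 2)) := by
    rw [norm_smul, norm_of_nonneg (key _ (by positivity))]
    exact inv_sub_inv_mul_le hd le_rfl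
  have heq : gradGreen ε x y - gradGreen 0 x y = (2 * π)⁻¹ •
      (((‖x - y‖ ^ 2)⁻¹ - (‖x - y‖ ^ 2 + ε ^ 2)⁻¹) • (x - y)
        - ((imageSq x y)⁻¹ - (imageSq x y + ε ^ 2)⁻¹) • (‖y‖ ^ 2 • x - y)) := by
    simp only [gradGreen]
    rw [zero_pow two_ne_zero, add_zero, add_zero]
    module
  rw [heq, norm_smul, norm_of_nonneg (by positivity)]
  calc (2 * π)⁻¹ * _ ≤ (2 * π)⁻¹ * (_ + _) := by
        gcongr; exact (norm_sub_le _ _).trans (add_le_add h2 h1)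
    _ = _ := by field_simp; ring

lemma green_nonneg {ε : ℝ} {x y : Plane} (hx : ‖x‖ ≤ 1) (hy : ‖y‖ ≤ 1)
    (h : x ≠ y ∨ ε ≠ 0) : 0 ≤ green ε x y := by
  have h1 := dist_sq_le_imageSq hx hy
  have h2 : 0 < ‖x - y‖ ^ 2 + ε ^ 2 := by
    rcases h with h | h
    · have : 0 < ‖x - y‖ := norm_pos_iff.2 (sub_ne_zero.2 h)
      positivity
    · positivity
  rw [green]
  have := log_le_log h2 (by linarith : ‖x - y‖ ^ 2 + ε ^ 2 ≤ imageSq x y + ε ^ 2)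
  exact mul_nonneg (by positivity) (by linarith)

lemma log_one_add_le_two_sqrt {t : ℝ} (ht : 0 ≤ t) : log (1 + t) ≤ 2 * √t := by
  have h1 : 1 + t ≤ (1 + √t) ^ 2 := by nlinarith [sq_sqrt ht, sqrt_nonneg t]
  have h0 := sqrt_nonneg t
  calc log (1 + t) ≤ log ((1 + √t) ^ 2) := log_le_log (by linarith) h1
    _ = 2 * log (1 + √t) := by rw [log_pow]; norm_num
    _ ≤ 2 * √t := by linarith [log_le_sub_one_of_pos (by linarith : 0 < 1 + √t)]

lemma green_le (ε : ℝ) {x y : Plane} (hx : ‖x‖ ≤ 1) (hy : ‖y‖ ≤ 1) (hxy : x ≠ y) :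
    green ε x y ≤ (2 * π)⁻¹ * √(1 - ‖x‖ ^ 2) * ‖x - y‖⁻¹ := by
  have hd : 0 < ‖x - y‖ := norm_pos_iff.2 (sub_ne_zero.2 hxy)
  have ha : 0 ≤ 1 - ‖x‖ ^ 2 := by nlinarith [norm_nonneg x]
  have hb : 0 ≤ 1 - ‖y‖ ^ 2 := by nlinarith [norm_nonneg y]
  have hb' : 1 - ‖y‖ ^ 2 ≤ 1 := by nlinarith [norm_nonneg y]
  have h1 := dist_sq_le_imageSq hx hy
  have h2 : log (imageSq x y + ε ^ 2) - log (‖x - y‖ ^ 2 + ε ^ 2)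
      ≤ 2 * (√(1 - ‖x‖ ^ 2) * ‖x - y‖⁻¹) := by
    have hp : 0 < imageSq x y + ε ^ 2 := by nlinarith [sq_nonneg ε, pow_pos hd 2]
    rw [← log_div hp.ne' (by positivity)]
    have h3 : (imageSq x y + ε ^ 2) / (‖x - y‖ ^ 2 + ε ^ 2)
        ≤ 1 + (1 - ‖x‖ ^ 2) / ‖x - y‖ ^ 2 := by
      rw [div_le_iff₀ (by positivity), imageSq_eq]
      have : 0 ≤ (1 - ‖x‖ ^ 2) / ‖x - y‖ ^ 2 := by positivity
      have h4 : (1 - ‖x‖ ^ 2) / ‖x - y‖ ^ 2 * ‖x - y‖ ^ 2 = 1 - ‖x‖ ^ 2 := by field_simp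
      nlinarith [mul_nonneg this (sq_nonneg ε), mul_le_of_le_one_right ha hb']
    refine (log_le_log (by positivity) h3).trans
        ((log_one_add_le_two_sqrt (by positivity)).trans ?_)
    rw [sqrt_div ha, sqrt_sq hd.le, div_eq_mul_inv]
  rw [green]
  calc (4 * π)⁻¹ * _ ≤ (4 * π)⁻¹ * (2 * (√(1 - ‖x‖ ^ 2) * ‖x - y‖⁻¹)) := by gcongr
    _ = _ := by field_simp; ring

lemma imageSq_line (x e y : Plane) (t : ℝ) :
    imageSq (x + t • e) y
      = imageSq x y + 2 * inner ℝ (‖y‖ ^ 2 • x - y) e * t + ‖y‖ ^ 2 * ‖e‖ ^ 2 * t ^ 2 := by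
  simp only [imageSq, norm_add_sq_real, inner_add_left, inner_sub_left, inner_smul_left,
    inner_smul_right, norm_smul, real_inner_comm y e]
  simp [mul_pow]; ring

lemma dist_sq_line (x e y : Plane) (t : ℝ) :
    ‖x + t • e - y‖ ^ 2 = ‖x - y‖ ^ 2 + 2 * inner ℝ (x - y) e * t + ‖e‖ ^ 2 * t ^ 2 := by
  rw [show x + t • e - y = (x - y) + t • e by abel, norm_add_sq_real, inner_smul_right, norm_smul]
  simp [mul_pow]; ring

lemma hasDerivAt_quadratic (a b c t : ℝ) :
    HasDerivAt (fun t : ℝ => a + 2 * b * t + c * t ^ 2) (2 * (b + c * t)) t := by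
  refine (((hasDerivAt_id t).const_mul (2 * b)).const_add a |>.add
    ((hasDerivAt_pow 2 t).const_mul c)).congr_deriv ?_
  simp; ring

lemma hasDerivAt_imageSq_line (x e y : Plane) (t : ℝ) :
    HasDerivAt (fun t : ℝ => imageSq (x + t • e) y)
      (2 * inner ℝ (‖y‖ ^ 2 • (x + t • e) - y) e) t := by
  simp_rw [imageSq_line]
  refine (hasDerivAt_quadratic _ _ _ t).congr_deriv ?_
  simp only [smul_add, inner_sub_left, inner_add_left, inner_smul_left, real_inner_self_eq_norm_sq]
  simp; ring

lemma hasDerivAt_dist_sq_line (x e y : Plane) (t : ℝ) :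
    HasDerivAt (fun t : ℝ => ‖x + t • e - y‖ ^ 2) (2 * inner ℝ (x + t • e - y) e) t := by
  simp_rw [dist_sq_line]
  refine (hasDerivAt_quadratic _ _ _ t).congr_deriv ?_
  simp only [inner_sub_left, inner_add_left, inner_smul_left, real_inner_self_eq_norm_sq]
  simp; ring

lemma hasDerivAt_green_line {ε : ℝ} (hε : ε ≠ 0) (x e y : Plane) (t : ℝ) :
    HasDerivAt (fun t : ℝ => green ε (x + t • e) y) (inner ℝ (gradGreen ε (x + t • e) y) e) t := by
  have hp : imageSq (x + t • e) y + ε ^ 2 ≠ 0 := by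
    have := imageSq_nonneg (x + t • e) y; positivity
  have hd : ‖x + t • e - y‖ ^ 2 + ε ^ 2 ≠ 0 := by positivity
  refine ((((hasDerivAt_imageSq_line x e y t).add_const (ε ^ 2)).log hp).sub
    (((hasDerivAt_dist_sq_line x e y t).add_const (ε ^ 2)).log hd)
      |>.const_mul (4 * π)⁻¹).congr_deriv ?_
  rw [gradGreen]
  generalize ‖y‖ ^ 2 • (x + t • e) - y = v
  generalize x + t • e - y = w at *
  simp only [inner_sub_left, inner_smul_left]
  simp; field_simp; ring

lemma hasDerivAt_inner_gradGreen_line {ε : ℝ} (hε : ε ≠ 0) (x e y : Plane) (t : ℝ) :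
    HasDerivAt (fun t : ℝ => inner ℝ (gradGreen ε (x + t • e) y) e)
      (hessGreen ε e (x + t • e) y) t := by
  have hp : imageSq (x + t • e) y + ε ^ 2 ≠ 0 := by
    have := imageSq_nonneg (x + t • e) y; positivity
  have hd : ‖x + t • e - y‖ ^ 2 + ε ^ 2 ≠ 0 := by positivity
  have h1 : HasDerivAt (fun t : ℝ => inner ℝ (‖y‖ ^ 2 • (x + t • e) - y) e)
      (‖y‖ ^ 2 * ‖e‖ ^ 2) t := by
    have : ∀ t : ℝ, inner ℝ (‖y‖ ^ 2 • (x + t • e) - y) e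
        = inner ℝ (‖y‖ ^ 2 • x - y) e + ‖y‖ ^ 2 * ‖e‖ ^ 2 * t := fun t => by
      simp only [smul_add, inner_sub_left, inner_add_left, inner_smul_left,
        real_inner_self_eq_norm_sq]
      simp; ring
    simp_rw [this]
    simpa using ((hasDerivAt_id t).const_mul (‖y‖ ^ 2 * ‖e‖ ^ 2)).const_add
      (inner ℝ (‖y‖ ^ 2 • x - y) e)
  have h2 : HasDerivAt (fun t : ℝ => inner ℝ (x + t • e - y) e) (‖e‖ ^ 2) t := by
    have : ∀ t : ℝ, inner ℝ (x + t • e - y) e = inner ℝ (x - y) e + ‖e‖ ^ 2 * t := fun t => by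
      simp only [inner_sub_left, inner_add_left, inner_smul_left, real_inner_self_eq_norm_sq]
      simp; ring
    simp_rw [this]
    simpa using ((hasDerivAt_id t).const_mul (‖e‖ ^ 2)).const_add (inner ℝ (x - y) e)
  have h3 : ∀ t : ℝ, inner ℝ (gradGreen ε (x + t • e) y) e = (2 * π)⁻¹ *
      (inner ℝ (‖y‖ ^ 2 • (x + t • e) - y) e / (imageSq (x + t • e) y + ε ^ 2)
        - inner ℝ (x + t • e - y) e / (‖x + t • e - y‖ ^ 2 + ε ^ 2)) := fun t => by
    simp only [gradGreen, inner_smul_left, inner_sub_left (𝕜 := ℝ) (_ • _ : Plane)]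
    simp [div_eq_inv_mul]
  simp_rw [h3]
  refine ((h1.div ((hasDerivAt_imageSq_line x e y t).add_const (ε ^ 2)) hp).sub
    (h2.div ((hasDerivAt_dist_sq_line x e y t).add_const (ε ^ 2)) hd)
      |>.const_mul (2 * π)⁻¹).congr_deriv ?_
  rw [hessGreen]
  generalize inner ℝ (‖y‖ ^ 2 • (x + t • e) - y) e = a
  generalize inner ℝ (x + t • e - y) e = c
  field_simp

lemma sum_hessGreen {ε : ℝ} (hε : ε ≠ 0) (x y : Plane) :
    ∑ i : Fin 2, hessGreen ε (EuclideanSpace.single i 1) x y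
      = π⁻¹ * (‖y‖ ^ 2 * (ε ^ 2 / (imageSq x y + ε ^ 2) ^ 2)
        - ε ^ 2 / (‖x - y‖ ^ 2 + ε ^ 2) ^ 2) := by
  have hp : imageSq x y + ε ^ 2 ≠ 0 := by
    have := imageSq_nonneg x y; positivity
  have hd : ‖x - y‖ ^ 2 + ε ^ 2 ≠ 0 := by positivity
  have key : ∀ v : Plane, inner ℝ v (EuclideanSpace.single 0 1) ^ 2
      + inner ℝ v (EuclideanSpace.single 1 1) ^ 2 = ‖v‖ ^ 2 := fun v => by
    rw [EuclideanSpace.real_norm_sq_eq]; simp [EuclideanSpace.inner_single_right]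
  have hA := key (‖y‖ ^ 2 • x - y)
  rw [norm_sq_smul_sub_sq] at hA
  have hB := key (x - y)
  rw [Fin.sum_univ_two]
  simp only [hessGreen, PiLp.norm_single, norm_one]
  generalize inner ℝ (‖y‖ ^ 2 • x - y) (EuclideanSpace.single 0 (1 : ℝ)) = a0 at *
  generalize inner ℝ (‖y‖ ^ 2 • x - y) (EuclideanSpace.single 1 (1 : ℝ)) = a1 at *
  generalize inner ℝ (x - y) (EuclideanSpace.single 0 (1 : ℝ)) = c0 at *
  generalize inner ℝ (x - y) (EuclideanSpace.single 1 (1 : ℝ)) = c1 at *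
  rw [show a1 ^ 2 = ‖y‖ ^ 2 * imageSq x y - a0 ^ 2 by linarith,
    show c1 ^ 2 = ‖x - y‖ ^ 2 - c0 ^ 2 by linarith]
  generalize ‖x - y‖ ^ 2 = D at *
  generalize imageSq x y = Q at *
  field_simp
  ring

/-- Green potential of `f` on the unit disc. -/
noncomputable def potential (ε : ℝ) (f : Plane → ℝ) (x : Plane) : ℝ :=
  ∫ y in ball (0 : Plane) 1, f y * green ε x y

/-- Gradient of the Green potential of `f`. -/
noncomputable def gradPotential (ε : ℝ) (f : Plane → ℝ) (x : Plane) : Plane :=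
  ∫ y in ball (0 : Plane) 1, f y • gradGreen ε x y

lemma measurable_imageSq : Measurable (fun p : Plane × Plane => imageSq p.1 p.2) := by
  unfold imageSq; fun_prop

lemma measurable_green (ε : ℝ) : Measurable (fun p : Plane × Plane => green ε p.1 p.2) := by
  have := measurable_imageSq
  unfold green; fun_prop

lemma measurable_gradGreen (ε : ℝ) : Measurable (fun p : Plane × Plane => gradGreen ε p.1 p.2) := by
  have := measurable_imageSq
  unfold gradGreen; fun_prop

lemma measurable_hessGreen (ε : ℝ) (e : Plane) :
    Measurable (fun p : Plane × Plane => hessGreen ε e p.1 p.2) := by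
  have := measurable_imageSq
  unfold hessGreen; fun_prop

lemma ae_mem_ball_and_ne (x : Plane) :
    ∀ᵐ y ∂(volume.restrict (ball (0 : Plane) 1)), y ∈ ball (0 : Plane) 1 ∧ x ≠ y := by
  have h : ∀ᵐ y ∂(volume : Measure Plane), x ≠ y := by
    filter_upwards [compl_mem_ae_iff.2 (measure_singleton x)] with y hy h
    exact hy (by simp [h])
  filter_upwards [ae_restrict_mem measurableSet_ball, ae_restrict_of_ae h] with y h1 h2
  exact ⟨h1, h2⟩

lemma abs_green_le (ε : ℝ) {x y : Plane} (hx : ‖x‖ ≤ 1) (hy : ‖y‖ ≤ 1) (hxy : x ≠ y) :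
    |green ε x y| ≤ ‖x - y‖⁻¹ := by
  rw [abs_of_nonneg (green_nonneg hx hy (.inl hxy))]
  refine (green_le ε hx hy hxy).trans (mul_le_of_le_one_left (by positivity) ?_)
  have h1 : √(1 - ‖x‖ ^ 2) ≤ 1 := sqrt_le_one.2 (by nlinarith [sq_nonneg ‖x‖])
  have h2 : (2 * π)⁻¹ ≤ 1 := inv_le_one_of_one_le₀ (by linarith [pi_gt_three])
  exact mul_le_one₀ h2 (sqrt_nonneg _) h1

lemma norm_gradGreen_le_inv (ε : ℝ) {x y : Plane} (hx : ‖x‖ ≤ 1) (hy : ‖y‖ ≤ 1) (hxy : x ≠ y) :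
    ‖gradGreen ε x y‖ ≤ ‖x - y‖⁻¹ := by
  refine (norm_gradGreen_le ε hx hy hxy).trans (mul_le_of_le_one_left (by positivity) ?_)
  exact inv_le_one_of_one_le₀ (by linarith [pi_gt_three])

lemma inv_add_sq_mul_le_inv {ε s : ℝ} (hε : ε ≠ 0) : (s ^ 2 + ε ^ 2)⁻¹ * s ≤ |ε|⁻¹ := by
  have h := abs_pos.2 hε
  rw [inv_mul_le_iff₀ (by positivity), ← div_eq_mul_inv, le_div_iff₀ h]
  rw [← sq_abs ε]
  nlinarith [sq_nonneg (s - |ε|), sq_nonneg s, sq_nonneg |ε|]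

lemma norm_gradGreen_le_const {ε : ℝ} (hε : ε ≠ 0) (x : Plane) {y : Plane} (hy : ‖y‖ ≤ 1) :
    ‖gradGreen ε x y‖ ≤ |ε|⁻¹ := by
  have hp := imageSq_nonneg x y
  have h1 : ‖(imageSq x y + ε ^ 2)⁻¹ • (‖y‖ ^ 2 • x - y)‖ ≤ |ε|⁻¹ := by
    have := inv_add_sq_mul_le_inv (s := √(imageSq x y)) hε
    rw [sq_sqrt hp] at this
    rw [norm_smul, norm_sq_smul_sub, norm_of_nonneg (by positivity)]
    refine le_trans ?_ this
    gcongr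
    exact mul_le_of_le_one_left (sqrt_nonneg _) hy
  have h2 : ‖(‖x - y‖ ^ 2 + ε ^ 2)⁻¹ • (x - y)‖ ≤ |ε|⁻¹ := by
    rw [norm_smul, norm_of_nonneg (by positivity)]
    exact inv_add_sq_mul_le_inv hε
  rw [gradGreen, norm_smul, norm_of_nonneg (by positivity)]
  calc (2 * π)⁻¹ * _ ≤ 2⁻¹ * (|ε|⁻¹ + |ε|⁻¹) := by
        gcongr
        · linarith [pi_gt_three]
        · exact (norm_sub_le _ _).trans (add_le_add h1 h2)
    _ = _ := by ring

lemma abs_hessGreen_le_const {ε : ℝ} (hε : ε ≠ 0) (x e : Plane) {y : Plane} (hy : ‖y‖ ≤ 1) :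
    |hessGreen ε e x y| ≤ 6 * (‖e‖ ^ 2 / ε ^ 2) := by
  have hp := imageSq_nonneg x y
  have hε2 : 0 < ε ^ 2 := by positivity
  have hy2 : ‖y‖ ^ 2 ≤ 1 := pow_le_one₀ (norm_nonneg y) hy
  have key : ∀ {q : ℝ} {v : Plane}, 0 ≤ q → ‖v‖ ^ 2 ≤ q →
      inner ℝ v e ^ 2 / (q + ε ^ 2) ^ 2 ≤ ‖e‖ ^ 2 / ε ^ 2 := by
    intro q v hq hv
    have h1 : inner ℝ v e ^ 2 ≤ q * ‖e‖ ^ 2 := by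
      calc inner ℝ v e ^ 2 = |inner ℝ v e| ^ 2 := (sq_abs _).symm
        _ ≤ (‖v‖ * ‖e‖) ^ 2 := by gcongr; exact abs_real_inner_le_norm v e
        _ = ‖v‖ ^ 2 * ‖e‖ ^ 2 := by ring
        _ ≤ _ := by gcongr
    rw [div_le_div_iff₀ (by positivity) hε2]
    nlinarith [mul_nonneg (sq_nonneg ‖e‖) hq, mul_nonneg (sq_nonneg ‖e‖) hε2.le,
      mul_nonneg (mul_nonneg (sq_nonneg ‖e‖) hq) hq,
      mul_nonneg (mul_nonneg (sq_nonneg ‖e‖) hq) hε2.le,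
      mul_nonneg (mul_nonneg (sq_nonneg ‖e‖) hε2.le) hε2.le]
  have h1 := key hp (v := ‖y‖ ^ 2 • x - y)
    (by rw [norm_sq_smul_sub_sq]; exact mul_le_of_le_one_left hp hy2)
  have h2 := key (sq_nonneg ‖x - y‖) (v := x - y) le_rfl
  have h3 : ‖y‖ ^ 2 * ‖e‖ ^ 2 / (imageSq x y + ε ^ 2) ≤ ‖e‖ ^ 2 / ε ^ 2 := by
    gcongr
    · exact mul_le_of_le_one_left (sq_nonneg _) hy2
    · linarith
  have h4 : ‖e‖ ^ 2 / (‖x - y‖ ^ 2 + ε ^ 2) ≤ ‖e‖ ^ 2 / ε ^ 2 := by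
    gcongr; nlinarith [sq_nonneg ‖x - y‖]
  have h5 : 0 ≤ ‖y‖ ^ 2 * ‖e‖ ^ 2 / (imageSq x y + ε ^ 2) := by positivity
  have h6 : 0 ≤ ‖e‖ ^ 2 / (‖x - y‖ ^ 2 + ε ^ 2) := by positivity
  have h7 : 0 ≤ inner ℝ (‖y‖ ^ 2 • x - y) e ^ 2 / (imageSq x y + ε ^ 2) ^ 2 := by positivity
  have h8 : 0 ≤ inner ℝ (x - y) e ^ 2 / (‖x - y‖ ^ 2 + ε ^ 2) ^ 2 := by positivity
  have h9 : 0 ≤ ‖e‖ ^ 2 / ε ^ 2 := by positivity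
  have h10 : (2 * π)⁻¹ ≤ 1 := inv_le_one_of_one_le₀ (by linarith [pi_gt_three])
  rw [hessGreen, abs_mul, abs_of_nonneg (by positivity : (0:ℝ) ≤ (2 * π)⁻¹)]
  refine (mul_le_of_le_one_left (abs_nonneg _) h10).trans ?_
  rw [mul_div_assoc 2, mul_div_assoc 2, abs_le]
  constructor <;> linarith

section Potential

variable {f : Plane → ℝ} {F : ℝ}

lemma aestronglyMeasurable_of_continuousOn (hf : ContinuousOn f (closedBall 0 1)) :
    AEStronglyMeasurable f (volume.restrict (ball (0 : Plane) 1)) :=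
  (hf.mono ball_subset_closedBall).aestronglyMeasurable measurableSet_ball

lemma aestronglyMeasurable_mul_green (hf : ContinuousOn f (closedBall 0 1)) (ε : ℝ) (x : Plane) :
    AEStronglyMeasurable (fun y => f y * green ε x y) (volume.restrict (ball (0 : Plane) 1)) :=
  (aestronglyMeasurable_of_continuousOn hf).mul
    ((measurable_green ε).comp measurable_prodMk_left).aestronglyMeasurable

lemma aestronglyMeasurable_smul_gradGreen (hf : ContinuousOn f (closedBall 0 1)) (ε : ℝ)
    (x : Plane) :
    AEStronglyMeasurable (fun y => f y • gradGreen ε x y) (volume.restrict (ball (0 : Plane) 1)) :=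
  (aestronglyMeasurable_of_continuousOn hf).smul
    ((measurable_gradGreen ε).comp measurable_prodMk_left).aestronglyMeasurable

lemma integrable_mul_inv_norm (hf : ContinuousOn f (closedBall 0 1)) {x : Plane}
    (hx : x ∈ ball (0 : Plane) 1) :
    IntegrableOn (fun y => |f y| * ‖x - y‖⁻¹) (ball 0 1) := by
  obtain ⟨F, hF⟩ := (isCompact_closedBall (0 : Plane) 1).exists_bound_of_continuousOn hf
  refine (integrableOn_inv_norm_sub hx).bdd_mul (c := F)
    (aestronglyMeasurable_of_continuousOn hf).norm ?_
  filter_upwards [ae_restrict_mem measurableSet_ball] with y hy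
  simpa using hF y (ball_subset_closedBall hy)

lemma integrable_mul_green (hf : ContinuousOn f (closedBall 0 1)) (ε : ℝ) {x : Plane}
    (hx : x ∈ ball (0 : Plane) 1) : IntegrableOn (fun y => f y * green ε x y) (ball 0 1) := by
  refine (integrable_mul_inv_norm hf hx).mono' (aestronglyMeasurable_mul_green hf ε x) ?_
  filter_upwards [ae_mem_ball_and_ne x] with y ⟨hy, hxy⟩
  rw [norm_mul, norm_eq_abs, norm_eq_abs]
  gcongr
  exact abs_green_le ε (norm_lt_one_of_mem hx).le (norm_lt_one_of_mem hy).le hxy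

lemma integrable_smul_gradGreen (hf : ContinuousOn f (closedBall 0 1)) (ε : ℝ) {x : Plane}
    (hx : x ∈ ball (0 : Plane) 1) : IntegrableOn (fun y => f y • gradGreen ε x y) (ball 0 1) := by
  refine (integrable_mul_inv_norm hf hx).mono' (aestronglyMeasurable_smul_gradGreen hf ε x) ?_
  filter_upwards [ae_mem_ball_and_ne x] with y ⟨hy, hxy⟩
  rw [norm_smul, norm_eq_abs]
  gcongr
  exact norm_gradGreen_le_inv ε (norm_lt_one_of_mem hx).le (norm_lt_one_of_mem hy).le hxy

lemma norm_gradPotential_le (hf : ContinuousOn f (closedBall 0 1)) (ε : ℝ) {x : Plane}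
    (hx : x ∈ ball (0 : Plane) 1) :
    ‖gradPotential ε f x‖ ≤ π⁻¹ * ∫ y in ball (0 : Plane) 1, |f y| * ‖x - y‖⁻¹ := by
  rw [← integral_const_mul]
  refine norm_integral_le_of_norm_le ((integrable_mul_inv_norm hf hx).const_mul _) ?_
  filter_upwards [ae_mem_ball_and_ne x] with y ⟨hy, hxy⟩
  rw [norm_smul, norm_eq_abs, mul_left_comm]
  gcongr
  exact norm_gradGreen_le ε (norm_lt_one_of_mem hx).le (norm_lt_one_of_mem hy).le hxy

lemma inner_gradPotential (hf : ContinuousOn f (closedBall 0 1)) (ε : ℝ) {x : Plane}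
    (hx : x ∈ ball (0 : Plane) 1) (e : Plane) :
    inner ℝ (gradPotential ε f x) e
      = ∫ y in ball (0 : Plane) 1, f y * inner ℝ (gradGreen ε x y) e := by
  rw [gradPotential, real_inner_comm, ← integral_inner (integrable_smul_gradGreen hf ε hx)]
  congr 1; ext y
  rw [inner_smul_right, real_inner_comm]

lemma isOpen_line_mem_ball (x e : Plane) : IsOpen {t : ℝ | x + t • e ∈ ball (0 : Plane) 1} :=
  isOpen_ball.preimage (by fun_prop)

lemma hasDerivAt_potential_line (hf : ContinuousOn f (closedBall 0 1)) {ε : ℝ} (hε : ε ≠ 0)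
    (x e : Plane) {t : ℝ} (ht : x + t • e ∈ ball (0 : Plane) 1) :
    HasDerivAt (fun t : ℝ => potential ε f (x + t • e))
      (inner ℝ (gradPotential ε f (x + t • e)) e) t := by
  obtain ⟨F, hF⟩ := (isCompact_closedBall (0 : Plane) 1).exists_bound_of_continuousOn hf
  rw [inner_gradPotential hf ε ht]
  refine (hasDerivAt_integral_of_dominated_loc_of_deriv_le
    (F := fun t y => f y * green ε (x + t • e) y)
    (F' := fun t y => f y * inner ℝ (gradGreen ε (x + t • e) y) e)
    (bound := fun _ => F * (|ε|⁻¹ * ‖e‖))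
    ((isOpen_line_mem_ball x e).mem_nhds ht)
    (Eventually.of_forall fun t => aestronglyMeasurable_mul_green hf ε _)
    (integrable_mul_green hf ε ht) ?_ ?_ (integrableOn_const (by simp)) ?_).2
  · exact (aestronglyMeasurable_of_continuousOn hf).mul
      (((measurable_gradGreen ε).comp measurable_prodMk_left).inner_const).aestronglyMeasurable
  · filter_upwards [ae_restrict_mem measurableSet_ball] with y hy s hs
    have hy' := hF y (ball_subset_closedBall hy)
    rw [norm_mul]
    gcongr
    · exact (norm_nonneg _).trans hy'
    · refine (norm_inner_le_norm _ _).trans ?_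
      gcongr
      exact norm_gradGreen_le_const hε _ (norm_lt_one_of_mem hy).le
  · exact Eventually.of_forall fun y s _ => (hasDerivAt_green_line hε x e y s).const_mul _

lemma hasDerivAt_gradPotential_line (hf : ContinuousOn f (closedBall 0 1)) {ε : ℝ} (hε : ε ≠ 0)
    (x e : Plane) {t : ℝ} (ht : x + t • e ∈ ball (0 : Plane) 1) :
    HasDerivAt (fun t : ℝ => inner ℝ (gradPotential ε f (x + t • e)) e)
      (∫ y in ball (0 : Plane) 1, f y * hessGreen ε e (x + t • e) y) t := by
  obtain ⟨F, hF⟩ := (isCompact_closedBall (0 : Plane) 1).exists_bound_of_continuousOn hf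
  have hopen := (isOpen_line_mem_ball x e).mem_nhds ht
  have hmeas : ∀ t : ℝ, AEStronglyMeasurable (fun y => f y * inner ℝ (gradGreen ε (x + t • e) y) e)
      (volume.restrict (ball (0 : Plane) 1)) := fun t =>
    (aestronglyMeasurable_of_continuousOn hf).mul
      (((measurable_gradGreen ε).comp measurable_prodMk_left).inner_const).aestronglyMeasurable
  have key := (hasDerivAt_integral_of_dominated_loc_of_deriv_le
    (μ := volume.restrict (ball (0 : Plane) 1))
    (F := fun t y => f y * inner ℝ (gradGreen ε (x + t • e) y) e)
    (F' := fun t y => f y * hessGreen ε e (x + t • e) y)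
    (bound := fun _ => F * (6 * (‖e‖ ^ 2 / ε ^ 2)))
    hopen (Eventually.of_forall hmeas) ?_ ?_ ?_ (integrableOn_const (by simp)) ?_).2
  · refine key.congr_of_eventuallyEq ?_
    filter_upwards [hopen] with s hs
    exact inner_gradPotential hf ε hs e
  · refine (integrableOn_const (C := F * (|ε|⁻¹ * ‖e‖)) (by simp)).mono' (hmeas t) ?_
    filter_upwards [ae_restrict_mem measurableSet_ball] with y hy
    have hy' := hF y (ball_subset_closedBall hy)
    rw [norm_mul]
    gcongr
    · exact (norm_nonneg _).trans hy'
    · refine (norm_inner_le_norm _ _).trans ?_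
      gcongr
      exact norm_gradGreen_le_const hε _ (norm_lt_one_of_mem hy).le
  · exact (aestronglyMeasurable_of_continuousOn hf).mul
      ((measurable_hessGreen ε e).comp measurable_prodMk_left).aestronglyMeasurable
  · filter_upwards [ae_restrict_mem measurableSet_ball] with y hy s hs
    have hy' := hF y (ball_subset_closedBall hy)
    rw [norm_mul]
    gcongr
    · exact (norm_nonneg _).trans hy'
    · exact abs_hessGreen_le_const hε _ e (norm_lt_one_of_mem hy).le
  · exact Eventually.of_forall fun y s _ => (hasDerivAt_inner_gradGreen_line hε x e y s).const_mul _

end Potential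

/-- Total mass of the error kernel that controls `gradGreen ε - gradGreen 0`. -/
noncomputable def gradError (ε : ℝ) : ℝ :=
  ∫ z in ball (0 : Plane) 2, ε ^ 2 / (‖z‖ * (‖z‖ ^ 2 + ε ^ 2))

lemma error_kernel_nonneg (ε : ℝ) (z : Plane) : 0 ≤ ε ^ 2 / (‖z‖ * (‖z‖ ^ 2 + ε ^ 2)) := by
  positivity

lemma error_kernel_le (ε : ℝ) (z : Plane) : ε ^ 2 / (‖z‖ * (‖z‖ ^ 2 + ε ^ 2)) ≤ ‖z‖⁻¹ := by
  rw [mul_comm, ← div_div, div_eq_mul_inv _ ‖z‖]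
  exact mul_le_of_le_one_left (by positivity)
    (div_le_one_of_le₀ (by nlinarith [sq_nonneg ‖z‖]) (by positivity))

lemma measurable_error_kernel (ε : ℝ) :
    Measurable fun z : Plane => ε ^ 2 / (‖z‖ * (‖z‖ ^ 2 + ε ^ 2)) := by fun_prop

lemma tendsto_gradError : Tendsto gradError (𝓝[>] 0) (𝓝 0) := by
  have h : Tendsto gradError (𝓝[>] 0) (𝓝 (∫ z in ball (0 : Plane) 2, (0:ℝ))) := by
    refine tendsto_integral_filter_of_dominated_convergence (fun z => ‖z‖⁻¹)
      (Eventually.of_forall fun ε => (measurable_error_kernel ε).aestronglyMeasurable) ?_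
      (integrableOn_inv_norm_zero 2) ?_
    · refine Eventually.of_forall fun ε => Eventually.of_forall fun z => ?_
      rw [norm_of_nonneg (error_kernel_nonneg ε z)]
      exact error_kernel_le ε z
    · have hz : ∀ᵐ z ∂(volume : Measure Plane), z ≠ 0 := by
        filter_upwards [compl_mem_ae_iff.2 (measure_singleton (0 : Plane))] with z hz using hz
      filter_upwards [ae_restrict_of_ae hz] with z hz
      have hz' : ‖z‖ ≠ 0 := norm_ne_zero_iff.2 hz
      have : ContinuousAt (fun ε : ℝ => ε ^ 2 / (‖z‖ * (‖z‖ ^ 2 + ε ^ 2))) 0 := by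
        refine ContinuousAt.div (by fun_prop) (by fun_prop) ?_
        simp [hz']
      have h2 := this.tendsto.mono_left (nhdsWithin_le_nhds (s := Set.Ioi 0))
      simpa using h2
  simpa using h

section

variable {f : Plane → ℝ} {F : ℝ}

lemma norm_gradPotential_sub_le (hf : ContinuousOn f (closedBall 0 1))
    (hF : ∀ y ∈ closedBall (0 : Plane) 1, |f y| ≤ F) (ε : ℝ) {x : Plane}
    (hx : x ∈ ball (0 : Plane) 1) :
    ‖gradPotential ε f x - gradPotential 0 f x‖ ≤ F * (π⁻¹ * gradError ε) := by
  have hF0 : 0 ≤ F := (abs_nonneg _).trans (hF 0 (by simp))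
  have hint2 : IntegrableOn (fun y => ε ^ 2 / (‖x - y‖ * (‖x - y‖ ^ 2 + ε ^ 2))) (ball x 2) := by
    refine (integrableOn_inv_norm_sub_ball x 2).mono'
      ((measurable_error_kernel ε).comp (measurable_const.sub measurable_id)).aestronglyMeasurable
      (Eventually.of_forall fun y => ?_)
    rw [norm_of_nonneg (error_kernel_nonneg ε (x - y))]
    exact error_kernel_le ε (x - y)
  have hsub := ball_one_subset_ball_two hx
  have hint := hint2.mono_set hsub
  rw [gradPotential, gradPotential,
    ← integral_sub (integrable_smul_gradGreen hf ε hx) (integrable_smul_gradGreen hf 0 hx)]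
  calc _ ≤ ∫ y in ball (0 : Plane) 1,
        F * (π⁻¹ * (ε ^ 2 / (‖x - y‖ * (‖x - y‖ ^ 2 + ε ^ 2)))) := by
        refine norm_integral_le_of_norm_le ((hint.const_mul _).const_mul _) ?_
        filter_upwards [ae_mem_ball_and_ne x] with y ⟨hy, hxy⟩
        rw [← smul_sub, norm_smul, norm_eq_abs]
        gcongr
        · exact hF y (ball_subset_closedBall hy)
        · exact norm_gradGreen_sub_le ε (norm_lt_one_of_mem hx).le (norm_lt_one_of_mem hy).le hxy
    _ = F * (π⁻¹ * ∫ y in ball (0 : Plane) 1, ε ^ 2 / (‖x - y‖ * (‖x - y‖ ^ 2 + ε ^ 2))) := by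
        rw [integral_const_mul, integral_const_mul]
    _ ≤ F * (π⁻¹ * ∫ y in ball x 2, ε ^ 2 / (‖x - y‖ * (‖x - y‖ ^ 2 + ε ^ 2))) := by
        have := setIntegral_mono_set hint2
          (Eventually.of_forall fun y => error_kernel_nonneg ε (x - y))
          hsub.eventuallyLE
        exact mul_le_mul_of_nonneg_left (mul_le_mul_of_nonneg_left this (by positivity)) hF0
    _ = _ := by
        rw [setIntegral_ball_sub (fun z => ε ^ 2 / (‖z‖ * (‖z‖ ^ 2 + ε ^ 2))), gradError]

lemma tendsto_potential (hf : ContinuousOn f (closedBall 0 1)) {x : Plane}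
    (hx : x ∈ ball (0 : Plane) 1) :
    Tendsto (fun ε => potential ε f x) (𝓝[>] 0) (𝓝 (potential 0 f x)) := by
  refine tendsto_integral_filter_of_dominated_convergence (fun y => |f y| * ‖x - y‖⁻¹)
    (Eventually.of_forall fun ε => aestronglyMeasurable_mul_green hf ε x) ?_
    (integrable_mul_inv_norm hf hx) ?_
  · refine Eventually.of_forall fun ε => ?_
    filter_upwards [ae_mem_ball_and_ne x] with y ⟨hy, hxy⟩
    rw [norm_mul, norm_eq_abs, norm_eq_abs]
    gcongr
    exact abs_green_le ε (norm_lt_one_of_mem hx).le (norm_lt_one_of_mem hy).le hxy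
  · filter_upwards [ae_mem_ball_and_ne x] with y ⟨hy, hxy⟩
    have h1 := imageSq_pos (norm_lt_one_of_mem hx) (norm_lt_one_of_mem hy).le
    have h2 : 0 < ‖x - y‖ := norm_pos_iff.2 (sub_ne_zero.2 hxy)
    have : ContinuousAt (fun ε : ℝ => f y * green ε x y) 0 := by
      unfold green
      refine continuousAt_const.mul (continuousAt_const.mul (ContinuousAt.sub ?_ ?_))
      · exact ContinuousAt.log (by fun_prop) (by simp [h1.ne'])
      · exact ContinuousAt.log (by fun_prop) (by simp [h2.ne'])
    exact this.tendsto.mono_left nhdsWithin_le_nhds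

lemma abs_potential_le
    (hF : ∀ y ∈ closedBall (0 : Plane) 1, |f y| ≤ F) (ε : ℝ) {x : Plane}
    (hx : x ∈ ball (0 : Plane) 1) : |potential ε f x| ≤ 2 * F * √(1 - ‖x‖ ^ 2) := by
  have hF0 : 0 ≤ F := (abs_nonneg _).trans (hF 0 (by simp))
  have h1 := norm_integral_le_of_norm_le (f := fun y => f y * green ε x y)
    (μ := volume.restrict (ball (0 : Plane) 1))
    (g := fun y => F * ((2 * π)⁻¹ * √(1 - ‖x‖ ^ 2)) * ‖x - y‖⁻¹)
    ((integrableOn_inv_norm_sub hx).const_mul _) (by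
      filter_upwards [ae_mem_ball_and_ne x] with y ⟨hy, hxy⟩
      have hx1 := (norm_lt_one_of_mem hx).le
      have hy1 := (norm_lt_one_of_mem hy).le
      rw [norm_mul, norm_eq_abs, norm_eq_abs, abs_of_nonneg (green_nonneg hx1 hy1 (.inl hxy)),
        mul_assoc F]
      have := green_nonneg hx1 hy1 (ε := ε) (.inl hxy)
      gcongr
      · exact hF y (ball_subset_closedBall hy)
      · exact green_le ε hx1 hy1 hxy)
  refine h1.trans ?_
  rw [integral_const_mul]
  calc _ ≤ F * ((2 * π)⁻¹ * √(1 - ‖x‖ ^ 2)) * (4 * π) := by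
        gcongr; exact integral_inv_norm_sub_le hx
    _ = _ := by field_simp; ring

lemma continuousOn_potential (hf : ContinuousOn f (closedBall 0 1)) {ε : ℝ} (hε : ε ≠ 0) :
    ContinuousOn (potential ε f) (ball 0 1) := by
  obtain ⟨F, hF⟩ := (isCompact_closedBall (0 : Plane) 1).exists_bound_of_continuousOn hf
  have hε2 : 0 < ε ^ 2 := by positivity
  have hcont : ∀ y, Continuous fun x => f y * green ε x y := by
    intro y
    unfold green
    refine continuous_const.mul (continuous_const.mul (Continuous.sub ?_ ?_))
    · refine Continuous.log (by unfold imageSq; fun_prop) fun x => ?_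
      have := imageSq_nonneg x y
      positivity
    · exact Continuous.log (by fun_prop) fun x => by positivity
  intro x hx
  refine ContinuousWithinAt.congr (f := fun x => ∫ y in ball (0 : Plane) 1, f y * green ε x y) ?_
    (fun _ _ => rfl) rfl
  refine continuousWithinAt_of_dominated
    (bound := fun _ => F * ((4 * π)⁻¹ * (log (4 + ε ^ 2) - log (ε ^ 2))))
    (Eventually.of_forall fun x => aestronglyMeasurable_mul_green hf ε x) ?_
    (integrableOn_const (by simp)) (Eventually.of_forall fun y => (hcont y).continuousWithinAt)
  filter_upwards [self_mem_nhdsWithin] with z hz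
  filter_upwards [ae_restrict_mem measurableSet_ball] with y hy
  have hz1 := (norm_lt_one_of_mem hz).le
  have hy1 := (norm_lt_one_of_mem hy).le
  have hF' := hF y (ball_subset_closedBall hy)
  rw [norm_mul, norm_eq_abs (green _ _ _), abs_of_nonneg (green_nonneg hz1 hy1 (.inr hε))]
  refine mul_le_mul hF' ?_ (green_nonneg hz1 hy1 (.inr hε)) ((norm_nonneg _).trans hF')
  · rw [green]
    have h4 : imageSq z y ≤ 4 := by
      rw [imageSq]
      have h := (abs_real_inner_le_norm z y)
      have h1 : ‖z‖ * ‖y‖ ≤ 1 := mul_le_one₀ hz1 (norm_nonneg _) hy1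
      have h2 : ‖z‖ ^ 2 * ‖y‖ ^ 2 ≤ 1 := by
        rw [← mul_pow]; exact pow_le_one₀ (by positivity) h1
      linarith [neg_abs_le (inner ℝ z y)]
    have := imageSq_nonneg z y
    gcongr
    nlinarith [sq_nonneg ‖z - y‖]

/-- The (negative) Laplacian of the regularised potential. -/
lemma sum_integral_hessGreen (hf : ContinuousOn f (closedBall 0 1)) {ε : ℝ} (hε : ε ≠ 0)
    (x : Plane) :
    ∑ i : Fin 2, ∫ y in ball (0 : Plane) 1, f y * hessGreen ε (EuclideanSpace.single i 1) x y
      = ∫ y in ball (0 : Plane) 1, f y * (π⁻¹ * (‖y‖ ^ 2 * (ε ^ 2 / (imageSq x y + ε ^ 2) ^ 2)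
        - ε ^ 2 / (‖x - y‖ ^ 2 + ε ^ 2) ^ 2)) := by
  obtain ⟨F, hF⟩ := (isCompact_closedBall (0 : Plane) 1).exists_bound_of_continuousOn hf
  rw [← integral_finsetSum]
  · congr 1; ext y
    rw [← Finset.mul_sum, sum_hessGreen hε]
  · intro i _
    refine (integrableOn_const (C := F * (6 * (‖EuclideanSpace.single i (1:ℝ)‖ ^ 2 / ε ^ 2)))
      (by simp)).mono' ((aestronglyMeasurable_of_continuousOn hf).mul
      ((measurable_hessGreen ε _).comp measurable_prodMk_left).aestronglyMeasurable) ?_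
    filter_upwards [ae_restrict_mem measurableSet_ball] with y hy
    have hy' := hF y (ball_subset_closedBall hy)
    rw [norm_mul]
    gcongr
    · exact (norm_nonneg _).trans hy'
    · exact abs_hessGreen_le_const hε _ _ (norm_lt_one_of_mem hy).le

/-- Uniformly on compact subsets of the ball, the Laplacian of the regularised potential
tends to `-f`. -/
lemma abs_add_laplacian_potential_le (hf : ContinuousOn f (closedBall 0 1))
    (hF : ∀ y ∈ closedBall (0 : Plane) 1, |f y| ≤ F) {ε δ r τ : ℝ} (hε : 0 < ε) (hδ : 0 < δ)
    (hr : r + δ ≤ 1) (hτ : ∀ y ∈ closedBall (0 : Plane) 1, ∀ x ∈ closedBall (0 : Plane) 1,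
      ‖x - y‖ < δ → |f x - f y| ≤ τ) {x : Plane} (hx : ‖x‖ ≤ r) :
    |f x + ∑ i : Fin 2, ∫ y in ball (0 : Plane) 1,
        f y * hessGreen ε (EuclideanSpace.single i 1) x y|
      ≤ τ + 4 * F * (ε ^ 2 / δ ^ 4) := by
  have hx1 : x ∈ ball (0 : Plane) 1 := by rw [mem_ball_zero_iff]; linarith
  have hxc := ball_subset_closedBall hx1
  have hF0 : 0 ≤ F := (abs_nonneg _).trans (hF 0 (by simp))
  have hτ0 : 0 ≤ τ := (abs_nonneg _).trans (hτ x hxc x hxc (by simpa using hδ))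
  have hfm := aestronglyMeasurable_of_continuousOn hf
  set B := ball (0 : Plane) 1 with hB
  set k : Plane → ℝ := fun y => ε ^ 2 / (‖x - y‖ ^ 2 + ε ^ 2) ^ 2 with hk
  set j : Plane → ℝ := fun y => ‖y‖ ^ 2 * (ε ^ 2 / (imageSq x y + ε ^ 2) ^ 2) with hj
  have hk0 : ∀ y, 0 ≤ k y := fun y => by positivity
  have hkb : ∀ y, k y ≤ ε ^ 2 / (ε ^ 2) ^ 2 := fun y => by
    simp only [hk]; gcongr; nlinarith [sq_nonneg ‖x - y‖]
  have hkm : Measurable k := by simp only [hk]; fun_prop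
  have hki : IntegrableOn k B :=
      (integrableOn_const (C := ε ^ 2 / (ε ^ 2) ^ 2) (by simp [hB])).mono'
    hkm.aestronglyMeasurable (Eventually.of_forall fun y => by
      rw [norm_of_nonneg (hk0 y)]; exact hkb y)
  have hjm : Measurable j := by simp only [hj, imageSq]; fun_prop
  have hj0 : ∀ y, 0 ≤ j y := fun y => by positivity
  have hjb : ∀ y ∈ B, j y ≤ ε ^ 2 / δ ^ 4 := fun y hy => by
    have hy1 := (norm_lt_one_of_mem hy).le
    have h1 : δ ^ 2 ≤ imageSq x y := le_trans (by
      have : δ ≤ 1 - ‖x‖ := by linarith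
      gcongr) (one_sub_sq_le_imageSq (norm_lt_one_of_mem hx1).le hy1)
    calc j y ≤ 1 * (ε ^ 2 / (δ ^ 2) ^ 2) := by
          simp only [hj]
          have : δ ^ 2 ≤ imageSq x y + ε ^ 2 := by nlinarith [sq_nonneg ε]
          gcongr
          exact pow_le_one₀ (norm_nonneg _) hy1
      _ = _ := by ring
  have hball : ball x δ ⊆ B := fun y hy => by
    rw [hB, mem_ball_zero_iff]
    rw [mem_ball, dist_eq_norm] at hy
    linarith [norm_le_norm_add_norm_sub x y, norm_sub_rev x y]
  have hfk : IntegrableOn (fun y => f y * k y) B := hki.bdd_mul (c := F) hfm (by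
    filter_upwards [ae_restrict_mem measurableSet_ball] with y hy
    exact hF y (ball_subset_closedBall hy))
  have hji : IntegrableOn j B := (integrableOn_const (C := ε ^ 2 / δ ^ 4) (by simp [hB])).mono'
    hjm.aestronglyMeasurable (by
      filter_upwards [ae_restrict_mem measurableSet_ball] with y hy
      rw [norm_of_nonneg (hj0 y)]; exact hjb y hy)
  have hfj : IntegrableOn (fun y => f y * j y) B := hji.bdd_mul (c := F) hfm (by
    filter_upwards [ae_restrict_mem measurableSet_ball] with y hy
    exact hF y (ball_subset_closedBall hy))
  have hvol : volume.real B = π := by rw [hB, volume_real_ball_plane 0 zero_le_one]; ring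
  have e1 : ∫ y in B, f y * (π⁻¹ * (j y - k y))
      = π⁻¹ * ((∫ y in B, f y * j y) - ∫ y in B, f y * k y) := by
    rw [← integral_sub hfj hfk, ← integral_const_mul]
    congr 1; ext y; ring
  -- the image part
  have e2 : |∫ y in B, f y * j y| ≤ F * (ε ^ 2 / δ ^ 4) * π := by
    have := norm_setIntegral_le_of_norm_le_const (μ := volume) (s := B) (C := F * (ε ^ 2 / δ ^ 4))
      (f := fun y => f y * j y) (by simp [hB]) (fun y hy => by
        rw [norm_mul, norm_eq_abs, norm_of_nonneg (hj0 y)]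
        exact mul_le_mul (hF y (ball_subset_closedBall hy)) (hjb y hy) (hj0 y) hF0)
    rwa [hvol] at this
  have hinner : ∫ y in ball x δ, k y = π * (1 - ε ^ 2 / (δ ^ 2 + ε ^ 2)) :=
    integral_approx_identity_ball x hδ.le hε
  have htail : ∀ y ∈ B \ ball x δ, k y ≤ ε ^ 2 / δ ^ 4 := fun y hy => by
    have h1 : δ ≤ ‖x - y‖ := by
      have := hy.2
      rw [mem_ball, not_lt, dist_comm, dist_eq_norm] at this
      exact this
    calc k y ≤ ε ^ 2 / (δ ^ 2) ^ 2 := by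
          simp only [hk]
          have : δ ^ 2 ≤ ‖x - y‖ ^ 2 + ε ^ 2 := by nlinarith [sq_nonneg ε]
          gcongr
      _ = _ := by ring
  have e3 : |∫ y in B, (f y - f x) * k y| ≤ τ * π + 2 * F * (ε ^ 2 / δ ^ 4) * π := by
    have hi : IntegrableOn (fun y => (f y - f x) * k y) B := by
      refine (hfk.sub (hki.const_mul (f x))).congr (Eventually.of_forall fun y => ?_)
      simp only [Pi.sub_apply]; ring
    have hsplit : ∫ y in B, (f y - f x) * k y = (∫ y in B \ ball x δ, (f y - f x) * k y)
        + ∫ y in ball x δ, (f y - f x) * k y := by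
      rw [add_comm, ← setIntegral_union Set.disjoint_sdiff_right
        (measurableSet_ball.diff measurableSet_ball)
        (hi.mono_set hball) (hi.mono_set Set.sdiff_subset), Set.union_sdiff_cancel hball]
    have t1 : |∫ y in B \ ball x δ, (f y - f x) * k y| ≤ 2 * F * (ε ^ 2 / δ ^ 4) * π := by
      have := norm_setIntegral_le_of_norm_le_const (μ := volume) (s := B \ ball x δ)
        (C := 2 * F * (ε ^ 2 / δ ^ 4)) (f := fun y => (f y - f x) * k y)
        ((measure_mono Set.sdiff_subset).trans_lt (by simp [hB])) (fun y hy => by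
          rw [norm_mul, norm_eq_abs, norm_of_nonneg (hk0 y)]
          refine mul_le_mul ?_ (htail y hy) (hk0 y) (by positivity)
          have h1 := hF y (ball_subset_closedBall hy.1)
          have h2 := hF x hxc
          linarith [abs_sub (f y) (f x)])
      refine this.trans ?_
      rw [← hvol]
      gcongr
      · simp [hB]
      · exact Set.sdiff_subset
    have t2 : |∫ y in ball x δ, (f y - f x) * k y| ≤ τ * π := by
      calc ‖∫ y in ball x δ, (f y - f x) * k y‖ ≤ ∫ y in ball x δ, τ * k y := by
            refine norm_integral_le_of_norm_le ((hki.mono_set hball).const_mul τ) ?_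
            filter_upwards [ae_restrict_mem measurableSet_ball] with y hy
            rw [norm_mul, norm_eq_abs, norm_of_nonneg (hk0 y)]
            refine mul_le_mul_of_nonneg_right ?_ (hk0 y)
            refine hτ x hxc y (ball_subset_closedBall (hball hy)) ?_
            rwa [mem_ball, dist_eq_norm] at hy
        _ = τ * (π * (1 - ε ^ 2 / (δ ^ 2 + ε ^ 2))) := by rw [integral_const_mul, hinner]
        _ ≤ τ * (π * 1) := by
            have : 0 ≤ ε ^ 2 / (δ ^ 2 + ε ^ 2) := by positivity
            gcongr; linarith
        _ = _ := by ring
    rw [hsplit]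
    exact (abs_add_le _ _).trans (by linarith)
  have e4 : |f x * (π - ∫ y in B, k y)| ≤ F * (ε ^ 2 / δ ^ 4) * π := by
    have hsplit : ∫ y in B, k y = (∫ y in B \ ball x δ, k y) + ∫ y in ball x δ, k y := by
      rw [add_comm, ← setIntegral_union Set.disjoint_sdiff_right
        (measurableSet_ball.diff measurableSet_ball)
        (hki.mono_set hball) (hki.mono_set Set.sdiff_subset), Set.union_sdiff_cancel hball]
    have t0 : 0 ≤ ∫ y in B \ ball x δ, k y := integral_nonneg hk0
    have t1 : ∫ y in B \ ball x δ, k y ≤ ε ^ 2 / δ ^ 4 * π := by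
      calc ∫ y in B \ ball x δ, k y ≤ ∫ y in B \ ball x δ, ε ^ 2 / δ ^ 4 :=
            setIntegral_mono_on (hki.mono_set Set.sdiff_subset) (integrableOn_const
              ((measure_mono Set.sdiff_subset).trans_lt (by simp [hB])).ne)
              (measurableSet_ball.diff measurableSet_ball) htail
        _ ≤ ε ^ 2 / δ ^ 4 * π := by
            rw [setIntegral_const, smul_eq_mul, ← hvol, mul_comm]
            gcongr
            · simp [hB]
            · exact Set.sdiff_subset
    have t2 : ε ^ 2 / (δ ^ 2 + ε ^ 2) ≤ ε ^ 2 / δ ^ 4 := by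
      have hδ1 : δ ≤ 1 := by linarith [norm_nonneg x]
      have : δ ^ 4 ≤ δ ^ 2 := pow_le_pow_of_le_one hδ.le hδ1 (by norm_num)
      gcongr
      nlinarith [sq_nonneg ε]
    have t3 : 0 ≤ ε ^ 2 / (δ ^ 2 + ε ^ 2) := by positivity
    have t4 : |π - ∫ y in B, k y| ≤ ε ^ 2 / δ ^ 4 * π := by
      rw [hsplit, hinner, abs_le]
      constructor <;> nlinarith [pi_pos, mul_le_mul_of_nonneg_right t2 pi_pos.le]
    rw [abs_mul, mul_assoc]
    exact mul_le_mul (hF x hxc) t4 (abs_nonneg _) hF0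
  have e5 : ∫ y in B, (f y - f x) * k y = (∫ y in B, f y * k y) - f x * ∫ y in B, k y := by
    rw [← integral_const_mul, ← integral_sub hfk (hki.const_mul _)]
    congr 1; ext y; ring
  rw [sum_integral_hessGreen hf hε.ne' x]
  simp only [← hB]
  rw [e1]
  have e6 : f x + π⁻¹ * ((∫ y in B, f y * j y) - ∫ y in B, f y * k y)
      = π⁻¹ * ((∫ y in B, f y * j y) - (∫ y in B, (f y - f x) * k y)
        + f x * (π - ∫ y in B, k y)) := by
    rw [e5]; field_simp; ring
  rw [e6, abs_mul, abs_of_pos (inv_pos.2 pi_pos), inv_mul_le_iff₀ pi_pos]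
  calc _ ≤ |∫ y in B, f y * j y| + |∫ y in B, (f y - f x) * k y|
        + |f x * (π - ∫ y in B, k y)| :=
        (abs_add_le _ _).trans (by gcongr; exact abs_sub _ _)
    _ ≤ _ := by linarith

end

lemma second_deriv_nonpos_of_isLocalMax {g g' : ℝ → ℝ} {c : ℝ}
    (hg : ∀ᶠ t in 𝓝 (0:ℝ), HasDerivAt g (g' t) t) (hg' : HasDerivAt g' c 0)
    (hmax : IsLocalMax g 0) : c ≤ 0 := by
  by_contra! hc
  have h1 : deriv g =ᶠ[𝓝 0] g' := hg.mono fun t ht => ht.deriv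
  have h2 : deriv (deriv g) 0 = c := by rw [h1.deriv_eq]; exact hg'.deriv
  have hmin : IsLocalMin g 0 :=
    isLocalMin_of_deriv_deriv_pos (by rw [h2]; exact hc) hmax.deriv_eq_zero
      hg.self_of_nhds.continuousAt
  have hconst : g =ᶠ[𝓝 0] fun _ => g 0 := by
    filter_upwards [hmax, hmin] with t h3 h4 using le_antisymm h3 h4
  have h5 : deriv g =ᶠ[𝓝 0] fun _ => 0 := hconst.deriv.trans (by simp)
  rw [h5.deriv_eq] at h2
  simp at h2
  exact hc.ne h2

/-- Weak maximum principle, for functions with a strictly positive (line-wise) Laplacian. -/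
lemma exists_sphere_ge {w : Plane → ℝ} {r : ℝ} (hr : 0 ≤ r)
    (hw : ContinuousOn w (closedBall 0 r))
    (hlap : ∀ x ∈ ball (0 : Plane) r, ∃ c : Fin 2 → ℝ, 0 < ∑ i, c i ∧ ∀ i, ∃ g' : ℝ → ℝ,
      (∀ᶠ t in 𝓝 (0:ℝ),
        HasDerivAt (fun t : ℝ => w (x + t • EuclideanSpace.single i (1:ℝ))) (g' t) t) ∧
      HasDerivAt g' (c i) 0) {x : Plane} (hx : x ∈ closedBall 0 r) :
    ∃ z ∈ sphere (0 : Plane) r, w x ≤ w z := by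
  obtain ⟨z, hz, hmax⟩ := (isCompact_closedBall (0 : Plane) r).exists_isMaxOn
    ⟨0, by simpa using hr⟩ hw
  refine ⟨z, ?_, hmax hx⟩
  by_contra hzs
  have hzb : z ∈ ball (0 : Plane) r := by
    rw [mem_ball]; exact lt_of_le_of_ne hz hzs
  obtain ⟨c, hc, h⟩ := hlap z hzb
  have : ∑ i, c i ≤ 0 := Finset.sum_nonpos fun i _ => by
    obtain ⟨g', h1, h2⟩ := h i
    refine second_deriv_nonpos_of_isLocalMax h1 h2 ?_
    have ho : IsOpen {t : ℝ | z + t • EuclideanSpace.single i (1:ℝ) ∈ ball (0 : Plane) r} :=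
      isOpen_ball.preimage (by fun_prop)
    filter_upwards [ho.mem_nhds (by simpa using hzb)] with t ht
    simpa using hmax (ball_subset_closedBall ht)
  linarith

lemma hasDerivAt_line_of_contDiffOn {u : Plane → ℝ} (hu : ContDiffOn ℝ 2 u (ball 0 1)) (x e : Plane)
    {t : ℝ} (ht : x + t • e ∈ ball (0 : Plane) 1) :
    HasDerivAt (fun t : ℝ => u (x + t • e)) (fderiv ℝ u (x + t • e) e) t := by
  have h := ((hu.contDiffAt (isOpen_ball.mem_nhds ht)).differentiableAt (by norm_num)).hasFDerivAt
  exact h.comp_hasDerivAt t (((hasDerivAt_id t).smul_const e).const_add x |>.congr_deriv (by simp))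

lemma hasDerivAt_fderiv_line_of_contDiffOn {u : Plane → ℝ} (hu : ContDiffOn ℝ 2 u (ball 0 1))
    {x : Plane} (hx : x ∈ ball (0 : Plane) 1) (e : Plane) :
    HasDerivAt (fun t : ℝ => fderiv ℝ u (x + t • e) e)
      (fderiv ℝ (fun y => fderiv ℝ u y e) x e) 0 := by
  have h1 : ContDiffOn ℝ 1 (fderiv ℝ u) (ball 0 1) :=
    hu.fderiv_of_isOpen isOpen_ball (by norm_num)
  have h2 : DifferentiableAt ℝ (fun y => fderiv ℝ u y e) x :=
    ((h1.contDiffAt (isOpen_ball.mem_nhds hx)).differentiableAt (by norm_num)).clm_apply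
      (differentiableAt_const e)
  have h3 : HasFDerivAt (fun y => fderiv ℝ u y e) (fderiv ℝ (fun y => fderiv ℝ u y e) x)
      (x + (0:ℝ) • e) := by simpa using h2.hasFDerivAt
  have h4 : HasDerivAt (fun t : ℝ => x + t • e) e 0 :=
    ((hasDerivAt_id (0:ℝ)).smul_const e).const_add x |>.congr_deriv (by simp)
  exact h3.comp_hasDerivAt 0 h4

lemma hasDerivAt_norm_sq_line (x e : Plane) (t : ℝ) :
    HasDerivAt (fun t : ℝ => ‖x + t • e‖ ^ 2) (2 * inner ℝ x e + 2 * t * ‖e‖ ^ 2) t := by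
  have h : (fun t : ℝ => ‖x + t • e‖ ^ 2)
      = fun t => ‖x‖ ^ 2 + 2 * t * inner ℝ x e + t ^ 2 * ‖e‖ ^ 2 := by
    ext t
    rw [norm_add_sq_real, inner_smul_right, norm_smul, mul_pow, norm_eq_abs, sq_abs]; ring
  rw [h]
  have h1 := ((((hasDerivAt_id t).const_mul 2).mul_const (inner ℝ x e)).const_add (‖x‖ ^ 2)).add
    (((hasDerivAt_id t).pow 2).mul_const (‖e‖ ^ 2))
  refine h1.congr_deriv ?_
  simp

section Representation

variable {u f : Plane → ℝ}

lemma sub_potential_le_of_boundary (hu : ContDiffOn ℝ 2 u (ball 0 1))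
    (hf : ContinuousOn f (closedBall 0 1)) {σ : ℝ} {ε τ η r : ℝ} (hσ : σ = 1 ∨ σ = -1)
    (hlap : ∀ x ∈ ball (0 : Plane) 1, -lap u x = f x) (hε : ε ≠ 0) (hτ : 0 < τ)
    (hr : 0 ≤ r) (hr1 : r < 1)
    (hclose : ∀ x : Plane, ‖x‖ ≤ r → |f x + ∑ i : Fin 2, ∫ y in ball (0 : Plane) 1,
        f y * hessGreen ε (EuclideanSpace.single i 1) x y| ≤ 2 * τ)
    (hbd : ∀ x ∈ sphere (0 : Plane) r, |u x - potential ε f x| ≤ η) {x : Plane} (hx : ‖x‖ ≤ r) :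
    σ * (u x - potential ε f x) ≤ η + τ := by
  have hsub : closedBall (0 : Plane) r ⊆ ball 0 1 := closedBall_subset_ball hr1
  have hσ2 : |σ| = 1 := by rcases hσ with h | h <;> simp [h]
  have hcont : ContinuousOn (fun x => σ * (u x - potential ε f x) + τ * ‖x‖ ^ 2)
      (closedBall 0 r) :=
    (continuousOn_const.mul ((hu.continuousOn.mono hsub).sub
      ((continuousOn_potential hf hε).mono hsub))).add (by fun_prop)
  have hmax : ∃ z ∈ sphere (0 : Plane) r, σ * (u x - potential ε f x) + τ * ‖x‖ ^ 2
      ≤ σ * (u z - potential ε f z) + τ * ‖z‖ ^ 2 := by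
    refine exists_sphere_ge hr hcont ?_ (by simpa using hx)
    intro x hx
    have hxr : ‖x‖ ≤ r := by simpa using (ball_subset_closedBall hx)
    have hx1 : x ∈ ball (0 : Plane) 1 := hsub (ball_subset_closedBall hx)
    refine ⟨fun i => σ * (fderiv ℝ (fun y => fderiv ℝ u y (EuclideanSpace.single i 1)) x
      (EuclideanSpace.single i 1) - ∫ y in ball (0 : Plane) 1,
        f y * hessGreen ε (EuclideanSpace.single i 1) x y) + τ * 2, ?_, fun i => ?_⟩
    · have h1 := hclose x hxr
      have h2 := hlap x hx1
      rw [lap] at h2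
      rw [Finset.sum_add_distrib, ← Finset.mul_sum, Finset.sum_sub_distrib]
      have h3 : |σ * (f x + ∑ i : Fin 2, ∫ y in ball (0 : Plane) 1,
        f y * hessGreen ε (EuclideanSpace.single i 1) x y)| ≤ 2 * τ := by
        rwa [abs_mul, hσ2, one_mul]
      have h4 := (abs_le.1 h3).2
      rw [← h2] at h4
      simp only [Finset.sum_const, Finset.card_univ, Fintype.card_fin, nsmul_eq_mul]
      push_cast
      linarith
    · set e : Plane := EuclideanSpace.single i (1:ℝ) with he
      have hen : ‖e‖ = 1 := by simp [he]
      refine ⟨fun t => σ * (fderiv ℝ u (x + t • e) e - inner ℝ (gradPotential ε f (x + t • e)) e)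
        + τ * (2 * inner ℝ x e + 2 * t * ‖e‖ ^ 2), ?_, ?_⟩
      · filter_upwards [(isOpen_line_mem_ball x e).mem_nhds (x := 0) (by simpa using hx1)] with t ht
        exact (((hasDerivAt_line_of_contDiffOn hu x e ht).sub
          (hasDerivAt_potential_line hf hε x e ht)).const_mul σ).add
          ((hasDerivAt_norm_sq_line x e t).const_mul τ)
      · have h0 := hasDerivAt_gradPotential_line hf hε x e (t := 0) (by simpa using hx1)
        simp only [zero_smul, add_zero] at h0
        have h1 : HasDerivAt (fun t : ℝ => 2 * inner ℝ x e + 2 * t * ‖e‖ ^ 2) 2 0 := by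
          refine ((((hasDerivAt_id (0:ℝ)).const_mul 2).mul_const (‖e‖ ^ 2)).const_add
            (2 * inner ℝ x e)).congr_deriv ?_
          simp [hen]
        exact (((hasDerivAt_fderiv_line_of_contDiffOn hu hx1 e).sub h0).const_mul σ).add
          (h1.const_mul τ)
  obtain ⟨z, hz, h⟩ := hmax
  have h1 := hbd z hz
  have hz' : ‖z‖ = r := by simpa using hz
  have h2 : σ * (u z - potential ε f z) ≤ η := by
    refine (le_abs_self _).trans ?_
    rwa [abs_mul, hσ2, one_mul]
  have h3 : τ * ‖z‖ ^ 2 ≤ τ * 1 := by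
    rw [hz']; gcongr; exact pow_le_one₀ hr hr1.le
  have h4 : 0 ≤ τ * ‖x‖ ^ 2 := by positivity
  linarith

lemma exists_radius_small (huc : ContinuousOn u (closedBall 0 1))
    (hb : ∀ x ∈ sphere (0 : Plane) 1, u x = 0) {η : ℝ} (hη : 0 < η) :
    ∃ r₀ < 1, ∀ x : Plane, r₀ < ‖x‖ → ‖x‖ ≤ 1 → |u x| ≤ η := by
  obtain ⟨δ, hδ, h⟩ := Metric.uniformContinuousOn_iff.1
    ((isCompact_closedBall (0 : Plane) 1).uniformContinuousOn_of_continuous huc) η hη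
  refine ⟨max (1 - δ) 0, max_lt (by linarith) one_pos, fun x hx hx1 => ?_⟩
  have hx0 : 0 < ‖x‖ := (le_max_right _ _).trans_lt hx
  have hx2 : 1 - δ < ‖x‖ := (le_max_left _ _).trans_lt hx
  set z : Plane := ‖x‖⁻¹ • x with hz
  have hzn : ‖z‖ = 1 := by rw [hz, norm_smul, norm_inv, norm_norm, inv_mul_cancel₀ hx0.ne']
  have hdist : dist x z < δ := by
    have : x - z = (1 - ‖x‖⁻¹) • x := by rw [hz]; module
    rw [dist_eq_norm, this, norm_smul, ← norm_norm x, ← norm_mul, norm_norm, sub_mul,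
      inv_mul_cancel₀ hx0.ne', norm_eq_abs, abs_lt]
    constructor <;> linarith
  have := h x (by simpa using hx1) z (by simp [hzn]) hdist
  rw [hb z (by simp [hzn]), dist_zero_right] at this
  exact this.le

/-- Green representation formula. -/
lemma eq_potential (hu : ContDiffOn ℝ 2 u (ball 0 1)) (huc : ContinuousOn u (closedBall 0 1))
    (hb : ∀ x ∈ sphere (0 : Plane) 1, u x = 0) (hf : ContinuousOn f (closedBall 0 1))
    (hlap : ∀ x ∈ ball (0 : Plane) 1, -lap u x = f x) {x : Plane} (hx : x ∈ ball (0 : Plane) 1) :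
    u x = potential 0 f x := by
  obtain ⟨F, hF⟩ := (isCompact_closedBall (0 : Plane) 1).exists_bound_of_continuousOn hf
  have hF0 : 0 ≤ F := (norm_nonneg _).trans (hF 0 (by simp))
  have key : ∀ η : ℝ, 0 < η → |u x - potential 0 f x| ≤ 3 * η := by
    intro η hη
    obtain ⟨r₀, hr₀, hsmall⟩ := exists_radius_small huc hb hη
    have hx1 := norm_lt_one_of_mem hx
    have hcont : ContinuousAt (fun r : ℝ => 2 * F * √(1 - r ^ 2)) 1 := by fun_prop
    have hev : ∀ᶠ r in 𝓝[<] (1:ℝ), 2 * F * √(1 - r ^ 2) < η :=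
      (hcont.tendsto.mono_left nhdsWithin_le_nhds).eventually_lt_const (by simpa using hη)
    obtain ⟨r, ⟨hrη, hr1⟩, hrm⟩ := ((hev.and self_mem_nhdsWithin).and
      (Ioo_mem_nhdsLT (max_lt hr₀ hx1))).exists
    have hr0 : r₀ < r := (le_max_left _ _).trans_lt hrm.1
    have hxr : ‖x‖ < r := (le_max_right _ _).trans_lt hrm.1
    have hrpos : 0 ≤ r := (norm_nonneg x).trans hxr.le
    obtain ⟨δ', hδ', hunif⟩ := Metric.uniformContinuousOn_iff.1
      ((isCompact_closedBall (0 : Plane) 1).uniformContinuousOn_of_continuous hf) η hη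
    set δ := min δ' (1 - r) with hδdef
    have hδ : 0 < δ := lt_min hδ' (by linarith)
    have hlim : ∀ᶠ ε in 𝓝[>] (0:ℝ), 4 * F * (ε ^ 2 / δ ^ 4) < η := by
      have : ContinuousAt (fun ε : ℝ => 4 * F * (ε ^ 2 / δ ^ 4)) 0 := by fun_prop
      exact (this.tendsto.mono_left nhdsWithin_le_nhds).eventually_lt_const (by simpa using hη)
    refine le_of_tendsto ((tendsto_const_nhds.sub (tendsto_potential hf hx)).abs) ?_
    filter_upwards [hlim, self_mem_nhdsWithin] with ε hε1 hε0
    simp only [Set.mem_Ioi] at hε0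
    have hclose : ∀ x : Plane, ‖x‖ ≤ r → |f x + ∑ i : Fin 2, ∫ y in ball (0 : Plane) 1,
        f y * hessGreen ε (EuclideanSpace.single i 1) x y| ≤ 2 * η := fun x hx => by
      refine (abs_add_laplacian_potential_le hf hF hε0 hδ (τ := η)
        (by linarith [min_le_right δ' (1 - r)]) ?_ hx).trans (by linarith)
      intro y hy x hx hxy
      refine (hunif x hx y hy ?_).le
      rw [dist_eq_norm]; exact hxy.trans_le (min_le_left _ _)
    have hbd : ∀ x ∈ sphere (0 : Plane) r, |u x - potential ε f x| ≤ 2 * η := fun z hz => by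
      have hz' : ‖z‖ = r := by simpa using hz
      have h1 := hsmall z (by rwa [hz']) (by rw [hz']; exact hr1.le)
      have h2 := abs_potential_le hF ε (x := z) (by rw [mem_ball_zero_iff, hz']; exact hr1)
      rw [hz'] at h2
      linarith [abs_sub (u z) (potential ε f z)]
    have h1 := sub_potential_le_of_boundary hu hf (.inl rfl) hlap hε0.ne' hη hrpos hr1 hclose hbd
      hxr.le
    have h2 := sub_potential_le_of_boundary hu hf (.inr rfl) hlap hε0.ne' hη hrpos hr1 hclose hbd
      hxr.le
    rw [abs_le]
    constructor <;> linarith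
  have h0 : |u x - potential 0 f x| ≤ 0 := by
    refine le_of_forall_pos_le_add fun η hη => ?_
    have := key (η / 3) (by positivity)
    linarith
  exact sub_eq_zero.1 (abs_nonpos_iff.1 h0)

lemma fderiv_eq_inner_gradPotential (hu : ContDiffOn ℝ 2 u (ball 0 1))
    (huc : ContinuousOn u (closedBall 0 1))
    (hb : ∀ x ∈ sphere (0 : Plane) 1, u x = 0) (hf : ContinuousOn f (closedBall 0 1))
    (hlap : ∀ x ∈ ball (0 : Plane) 1, -lap u x = f x) {x : Plane} (hx : x ∈ ball (0 : Plane) 1)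
    (e : Plane) : fderiv ℝ u x e = inner ℝ (gradPotential 0 f x) e := by
  obtain ⟨F, hF⟩ := (isCompact_closedBall (0 : Plane) 1).exists_bound_of_continuousOn hf
  have hF0 : 0 ≤ F := (norm_nonneg _).trans (hF 0 (by simp))
  have hx0 : (0:ℝ) ∈ {t : ℝ | x + t • e ∈ ball (0 : Plane) 1} := by simpa using hx
  have hunif : TendstoUniformlyOn (fun ε (t : ℝ) => inner ℝ (gradPotential ε f (x + t • e)) e)
      (fun t => inner ℝ (gradPotential 0 f (x + t • e)) e) (𝓝[>] 0)
      {t : ℝ | x + t • e ∈ ball (0 : Plane) 1} := by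
    rw [Metric.tendstoUniformlyOn_iff]
    intro η hη
    have hlim : Tendsto (fun ε => F * (π⁻¹ * gradError ε) * ‖e‖) (𝓝[>] 0) (𝓝 0) := by
      simpa using ((tendsto_gradError.const_mul π⁻¹).const_mul F).mul_const ‖e‖
    filter_upwards [hlim.eventually_lt_const hη] with ε hε t ht
    rw [dist_comm, dist_eq_norm, ← inner_sub_left]
    refine lt_of_le_of_lt ?_ hε
    refine (norm_inner_le_norm _ _).trans ?_
    gcongr
    exact norm_gradPotential_sub_le hf hF ε ht
  have h1 : HasDerivAt (fun t : ℝ => u (x + t • e))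
      (inner ℝ (gradPotential 0 f (x + (0:ℝ) • e)) e) 0 := by
    refine hasDerivAt_of_tendstoUniformlyOn (l := 𝓝[>] (0:ℝ))
      (f := fun ε (t : ℝ) => potential ε f (x + t • e)) (isOpen_line_mem_ball x e)
      hunif ?_ (fun t ht => ?_) hx0
    · filter_upwards [self_mem_nhdsWithin] with ε hε t ht
      exact hasDerivAt_potential_line hf (ne_of_gt hε) x e ht
    · rw [eq_potential hu huc hb hf hlap ht]
      exact tendsto_potential hf ht
  have h2 := hasDerivAt_line_of_contDiffOn hu x e hx0
  have := h2.unique h1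
  simpa using this

end Representation

lemma exists_unit_norm_sub_eq {x : Plane} (hx : ‖x‖ ≤ 1) :
    ∃ z : Plane, ‖z‖ = 1 ∧ ‖x - z‖ = 1 - ‖x‖ := by
  rcases eq_or_ne x 0 with rfl | h0
  · exact ⟨EuclideanSpace.single 0 1, by simp, by simp⟩
  · have hx0 : 0 < ‖x‖ := norm_pos_iff.2 h0
    refine ⟨‖x‖⁻¹ • x, ?_, ?_⟩
    · rw [norm_smul, norm_inv, norm_norm, inv_mul_cancel₀ hx0.ne']
    · have : x - ‖x‖⁻¹ • x = (1 - ‖x‖⁻¹) • x := by module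
      have h1 : 1 - ‖x‖⁻¹ ≤ 0 := by
        rw [sub_nonpos]; exact one_le_inv_iff₀.2 ⟨hx0, hx⟩
      rw [this, norm_smul, norm_of_nonpos h1, neg_sub, sub_mul, inv_mul_cancel₀ hx0.ne', one_mul]

/-- Solutions of `-Δu = V e^u` in the unit disc with zero boundary values, under the
uniform bounds of the problem. -/
structure IsLiouvilleSolution (b C A s : ℝ) (u V : Plane → ℝ) : Prop where
  b_pos : 0 < b
  C_pos : 0 < C
  A_pos : 0 < A
  s_pos : 0 < s
  s_le : s ≤ 1
  reg : ContDiffOn ℝ 2 u (ball 0 1)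
  cont : ContinuousOn u (closedBall 0 1)
  nonneg : ∀ x ∈ closedBall (0 : Plane) 1, 0 ≤ V x
  le : ∀ x ∈ closedBall (0 : Plane) 1, V x ≤ b
  holder : ∀ x ∈ closedBall (0 : Plane) 1, ∀ y ∈ closedBall (0 : Plane) 1,
    |V x - V y| ≤ A * ‖x - y‖ ^ s
  pde : ∀ x ∈ ball (0 : Plane) 1, -lap u x = V x * exp (u x)
  bdry : ∀ x ∈ sphere (0 : Plane) 1, u x = 0
  int : ∫ y in ball (0 : Plane) 1, exp (u y) ≤ C

/-- `x₀` is a maximum point of `u`, with value `2 log M`. -/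
structure IsPeak (u : Plane → ℝ) (M : ℝ) (x₀ : Plane) : Prop where
  one_lt : 1 < M
  mem : x₀ ∈ ball (0 : Plane) 1
  max : ∀ x ∈ closedBall (0 : Plane) 1, u x ≤ 2 * log M
  val : u x₀ = 2 * log M

/-- The right-hand side `V e^u`. -/
noncomputable def density (u V : Plane → ℝ) (x : Plane) : ℝ := V x * exp (u x)

/-- The constant in the gradient bound. -/
noncomputable def gradConst (b C : ℝ) : ℝ := 2 * b + b * C / π

namespace IsPeak

variable {u : Plane → ℝ} {M : ℝ} {x₀ : Plane}

lemma pos (hp : IsPeak u M x₀) : 0 < M := one_pos.trans hp.one_lt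

lemma exp_le (hp : IsPeak u M x₀) {x : Plane} (hx : x ∈ closedBall (0 : Plane) 1) :
    exp (u x) ≤ M ^ 2 := by
  calc exp (u x) ≤ exp (2 * log M) := exp_le_exp.2 (hp.max x hx)
    _ = M ^ 2 := by rw [mul_comm, exp_mul, exp_log hp.pos]; norm_num

end IsPeak

namespace IsLiouvilleSolution

variable {b C A s : ℝ} {u V : Plane → ℝ} {M : ℝ} {x₀ : Plane}

lemma continuousOn_V (h : IsLiouvilleSolution b C A s u V) :
    ContinuousOn V (closedBall 0 1) := by
  intro x hx
  rw [ContinuousWithinAt, tendsto_iff_norm_sub_tendsto_zero]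
  have h1 : Tendsto (fun y : Plane => A * ‖y - x‖ ^ s) (𝓝[closedBall 0 1] x) (𝓝 0) := by
    have : ContinuousAt (fun y : Plane => A * ‖y - x‖ ^ s) x :=
      continuousAt_const.mul (ContinuousAt.rpow_const (by fun_prop) (.inr h.s_pos.le))
    have h2 := this.tendsto.mono_left (nhdsWithin_le_nhds (s := closedBall (0 : Plane) 1))
    simpa [h.s_pos.ne'] using h2
  refine squeeze_zero' (Eventually.of_forall fun y => norm_nonneg _) ?_ h1
  filter_upwards [self_mem_nhdsWithin] with y hy
  exact h.holder y hy x hx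

lemma continuousOn_exp (h : IsLiouvilleSolution b C A s u V) :
    ContinuousOn (fun x => exp (u x)) (closedBall 0 1) := h.cont.rexp

lemma continuousOn_density (h : IsLiouvilleSolution b C A s u V) :
    ContinuousOn (density u V) (closedBall 0 1) := h.continuousOn_V.mul h.cont.rexp

lemma integrableOn_exp (h : IsLiouvilleSolution b C A s u V) :
    IntegrableOn (fun x => exp (u x)) (ball 0 1) :=
  (h.continuousOn_exp.integrableOn_compact (isCompact_closedBall _ _)).mono_set
    ball_subset_closedBall

lemma integrableOn_density (h : IsLiouvilleSolution b C A s u V) :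
    IntegrableOn (density u V) (ball 0 1) :=
  (h.continuousOn_density.integrableOn_compact (isCompact_closedBall _ _)).mono_set
    ball_subset_closedBall

lemma density_nonneg (h : IsLiouvilleSolution b C A s u V) {x : Plane}
    (hx : x ∈ closedBall (0 : Plane) 1) : 0 ≤ density u V x :=
  mul_nonneg (h.nonneg x hx) (exp_pos _).le

lemma density_le_mul_exp (h : IsLiouvilleSolution b C A s u V) {x : Plane}
    (hx : x ∈ closedBall (0 : Plane) 1) : density u V x ≤ b * exp (u x) :=
  mul_le_mul_of_nonneg_right (h.le x hx) (exp_pos _).le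

lemma density_le (h : IsLiouvilleSolution b C A s u V) (hp : IsPeak u M x₀) {x : Plane}
    (hx : x ∈ closedBall (0 : Plane) 1) : density u V x ≤ b * M ^ 2 :=
  (h.density_le_mul_exp hx).trans (mul_le_mul_of_nonneg_left (hp.exp_le hx) h.b_pos.le)

lemma integral_density_le (h : IsLiouvilleSolution b C A s u V) :
    ∫ y in ball (0 : Plane) 1, density u V y ≤ b * C := by
  calc _ ≤ ∫ y in ball (0 : Plane) 1, b * exp (u y) :=
        setIntegral_mono_on h.integrableOn_density (h.integrableOn_exp.const_mul b)
          measurableSet_ball fun y hy => h.density_le_mul_exp (ball_subset_closedBall hy)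
    _ ≤ b * C := by
        rw [integral_const_mul]; exact mul_le_mul_of_nonneg_left h.int h.b_pos.le

lemma setIntegral_density_nonneg (h : IsLiouvilleSolution b C A s u V) {S : Set Plane}
    (hS : MeasurableSet S) (hsub : S ⊆ ball 0 1) : 0 ≤ ∫ y in S, density u V y :=
  setIntegral_nonneg hS fun _ hy => h.density_nonneg (ball_subset_closedBall (hsub hy))

lemma setIntegral_density_le (h : IsLiouvilleSolution b C A s u V) {S : Set Plane}
    (hsub : S ⊆ ball 0 1) : ∫ y in S, density u V y ≤ b * C := by
  refine le_trans (setIntegral_mono_set h.integrableOn_density ?_ hsub.eventuallyLE)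
    h.integral_density_le
  filter_upwards [ae_restrict_mem measurableSet_ball] with y hy
  exact h.density_nonneg (ball_subset_closedBall hy)

lemma setIntegral_exp_le (h : IsLiouvilleSolution b C A s u V) {S : Set Plane}
    (hsub : S ⊆ ball 0 1) : ∫ y in S, exp (u y) ≤ C :=
  (setIntegral_mono_set h.integrableOn_exp (Eventually.of_forall fun _ => (exp_pos _).le)
    hsub.eventuallyLE).trans h.int

lemma eq_potential (h : IsLiouvilleSolution b C A s u V) {x : Plane} (hx : x ∈ ball (0 : Plane) 1) :
    u x = potential 0 (density u V) x :=
  _root_.eq_potential h.reg h.cont h.bdry h.continuousOn_density h.pde hx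

lemma fderiv_eq (h : IsLiouvilleSolution b C A s u V) {x : Plane} (hx : x ∈ ball (0 : Plane) 1)
    (e : Plane) : fderiv ℝ u x e = inner ℝ (gradPotential 0 (density u V) x) e :=
  fderiv_eq_inner_gradPotential h.reg h.cont h.bdry h.continuousOn_density h.pde hx e

lemma u_nonneg (h : IsLiouvilleSolution b C A s u V) {x : Plane} (hx : x ∈ ball (0 : Plane) 1) :
    0 ≤ u x := by
  rw [h.eq_potential hx, potential]
  refine integral_nonneg_of_ae ?_
  filter_upwards [ae_mem_ball_and_ne x] with y ⟨hy, hxy⟩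
  exact mul_nonneg (h.density_nonneg (ball_subset_closedBall hy))
    (green_nonneg (norm_lt_one_of_mem hx).le (norm_lt_one_of_mem hy).le (.inl hxy))

/-- Total mass of `density / |x - ·|`. -/
lemma integral_density_mul_inv_le (h : IsLiouvilleSolution b C A s u V) (hp : IsPeak u M x₀)
    {x : Plane} (hx : x ∈ ball (0 : Plane) 1) :
    ∫ y in ball (0 : Plane) 1, |density u V y| * ‖x - y‖⁻¹ ≤ (2 * π * b + b * C) * M := by
  have hM := hp.pos
  have hi := integrable_mul_inv_norm h.continuousOn_density hx
  have hloc : IntegrableOn (fun y : Plane => b * M ^ 2 * ‖x - y‖⁻¹) (ball x M⁻¹) :=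
    (integrableOn_inv_norm_sub_ball x M⁻¹).const_mul _
  calc ∫ y in ball (0 : Plane) 1, |density u V y| * ‖x - y‖⁻¹
      ≤ ∫ y in ball (0 : Plane) 1, ((ball x M⁻¹).indicator (fun y => b * M ^ 2 * ‖x - y‖⁻¹) y
          + M * density u V y) := by
        refine setIntegral_mono_on hi
          (((integrable_indicator_iff measurableSet_ball).2 hloc).integrableOn.add
            (h.integrableOn_density.const_mul M)) measurableSet_ball fun y hy => ?_
        have hy' := ball_subset_closedBall hy
        have h0 := h.density_nonneg hy'
        rw [abs_of_nonneg h0]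
        by_cases hyx : y ∈ ball x M⁻¹
        · rw [Set.indicator_of_mem hyx]
          have := h.density_le hp hy'
          have h1 : density u V y * ‖x - y‖⁻¹ ≤ b * M ^ 2 * ‖x - y‖⁻¹ := by gcongr
          have h2 : 0 ≤ M * density u V y := by positivity
          linarith
        · rw [Set.indicator_of_notMem hyx, zero_add, mul_comm M]
          rw [mem_ball, not_lt, dist_comm, dist_eq_norm] at hyx
          have : ‖x - y‖⁻¹ ≤ M := by
            rw [← inv_inv M]; exact inv_anti₀ (by positivity) hyx
          gcongr
    _ = (∫ y in ball (0 : Plane) 1, (ball x M⁻¹).indicator (fun y => b * M ^ 2 * ‖x - y‖⁻¹) y)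
          + M * ∫ y in ball (0 : Plane) 1, density u V y := by
        rw [integral_add ((integrable_indicator_iff measurableSet_ball).2 hloc).integrableOn
            (h.integrableOn_density.const_mul M), integral_const_mul]
    _ ≤ 2 * π * b * M + M * (b * C) := by
        have h1 : (∫ y in ball (0 : Plane) 1,
            (ball x M⁻¹).indicator (fun y => b * M ^ 2 * ‖x - y‖⁻¹) y) ≤ 2 * π * b * M := by
          calc _ ≤ ∫ y, (ball x M⁻¹).indicator (fun y => b * M ^ 2 * ‖x - y‖⁻¹) y := by
                refine setIntegral_le_integral
                  ((integrable_indicator_iff measurableSet_ball).2 hloc)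
                  (Eventually.of_forall fun y => ?_)
                have := h.b_pos
                exact Set.indicator_nonneg (fun y _ => by positivity) y
            _ = 2 * π * b * M := by
                rw [integral_indicator measurableSet_ball, integral_const_mul,
                  integral_inv_norm_sub_ball x (by positivity)]
                field_simp
        have h2 := mul_le_mul_of_nonneg_left h.integral_density_le hM.le
        exact add_le_add h1 h2
    _ = _ := by ring

lemma norm_grad_le (h : IsLiouvilleSolution b C A s u V) (hp : IsPeak u M x₀) {x : Plane}
    (hx : x ∈ ball (0 : Plane) 1) :
    ‖gradPotential 0 (density u V) x‖ ≤ gradConst b C * M := by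
  refine (norm_gradPotential_le h.continuousOn_density 0 hx).trans ?_
  refine (mul_le_mul_of_nonneg_left (h.integral_density_mul_inv_le hp hx)
    (by positivity)).trans (le_of_eq ?_)
  rw [gradConst]; field_simp

lemma gradConst_pos (h : IsLiouvilleSolution b C A s u V) : 0 < gradConst b C := by
  have := h.b_pos; have := h.C_pos
  rw [gradConst]; positivity

lemma norm_fderiv_le (h : IsLiouvilleSolution b C A s u V) (hp : IsPeak u M x₀) {x : Plane}
    (hx : x ∈ ball (0 : Plane) 1) : ‖fderiv ℝ u x‖ ≤ gradConst b C * M := by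
  refine ContinuousLinearMap.opNorm_le_bound _ ?_ fun e => ?_
  · have := h.gradConst_pos; have := hp.pos; positivity
  · rw [h.fderiv_eq hx]
    exact (norm_inner_le_norm _ _).trans
      (mul_le_mul_of_nonneg_right (h.norm_grad_le hp hx) (norm_nonneg _))

lemma abs_sub_le (h : IsLiouvilleSolution b C A s u V) (hp : IsPeak u M x₀) {x y : Plane}
    (hx : x ∈ closedBall (0 : Plane) 1) (hy : y ∈ closedBall (0 : Plane) 1) :
    |u x - u y| ≤ gradConst b C * M * ‖x - y‖ := by
  have h0 : 0 ≤ gradConst b C * M := by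
    have := h.gradConst_pos; have := hp.pos; positivity
  have h1 : LipschitzOnWith (gradConst b C * M).toNNReal u (ball 0 1) := by
    refine (convex_ball (0 : Plane) 1).lipschitzOnWith_of_nnnorm_fderiv_le (𝕜 := ℝ)
      (fun z hz => (h.reg.contDiffAt (isOpen_ball.mem_nhds hz)).differentiableAt (by norm_num))
      fun z hz => ?_
    rw [← NNReal.coe_le_coe, coe_nnnorm, Real.coe_toNNReal _ h0]
    exact h.norm_fderiv_le hp hz
  have h2 : LipschitzOnWith (gradConst b C * M).toNNReal u (closure (ball 0 1)) :=
    h1.closure (by rw [closure_ball _ one_ne_zero]; exact h.cont)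
  rw [closure_ball _ one_ne_zero] at h2
  have := h2.dist_le_mul x hx y hy
  rwa [dist_eq_norm, dist_eq_norm, Real.coe_toNNReal _ h0] at this

lemma u_le_dist (h : IsLiouvilleSolution b C A s u V) (hp : IsPeak u M x₀) {x : Plane}
    (hx : x ∈ closedBall (0 : Plane) 1) : |u x| ≤ gradConst b C * M * (1 - ‖x‖) := by
  obtain ⟨z, hz, hxz⟩ := exists_unit_norm_sub_eq (by simpa using hx : ‖x‖ ≤ 1)
  have := h.abs_sub_le hp hx (y := z) (by simp [hz])
  rwa [h.bdry z (by simp [hz]), sub_zero, hxz] at this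

/-- The peak is far from the boundary at the scale `1 / M`. -/
lemma two_mul_log_le (h : IsLiouvilleSolution b C A s u V) (hp : IsPeak u M x₀) :
    2 * log M ≤ gradConst b C * (M * (1 - ‖x₀‖)) := by
  rw [← hp.val, ← mul_assoc]
  exact (le_abs_self _).trans (h.u_le_dist hp (ball_subset_closedBall hp.mem))

lemma abs_exp_sub_exp_le (h : IsLiouvilleSolution b C A s u V) (hp : IsPeak u M x₀) {x y : Plane}
    (hx : x ∈ closedBall (0 : Plane) 1) (hy : y ∈ closedBall (0 : Plane) 1) :
    |exp (u x) - exp (u y)| ≤ M ^ 2 * (gradConst b C * M) * ‖x - y‖ := by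
  have key : ∀ p q : ℝ, exp p ≤ M ^ 2 → exp p - exp q ≤ M ^ 2 * |p - q| := fun p q hpq => by
    have h1 := add_one_le_exp (q - p)
    have h2 : exp q = exp p * exp (q - p) := by rw [← exp_add]; ring_nf
    have h3 : exp p - exp q ≤ exp p * (p - q) := by
      rw [h2]; nlinarith [exp_pos p]
    refine h3.trans ((mul_le_mul_of_nonneg_left (le_abs_self _) (exp_pos p).le).trans ?_)
    exact mul_le_mul_of_nonneg_right hpq (abs_nonneg _)
  have h1 : |exp (u x) - exp (u y)| ≤ M ^ 2 * |u x - u y| := by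
    rw [abs_le]
    have h2 := key (u x) (u y) (hp.exp_le hx)
    have h3 := key (u y) (u x) (hp.exp_le hy)
    rw [abs_sub_comm] at h3
    constructor <;> linarith
  refine h1.trans ?_
  rw [mul_assoc]
  exact mul_le_mul_of_nonneg_left (h.abs_sub_le hp hx hy) (sq_nonneg M)

/-- Integration by parts against `e^u - 1`, which vanishes on the boundary. -/
lemma integral_mul_fderiv_exp (h : IsLiouvilleSolution b C A s u V) (hp : IsPeak u M x₀)
    {g : Plane → ℝ} {K : NNReal} (hg : LipschitzWith K g) (e : Plane) :
    ∫ x in ball (0 : Plane) 1, g x * (exp (u x) * fderiv ℝ u x e)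
      = -∫ x in ball (0 : Plane) 1, (exp (u x) - 1) * lineDeriv ℝ g x e := by
  set w : Plane → ℝ := (ball (0 : Plane) 1).indicator fun x => exp (u x) - 1 with hw
  set N := M ^ 2 * (gradConst b C * M) with hN
  have hN0 : 0 ≤ N := by have := h.gradConst_pos; have := hp.pos; positivity
  have hwc : ∀ x ∈ closedBall (0 : Plane) 1, w x = exp (u x) - 1 := fun x hx => by
    by_cases hxb : x ∈ ball (0 : Plane) 1
    · rw [hw, Set.indicator_of_mem hxb]
    · rw [hw, Set.indicator_of_notMem hxb, h.bdry x (by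
        rw [mem_closedBall] at hx; rw [mem_ball, not_lt] at hxb; exact le_antisymm hx hxb)]
      simp
  have hw0 : ∀ x, x ∉ ball (0 : Plane) 1 → w x = 0 := fun x hx => Set.indicator_of_notMem hx _
  have hin : ∀ x ∈ closedBall (0 : Plane) 1, ∀ y ∈ closedBall (0 : Plane) 1,
      |w x - w y| ≤ N * ‖x - y‖ := fun x hx y hy => by
    rw [hwc x hx, hwc y hy, sub_sub_sub_cancel_right]
    exact h.abs_exp_sub_exp_le hp hx hy
  have hout : ∀ x ∈ closedBall (0 : Plane) 1, ∀ y ∉ closedBall (0 : Plane) 1,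
      |w x - w y| ≤ N * ‖x - y‖ := fun x hx y hy => by
    have hx1 : ‖x‖ ≤ 1 := by simpa using hx
    have hy1 : 1 < ‖y‖ := by simpa using hy
    obtain ⟨z, hz, hxz⟩ := exists_unit_norm_sub_eq hx1
    have h1 := hin x hx z (by simp [hz])
    rw [hw0 z (by simp [hz]), hxz] at h1
    rw [hw0 y (fun hy' => hy (ball_subset_closedBall hy'))]
    refine h1.trans (mul_le_mul_of_nonneg_left ?_ hN0)
    have := norm_sub_norm_le y x
    rw [norm_sub_rev] at this
    linarith
  have hwl : LipschitzWith N.toNNReal w := by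
    refine LipschitzWith.of_dist_le_mul fun x y => ?_
    rw [Real.coe_toNNReal _ hN0, dist_eq_norm, dist_eq_norm, norm_eq_abs]
    by_cases hx : x ∈ closedBall (0 : Plane) 1 <;> by_cases hy : y ∈ closedBall (0 : Plane) 1
    · exact hin x hx y hy
    · exact hout x hx y hy
    · rw [abs_sub_comm, norm_sub_rev]; exact hout y hy x hx
    · rw [hw0 x (fun h => hx (ball_subset_closedBall h)),
        hw0 y (fun h => hy (ball_subset_closedBall h)), sub_zero, abs_zero]
      positivity
  have hsupp : HasCompactSupport w :=
    HasCompactSupport.of_support_subset_isCompact (isCompact_closedBall (0 : Plane) 1)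
      ((Set.support_indicator_subset).trans ball_subset_closedBall)
  have key := hg.integral_lineDeriv_mul_eq (μ := volume) hwl hsupp (v := e)
  have hball : ∀ x ∈ ball (0 : Plane) 1, lineDeriv ℝ w x (-e) = -(exp (u x) * fderiv ℝ u x e) := by
    intro x hx
    have hd := ((h.reg.contDiffAt (isOpen_ball.mem_nhds hx)).differentiableAt
      (by norm_num)).hasFDerivAt.exp.sub_const 1
    have hd' : HasFDerivAt w (exp (u x) • fderiv ℝ u x) x := by
      refine hd.congr_of_eventuallyEq ?_
      filter_upwards [isOpen_ball.mem_nhds hx] with y hy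
      rw [hw, Set.indicator_of_mem hy]
    rw [(hd'.hasLineDerivAt (-e)).lineDeriv]
    simp
  have hext : ∀ x ∉ closedBall (0 : Plane) 1, lineDeriv ℝ w x (-e) = 0 := by
    intro x hx
    have hd : HasFDerivAt w (0 : Plane →L[ℝ] ℝ) x := by
      refine (hasFDerivAt_const (0:ℝ) x).congr_of_eventuallyEq ?_
      filter_upwards [isClosed_closedBall.isOpen_compl.mem_nhds hx] with y hy
      exact hw0 y fun h => hy (ball_subset_closedBall h)
    rw [(hd.hasLineDerivAt (-e)).lineDeriv]
    simp
  have hsph : ∀ᵐ x ∂(volume : Measure Plane), x ∉ sphere (0 : Plane) 1 :=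
    compl_mem_ae_iff.2 (Measure.addHaar_sphere volume (0 : Plane) 1)
  have e1 : ∫ x, lineDeriv ℝ g x e * w x
      = ∫ x in ball (0 : Plane) 1, (exp (u x) - 1) * lineDeriv ℝ g x e := by
    rw [← integral_indicator measurableSet_ball]
    congr 1; ext x
    by_cases hx : x ∈ ball (0 : Plane) 1
    · rw [Set.indicator_of_mem hx, hw, Set.indicator_of_mem hx, mul_comm]
    · rw [Set.indicator_of_notMem hx, hw0 x hx, mul_zero]
  have e2 : ∫ x, lineDeriv ℝ w x (-e) * g x
      = -∫ x in ball (0 : Plane) 1, g x * (exp (u x) * fderiv ℝ u x e) := by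
    rw [← integral_neg, ← integral_indicator measurableSet_ball]
    refine integral_congr_ae ?_
    filter_upwards [hsph] with x hxs
    by_cases hx : x ∈ ball (0 : Plane) 1
    · rw [Set.indicator_of_mem hx, hball x hx]; ring
    · rw [Set.indicator_of_notMem hx, hext x, zero_mul]
      rw [mem_sphere] at hxs
      rw [mem_ball] at hx
      rw [mem_closedBall]
      exact fun hle => hx (lt_of_le_of_ne hle hxs)
  rw [e1, e2] at key
  rw [key, neg_neg]

end IsLiouvilleSolution

lemma ae_prod_mem_ball_and_ne :
    ∀ᵐ z ∂((volume.restrict (ball (0 : Plane) 1)).prod (volume.restrict (ball (0 : Plane) 1))),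
      z.1 ∈ ball (0 : Plane) 1 ∧ z.2 ∈ ball (0 : Plane) 1 ∧ z.1 ≠ z.2 := by
  have h1 : ∀ᵐ z ∂((volume.restrict (ball (0 : Plane) 1)).prod
      (volume.restrict (ball (0 : Plane) 1))), z ∈ ball (0 : Plane) 1 ×ˢ ball (0 : Plane) 1 := by
    rw [Measure.prod_restrict]
    exact ae_restrict_mem (measurableSet_ball.prod measurableSet_ball)
  have h2 : ∀ᵐ z ∂((volume.restrict (ball (0 : Plane) 1)).prod
      (volume.restrict (ball (0 : Plane) 1))), z ∉ Set.diagonal Plane := by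
    refine compl_mem_ae_iff.2 ((Measure.measure_prod_null isClosed_diagonal.measurableSet).2
      (Eventually.of_forall fun x => ?_))
    have : Prod.mk x ⁻¹' Set.diagonal Plane = {x} := by ext y; simp [eq_comm]
    change (volume.restrict _) (Prod.mk x ⁻¹' Set.diagonal Plane) = 0
    rw [this]
    exact le_antisymm ((Measure.restrict_apply_le _ _).trans (by simp)) bot_le
  filter_upwards [h1, h2] with z hz1 hz2
  exact ⟨hz1.1, hz1.2, hz2⟩

namespace IsLiouvilleSolution

variable {b C A s : ℝ} {u V : Plane → ℝ} {M : ℝ} {x₀ : Plane}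

lemma integrable_prod_kernel (h : IsLiouvilleSolution b C A s u V) (hp : IsPeak u M x₀)
    {X : Plane → Plane} (hX : Measurable X) {N : ℝ} (hN : ∀ x ∈ ball (0 : Plane) 1, ‖X x‖ ≤ N) :
    Integrable (fun z : Plane × Plane =>
      density u V z.1 * (density u V z.2 * inner ℝ (gradGreen 0 z.1 z.2) (X z.1)))
      ((volume.restrict (ball (0 : Plane) 1)).prod (volume.restrict (ball (0 : Plane) 1))) := by
  have hfm := aestronglyMeasurable_of_continuousOn h.continuousOn_density
  have hN0 : 0 ≤ N := (norm_nonneg _).trans (hN 0 (by simp))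
  have hm : AEStronglyMeasurable (fun z : Plane × Plane =>
      density u V z.1 * (density u V z.2 * inner ℝ (gradGreen 0 z.1 z.2) (X z.1)))
      ((volume.restrict (ball (0 : Plane) 1)).prod (volume.restrict (ball (0 : Plane) 1))) :=
    hfm.comp_fst.mul (hfm.comp_snd.mul
      ((measurable_gradGreen 0).inner (hX.comp measurable_fst)).aestronglyMeasurable)
  have hbound : ∀ x ∈ ball (0 : Plane) 1, ∀ᵐ y ∂(volume.restrict (ball (0 : Plane) 1)),
      ‖density u V x * (density u V y * inner ℝ (gradGreen 0 x y) (X x))‖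
        ≤ |density u V x| * N * (|density u V y| * ‖x - y‖⁻¹) := by
    intro x hx
    filter_upwards [ae_mem_ball_and_ne x] with y ⟨hy, hxy⟩
    rw [norm_mul, norm_mul, norm_eq_abs, norm_eq_abs]
    have h1 := (norm_inner_le_norm (𝕜 := ℝ) (gradGreen 0 x y) (X x)).trans
      (mul_le_mul (norm_gradGreen_le_inv 0 (norm_lt_one_of_mem hx).le
        (norm_lt_one_of_mem hy).le hxy)
        (hN x hx) (norm_nonneg _) (by positivity))
    calc _ ≤ |density u V x| * (|density u V y| * (‖x - y‖⁻¹ * N)) := by gcongr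
      _ = _ := by ring
  rw [integrable_prod_iff hm]
  constructor
  · filter_upwards [ae_restrict_mem measurableSet_ball, hm.prodMk_left] with x hx hmx
    exact ((integrable_mul_inv_norm h.continuousOn_density hx).const_mul _).mono' hmx (hbound x hx)
  · refine (h.integrableOn_density.norm.mul_const (N * ((2 * π * b + b * C) * M))).mono'
      hm.norm.integral_prod_right' ?_
    filter_upwards [ae_restrict_mem measurableSet_ball] with x hx
    rw [norm_of_nonneg (integral_nonneg fun _ => norm_nonneg _)]
    have hi := (integrable_mul_inv_norm h.continuousOn_density hx).const_mul (|density u V x| * N)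
    calc _ ≤ ∫ y in ball (0 : Plane) 1, |density u V x| * N * (|density u V y| * ‖x - y‖⁻¹) :=
          integral_mono_of_nonneg (Eventually.of_forall fun _ => norm_nonneg _) hi (hbound x hx)
      _ = |density u V x| * N * ∫ y in ball (0 : Plane) 1, |density u V y| * ‖x - y‖⁻¹ :=
          integral_const_mul _ _
      _ ≤ |density u V x| * N * ((2 * π * b + b * C) * M) := by
          gcongr; exact h.integral_density_mul_inv_le hp hx
      _ = _ := by rw [norm_eq_abs]; ring

/-- Symmetrised lower bound for `∫ f ⟨X, ∇u⟩` in terms of a lower bound of the symmetrised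
interaction kernel. -/
lemma le_integral_density_mul_inner (h : IsLiouvilleSolution b C A s u V) (hp : IsPeak u M x₀)
    {X : Plane → Plane} (hX : Measurable X) {N : ℝ} (hN : ∀ x ∈ ball (0 : Plane) 1, ‖X x‖ ≤ N)
    {P Q : Set Plane} (hP : MeasurableSet P) (hQ : MeasurableSet Q) (hPB : P ⊆ ball 0 1)
    (hQB : Q ⊆ ball 0 1) {α β γ : ℝ}
    (hker : ∀ x ∈ ball (0 : Plane) 1, ∀ y ∈ ball (0 : Plane) 1, x ≠ y →
      α * (P.indicator 1 x * P.indicator 1 y) - β * (Q.indicator 1 x + Q.indicator 1 y) - γ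
        ≤ inner ℝ (gradGreen 0 x y) (X x) + inner ℝ (gradGreen 0 y x) (X y)) :
    (α * (∫ y in P, density u V y) ^ 2
      - 2 * β * (∫ y in ball (0 : Plane) 1, density u V y) * (∫ y in Q, density u V y)
      - γ * (∫ y in ball (0 : Plane) 1, density u V y) ^ 2) / 2
      ≤ ∫ x in ball (0 : Plane) 1, density u V x * fderiv ℝ u x (X x) := by
  set f := density u V with hf
  set ν := volume.restrict (ball (0 : Plane) 1) with hν
  set m := ∫ y, f y ∂ν with hm
  have hfi : Integrable f ν := h.integrableOn_density
  have hPi : Integrable (P.indicator f) ν := hfi.indicator hP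
  have hQi : Integrable (Q.indicator f) ν := hfi.indicator hQ
  have hPint : ∫ y, P.indicator f y ∂ν = ∫ y in P, f y := by
    rw [hν, setIntegral_indicator hP, Set.inter_eq_self_of_subset_right hPB]
  have hQint : ∫ y, Q.indicator f y ∂ν = ∫ y in Q, f y := by
    rw [hν, setIntegral_indicator hQ, Set.inter_eq_self_of_subset_right hQB]
  have hΦ := h.integrable_prod_kernel hp hX hN
  rw [← hf, ← hν] at hΦ
  have e1 : ∫ x, f x * fderiv ℝ u x (X x) ∂ν
      = ∫ z, f z.1 * (f z.2 * inner ℝ (gradGreen 0 z.1 z.2) (X z.1)) ∂(ν.prod ν) := by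
    rw [integral_prod _ hΦ]
    refine integral_congr_ae ?_
    filter_upwards [ae_restrict_mem measurableSet_ball] with x hx
    rw [h.fderiv_eq hx, inner_gradPotential h.continuousOn_density 0 hx, integral_const_mul]
  have e2 := integral_prod_swap (μ := ν) (ν := ν)
    (fun z : Plane × Plane => f z.1 * (f z.2 * inner ℝ (gradGreen 0 z.1 z.2) (X z.1)))
  have i1 : Integrable (fun z : Plane × Plane => P.indicator f z.1 * P.indicator f z.2)
    (ν.prod ν) := hPi.mul_prod hPi
  have i2 : Integrable (fun z : Plane × Plane => Q.indicator f z.1 * f z.2)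
    (ν.prod ν) := hQi.mul_prod hfi
  have i3 : Integrable (fun z : Plane × Plane => f z.1 * Q.indicator f z.2)
    (ν.prod ν) := hfi.mul_prod hQi
  have i4 : Integrable (fun z : Plane × Plane => f z.1 * f z.2)
    (ν.prod ν) := hfi.mul_prod hfi
  have i23 : Integrable (fun z : Plane × Plane => Q.indicator f z.1 * f z.2
    + f z.1 * Q.indicator f z.2) (ν.prod ν) := i2.add i3
  have i123 : Integrable (fun z : Plane × Plane => α * (P.indicator f z.1 * P.indicator f z.2)
    - β * (Q.indicator f z.1 * f z.2 + f z.1 * Q.indicator f z.2)) (ν.prod ν) :=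
    (i1.const_mul α).sub (i23.const_mul β)
  have hΦs : Integrable (fun z : Plane × Plane =>
    f z.2 * (f z.1 * inner ℝ (gradGreen 0 z.2 z.1) (X z.2))) (ν.prod ν) := hΦ.swap
  have e3 : ∫ z, (α * (P.indicator f z.1 * P.indicator f z.2)
      - β * (Q.indicator f z.1 * f z.2 + f z.1 * Q.indicator f z.2) - γ * (f z.1 * f z.2))
      ∂(ν.prod ν) = α * (∫ y in P, f y) ^ 2 - 2 * β * m * (∫ y in Q, f y) - γ * m ^ 2 := by
    rw [integral_sub i123 (i4.const_mul γ),
      integral_sub (i1.const_mul α) (i23.const_mul β), integral_const_mul,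
      integral_const_mul, integral_const_mul, integral_add i2 i3, integral_prod_mul,
      integral_prod_mul, integral_prod_mul, integral_prod_mul, hPint, hQint]
    ring
  have e4 : ∫ z, (α * (P.indicator f z.1 * P.indicator f z.2)
      - β * (Q.indicator f z.1 * f z.2 + f z.1 * Q.indicator f z.2) - γ * (f z.1 * f z.2))
      ∂(ν.prod ν) ≤ ∫ z, (f z.1 * (f z.2 * inner ℝ (gradGreen 0 z.1 z.2) (X z.1))
        + f z.2 * (f z.1 * inner ℝ (gradGreen 0 z.2 z.1) (X z.2))) ∂(ν.prod ν) := by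
    refine integral_mono_ae (i123.sub (i4.const_mul γ)) (hΦ.add hΦs) ?_
    filter_upwards [ae_prod_mem_ball_and_ne] with z ⟨hz1, hz2, hne⟩
    have h1 := h.density_nonneg (ball_subset_closedBall hz1)
    have h2 := h.density_nonneg (ball_subset_closedBall hz2)
    have hind : ∀ (T : Set Plane) x, T.indicator f x = f x * T.indicator 1 x := fun T x => by
      by_cases hx : x ∈ T <;> simp [hx]
    have := mul_le_mul_of_nonneg_left (hker z.1 hz1 z.2 hz2 hne) (mul_nonneg h1 h2)
    simp only [hind]
    simp only [← hf] at this
    linarith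
  rw [integral_add hΦ hΦs] at e4
  simp only [Prod.fst_swap, Prod.snd_swap] at e2
  rw [e3, e2, ← e1] at e4
  linarith

end IsLiouvilleSolution

lemma green_zero_eq {x y : Plane} : green 0 x y
    = (2 * π)⁻¹ * (log √(imageSq x y) - log ‖x - y‖) := by
  have h1 : log √(imageSq x y) = log (imageSq x y) / 2 := log_sqrt (imageSq_nonneg x y)
  rw [green, h1]
  simp only [ne_eq, OfNat.ofNat_ne_zero, not_false_eq_true, zero_pow, add_zero, log_pow]
  push_cast
  field_simp
  ring

lemma sqrt_imageSq_pos {x y : Plane} (hx : ‖x‖ < 1) (hy : ‖y‖ ≤ 1) : 0 < √(imageSq x y) :=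
  sqrt_pos.2 (imageSq_pos hx hy)

lemma one_sub_norm_le_sqrt_imageSq {x y : Plane} (hx : ‖x‖ ≤ 1) (hy : ‖y‖ ≤ 1) :
    1 - ‖x‖ ≤ √(imageSq x y) := le_sqrt_of_sq_le (one_sub_sq_le_imageSq hx hy)

lemma sqrt_imageSq_le_add (x x' : Plane) {y : Plane} (hy : ‖y‖ ≤ 1) :
    √(imageSq x y) ≤ √(imageSq x' y) + ‖x - x'‖ := by
  rcases eq_or_ne y 0 with rfl | h0
  · simp [imageSq]
  · have hy0 : 0 < ‖y‖ := norm_pos_iff.2 h0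
    have h1 : ‖‖y‖ ^ 2 • x - y‖ ≤ ‖‖y‖ ^ 2 • x' - y‖ + ‖y‖ ^ 2 * ‖x - x'‖ := by
      have : ‖y‖ ^ 2 • x - y = (‖y‖ ^ 2 • x' - y) + ‖y‖ ^ 2 • (x - x') := by module
      rw [this]
      refine (norm_add_le _ _).trans (le_of_eq ?_)
      rw [norm_smul (‖y‖ ^ 2) (x - x')]; simp
    rw [norm_sq_smul_sub, norm_sq_smul_sub] at h1
    have h2 : ‖y‖ * √(imageSq x y) ≤ ‖y‖ * (√(imageSq x' y) + ‖y‖ * ‖x - x'‖) := by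
      calc _ ≤ _ := h1
        _ = _ := by ring
    have h3 := le_of_mul_le_mul_left h2 hy0
    have := mul_le_of_le_one_left (norm_nonneg (x - x')) hy
    linarith

lemma log_ratio_le {p q t : ℝ} (hp : 0 < p) (hq : 0 < q) (h : p ≤ (1 + t) * q) :
    log p ≤ log q + t := by
  have ht : 0 < 1 + t := by
    by_contra hc
    nlinarith
  have h1 := log_le_log hp h
  rw [log_mul ht.ne' hq.ne'] at h1
  linarith [log_le_sub_one_of_pos ht]

/-- Comparison of the Green function with poles at nearby points. -/
lemma green_sub_le {x₀ x y : Plane} (hx₀ : x₀ ∈ ball (0 : Plane) 1) (hx : x ∈ ball (0 : Plane) 1)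
    (hy : y ∈ ball (0 : Plane) 1) {R M : ℝ} (hR : 0 < R) (hRd : R ≤ (1 - ‖x₀‖) / 4) (hM : 0 < M)
    (hxR : ‖x - x₀‖ ≤ R / 4) (hxy : x ≠ y) (hx₀y : x₀ ≠ y) :
    green 0 x₀ y - (2 * π)⁻¹ * (3 / 4 + (ball x₀ R).indicator 1 y * log (2 * (R * M))
      + (ball x₀ M⁻¹).indicator 1 y * (M⁻¹ * ‖x₀ - y‖⁻¹)) ≤ green 0 x y := by
  have hn0 := norm_lt_one_of_mem hx₀
  have hn := norm_lt_one_of_mem hx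
  have hny := norm_lt_one_of_mem hy
  have hd1 : 0 < ‖x - y‖ := norm_pos_iff.2 (sub_ne_zero.2 hxy)
  have hd0 : 0 < ‖x₀ - y‖ := norm_pos_iff.2 (sub_ne_zero.2 hx₀y)
  have hP : log √(imageSq x₀ y) ≤ log √(imageSq x y) + 1 / 2 := by
    refine log_ratio_le (sqrt_imageSq_pos hn0 hny.le) (sqrt_imageSq_pos hn hny.le) ?_
    have h1 := sqrt_imageSq_le_add x₀ x hny.le
    have h2 := one_sub_norm_le_sqrt_imageSq hn.le hny.le
    rw [norm_sub_rev] at h1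
    have h3 := norm_sub_norm_le x x₀
    linarith
  have htri : ‖x - y‖ ≤ ‖x₀ - y‖ + R / 4 := by
    have := norm_add_le (x - x₀) (x₀ - y)
    rw [sub_add_sub_cancel] at this
    linarith
  have hI0 : (0 : ℝ) ≤ (ball x₀ M⁻¹).indicator 1 y * (M⁻¹ * ‖x₀ - y‖⁻¹) :=
    mul_nonneg (Set.indicator_nonneg (fun _ _ => zero_le_one) _) (by positivity)
  have hD : log ‖x - y‖ ≤ log ‖x₀ - y‖ + 1 / 4
      + (ball x₀ R).indicator 1 y * log (2 * (R * M))
      + (ball x₀ M⁻¹).indicator 1 y * (M⁻¹ * ‖x₀ - y‖⁻¹) := by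
    by_cases hyR : y ∈ ball x₀ R
    · rw [Set.indicator_of_mem hyR]
      rw [mem_ball, dist_comm, dist_eq_norm] at hyR
      have h1 : log ‖x - y‖ ≤ log (2 * R) := log_le_log hd1 (by linarith)
      have h2 : log (2 * (R * M)) = log (2 * R) + log M := by
        rw [← mul_assoc, log_mul (by positivity) hM.ne']
      have h3 : -((ball x₀ M⁻¹).indicator 1 y * (M⁻¹ * ‖x₀ - y‖⁻¹)) ≤ log M + log ‖x₀ - y‖ := by
        rw [← log_mul hM.ne' hd0.ne']
        by_cases hyM : y ∈ ball x₀ M⁻¹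
        · rw [Set.indicator_of_mem hyM]
          have := one_sub_inv_le_log_of_pos (mul_pos hM hd0)
          rw [mul_inv] at this
          simp only [Pi.one_apply]
          linarith
        · rw [Set.indicator_of_notMem hyM, zero_mul, neg_zero]
          rw [mem_ball, not_lt, dist_comm, dist_eq_norm] at hyM
          refine log_nonneg ?_
          rwa [inv_le_iff_one_le_mul₀ hM, mul_comm] at hyM
      simp only [Pi.one_apply]
      linarith
    · rw [Set.indicator_of_notMem hyR, zero_mul, add_zero]
      rw [mem_ball, not_lt, dist_comm, dist_eq_norm] at hyR
      have := log_ratio_le (t := 1 / 4) hd1 hd0 (by linarith)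
      linarith
  rw [green_zero_eq, green_zero_eq, ← mul_sub]
  refine mul_le_mul_of_nonneg_left ?_ (by positivity)
  linarith

namespace IsLiouvilleSolution

variable {b C A s : ℝ} {u V : Plane → ℝ} {M : ℝ} {x₀ : Plane}

lemma ball_subset_of_le {R : ℝ} (hRd : R ≤ 1 - ‖x₀‖) : ball x₀ R ⊆ ball (0 : Plane) 1 :=
  ball_subset_ball' (by rw [dist_zero_right]; linarith)

/-- Lower bound of `u` near the peak in terms of the mass of a small disc. -/
lemma le_u_near_peak (h : IsLiouvilleSolution b C A s u V) (hp : IsPeak u M x₀) {R : ℝ}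
    (hR : 0 < R) (hRd : R ≤ (1 - ‖x₀‖) / 4) (hRM : 1 ≤ R * M)
    {x : Plane} (hx : x ∈ ball x₀ (R / 4)) :
    2 * log M - (2 * π)⁻¹ * (3 / 4 * (b * C)
      + log (2 * (R * M)) * (∫ y in ball x₀ R, density u V y) + 2 * π * b) ≤ u x := by
  have hM := hp.pos
  have hn0 := norm_lt_one_of_mem hp.mem
  have hsub : ball x₀ R ⊆ ball (0 : Plane) 1 := ball_subset_of_le (by linarith)
  have hsubM : ball x₀ M⁻¹ ⊆ ball (0 : Plane) 1 := by
    refine (ball_subset_ball ?_).trans hsub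
    rwa [inv_le_iff_one_le_mul₀ hM]
  have hxB : x ∈ ball (0 : Plane) 1 := ball_subset_of_le (R := R / 4) (by linarith) hx
  have hxR : ‖x - x₀‖ ≤ R / 4 := by
    rw [mem_ball, dist_eq_norm] at hx; exact hx.le
  set f := density u V with hf
  have hfi : IntegrableOn f (ball 0 1) := h.integrableOn_density
  have i1 : IntegrableOn (fun y => f y * green 0 x₀ y) (ball 0 1) :=
    integrable_mul_green h.continuousOn_density 0 hp.mem
  have i2 : IntegrableOn ((ball x₀ R).indicator f) (ball 0 1) := hfi.indicator measurableSet_ball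
  have hlocM : IntegrableOn (fun y => b * M ^ 2 * (M⁻¹ * ‖x₀ - y‖⁻¹)) (ball x₀ M⁻¹) :=
    ((integrableOn_inv_norm_sub_ball x₀ M⁻¹).const_mul _).const_mul _
  have i3 : IntegrableOn ((ball x₀ M⁻¹).indicator fun y => b * M ^ 2 * (M⁻¹ * ‖x₀ - y‖⁻¹))
    (ball 0 1) := ((integrable_indicator_iff measurableSet_ball).2 hlocM).integrableOn
  have i4 : IntegrableOn (fun y => f y * green 0 x y) (ball 0 1) :=
    integrable_mul_green h.continuousOn_density 0 hxB
  have j1 : IntegrableOn (fun y => 3 / 4 * f y + log (2 * (R * M)) * (ball x₀ R).indicator f y)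
    (ball 0 1) := (hfi.const_mul (3 / 4)).add (i2.const_mul (log (2 * (R * M))))
  have j2 : IntegrableOn (fun y => 3 / 4 * f y + log (2 * (R * M)) * (ball x₀ R).indicator f y
      + (ball x₀ M⁻¹).indicator (fun y => b * M ^ 2 * (M⁻¹ * ‖x₀ - y‖⁻¹)) y) (ball 0 1) := j1.add i3
  have e2 : ∫ y in ball (0 : Plane) 1, (ball x₀ R).indicator f y = ∫ y in ball x₀ R, f y := by
    rw [setIntegral_indicator measurableSet_ball, Set.inter_eq_self_of_subset_right hsub]
  have e3 : ∫ y in ball (0 : Plane) 1,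
      (ball x₀ M⁻¹).indicator (fun y => b * M ^ 2 * (M⁻¹ * ‖x₀ - y‖⁻¹)) y = 2 * π * b := by
    rw [setIntegral_indicator measurableSet_ball, Set.inter_eq_self_of_subset_right hsubM,
      integral_const_mul, integral_const_mul, integral_inv_norm_sub_ball x₀ (by positivity)]
    field_simp
  have key : ∫ y in ball (0 : Plane) 1, (f y * green 0 x₀ y - (2 * π)⁻¹ * (3 / 4 * f y
      + log (2 * (R * M)) * (ball x₀ R).indicator f y
      + (ball x₀ M⁻¹).indicator (fun y => b * M ^ 2 * (M⁻¹ * ‖x₀ - y‖⁻¹)) y))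
      ≤ ∫ y in ball (0 : Plane) 1, f y * green 0 x y := by
    refine integral_mono_ae (i1.sub (j2.const_mul _)) i4 ?_
    filter_upwards [ae_mem_ball_and_ne x, ae_mem_ball_and_ne x₀] with y ⟨hy, hxy⟩ ⟨_, hx₀y⟩
    have hy' := ball_subset_closedBall hy
    have h0 : 0 ≤ f y := h.density_nonneg hy'
    have h1 := mul_le_mul_of_nonneg_left
      (green_sub_le hp.mem hxB hy hR hRd hM hxR hxy hx₀y) h0
    have hind : (ball x₀ R).indicator f y = f y * (ball x₀ R).indicator 1 y := by
      by_cases hyR : y ∈ ball x₀ R <;> simp [hyR]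
    have h2 : f y * ((ball x₀ M⁻¹).indicator 1 y * (M⁻¹ * ‖x₀ - y‖⁻¹))
        ≤ (ball x₀ M⁻¹).indicator (fun y => b * M ^ 2 * (M⁻¹ * ‖x₀ - y‖⁻¹)) y := by
      by_cases hyM : y ∈ ball x₀ M⁻¹
      · have := h.density_le hp hy'
        simp only [Set.indicator_of_mem hyM, Pi.one_apply, one_mul]
        gcongr
      · simp [hyM]
    have h3 := mul_le_mul_of_nonneg_left h2 (by positivity : 0 ≤ (2 * π)⁻¹)
    rw [hind]
    linarith
  have e5 : ∫ y in ball (0 : Plane) 1, (f y * green 0 x₀ y - (2 * π)⁻¹ * (3 / 4 * f y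
      + log (2 * (R * M)) * (ball x₀ R).indicator f y
      + (ball x₀ M⁻¹).indicator (fun y => b * M ^ 2 * (M⁻¹ * ‖x₀ - y‖⁻¹)) y))
      = (∫ y in ball (0 : Plane) 1, f y * green 0 x₀ y)
        - (2 * π)⁻¹ * (3 / 4 * (∫ y in ball (0 : Plane) 1, f y)
        + log (2 * (R * M)) * (∫ y in ball x₀ R, f y) + 2 * π * b) := by
    rw [integral_sub i1 (j2.const_mul _), integral_const_mul, integral_add j1 i3,
      integral_add (hfi.const_mul (3 / 4)) (i2.const_mul (log (2 * (R * M)))), integral_const_mul,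
      integral_const_mul, e2, e3]
  rw [e5] at key
  have v0 := h.eq_potential hp.mem
  have v1 := h.eq_potential hxB
  rw [potential] at v0 v1
  rw [← v0, ← v1, hp.val] at key
  have hm := h.integral_density_le
  have h4 := mul_le_mul_of_nonneg_left hm (by positivity : 0 ≤ (2 * π)⁻¹ * (3 / 4))
  linarith

/-- A disc of radius a large multiple of `1 / M` around the peak carries mass more than `2π`. -/
lemma two_pi_lt_mass (h : IsLiouvilleSolution b C A s u V) (hp : IsPeak u M x₀) {R : ℝ}
    (hR : 0 < R) (hRd : R ≤ (1 - ‖x₀‖) / 4) (hRM : 1 ≤ R * M)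
    (hbig : 32 * C * exp (b + 3 * (b * C) / (8 * π)) < π * (R * M)) :
    2 * π < ∫ y in ball x₀ R, density u V y := by
  by_contra hc
  rw [not_lt] at hc
  have hM := hp.pos
  have hn0 := norm_lt_one_of_mem hp.mem
  set c := b + 3 * (b * C) / (8 * π) with hcdef
  have hsub : ball x₀ (R / 4) ⊆ ball (0 : Plane) 1 := ball_subset_of_le (by linarith)
  have hlog : 0 ≤ log (2 * (R * M)) := log_nonneg (by linarith)
  have hlow : ∀ x ∈ ball x₀ (R / 4), M ^ 2 * exp (-c) / (2 * (R * M)) ≤ exp (u x) := by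
    intro x hx
    have h1 := h.le_u_near_peak hp hR hRd hRM hx
    have h2 := mul_le_mul_of_nonneg_left hc hlog
    have h3 : 2 * log M - c - log (2 * (R * M)) ≤ u x := by
      refine le_trans ?_ h1
      have h4 : (2 * π)⁻¹ * (3 / 4 * (b * C)
        + log (2 * (R * M)) * (∫ y in ball x₀ R, density u V y) + 2 * π * b) ≤ (2 * π)⁻¹ *
        (3 / 4 * (b * C) + log (2 * (R * M)) * (2 * π) + 2 * π * b) := by gcongr
      have h5 : (2 * π)⁻¹ * (3 / 4 * (b * C) + log (2 * (R * M)) * (2 * π) + 2 * π * b)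
          = c + log (2 * (R * M)) := by
        rw [hcdef]; field_simp; ring
      linarith
    calc _ = exp (2 * log M - c - log (2 * (R * M))) := by
          rw [exp_sub, exp_log (by positivity), sub_eq_add_neg, exp_add, mul_comm 2 (log M),
            exp_mul, exp_log hM]
          norm_num
      _ ≤ _ := exp_le_exp.2 h3
  have h1 : ∫ x in ball x₀ (R / 4), M ^ 2 * exp (-c) / (2 * (R * M))
      ≤ ∫ x in ball x₀ (R / 4), exp (u x) :=
    setIntegral_mono_on (integrableOn_const measure_ball_lt_top.ne)
      (h.integrableOn_exp.mono_set hsub)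
      measurableSet_ball hlow
  rw [setIntegral_const, volume_real_ball_plane _ (by positivity), smul_eq_mul] at h1
  have h2 := h1.trans (h.setIntegral_exp_le hsub)
  have h3 : π * (R / 4) ^ 2 * (M ^ 2 * exp (-c) / (2 * (R * M))) = π * (R * M) * exp (-c) / 32 := by
    field_simp; ring
  rw [h3, exp_neg, div_le_iff₀ (by norm_num), ← div_eq_mul_inv, div_le_iff₀ (exp_pos c)] at h2
  linarith

/-- A concentrated mass at the peak forces a lower bound of the peak value. -/
lemma mass_mul_log_le (h : IsLiouvilleSolution b C A s u V) (hp : IsPeak u M x₀) {R : ℝ}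
    (hR : 0 < R) (hRd : R ≤ 1 - ‖x₀‖) :
    (∫ y in ball x₀ R, density u V y) * ((2 * π)⁻¹ * log ((1 - ‖x₀‖) / R)) ≤ 2 * log M := by
  have hn0 := norm_lt_one_of_mem hp.mem
  have hd : 0 < 1 - ‖x₀‖ := by linarith
  have hsub : ball x₀ R ⊆ ball (0 : Plane) 1 := ball_subset_of_le hRd
  have i1 := integrable_mul_green h.continuousOn_density 0 hp.mem
  rw [← hp.val, h.eq_potential hp.mem, potential, ← integral_mul_const]
  calc _ ≤ ∫ y in ball x₀ R, density u V y * green 0 x₀ y := by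
        refine integral_mono_ae ((h.integrableOn_density.mono_set hsub).mul_const _)
          (i1.mono_set hsub) ?_
        filter_upwards [ae_restrict_of_ae_restrict_of_subset hsub (ae_mem_ball_and_ne x₀),
          ae_restrict_mem measurableSet_ball] with y ⟨hy, hxy⟩ hyR
        refine mul_le_mul_of_nonneg_left ?_ (h.density_nonneg (ball_subset_closedBall hy))
        have hd0 : 0 < ‖x₀ - y‖ := norm_pos_iff.2 (sub_ne_zero.2 hxy)
        rw [mem_ball, dist_comm, dist_eq_norm] at hyR
        rw [green_zero_eq]
        refine mul_le_mul_of_nonneg_left ?_ (by positivity)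
        rw [log_div hd.ne' hR.ne']
        have h1 := log_le_log hd (one_sub_norm_le_sqrt_imageSq hn0.le (norm_lt_one_of_mem hy).le)
        have h2 := log_le_log hd0 hyR.le
        linarith
    _ ≤ _ := by
        refine setIntegral_mono_set i1 ?_ hsub.eventuallyLE
        filter_upwards [ae_mem_ball_and_ne x₀] with y ⟨hy, hxy⟩
        exact mul_nonneg (h.density_nonneg (ball_subset_closedBall hy))
          (green_nonneg hn0.le (norm_lt_one_of_mem hy).le (.inl hxy))

end IsLiouvilleSolution

/-- Divergence of a vector field on the plane. -/
noncomputable def planeDiv (X : Plane → Plane) (x : Plane) : ℝ :=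
  ∑ i : Fin 2, lineDeriv ℝ (fun z => X z i) x (EuclideanSpace.single i 1)

lemma lipschitzWith_coord {X : Plane → Plane} {K : NNReal} (hX : LipschitzWith K X) (i : Fin 2) :
    LipschitzWith K (fun z => X z i) := by
  refine LipschitzWith.of_dist_le_mul fun x y => ?_
  refine le_trans ?_ (hX.dist_le_mul x y)
  rw [dist_eq_norm, dist_eq_norm]
  exact PiLp.norm_apply_le (X x - X y) i

lemma abs_lineDeriv_coord_le {g : Plane → ℝ} {K : NNReal} (hg : LipschitzWith K g) (i : Fin 2)
    (x : Plane) : |lineDeriv ℝ g x (EuclideanSpace.single i 1)| ≤ K := by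
  have := norm_lineDeriv_le_of_lipschitz ℝ (v := EuclideanSpace.single i (1 : ℝ)) hg (x₀ := x)
  simpa using this

lemma abs_planeDiv_le {X : Plane → Plane} {K : NNReal} (hX : LipschitzWith K X) (x : Plane) :
    |planeDiv X x| ≤ 2 * K := by
  rw [planeDiv, Fin.sum_univ_two]
  have h0 := abs_lineDeriv_coord_le (lipschitzWith_coord hX 0) 0 x
  have h1 := abs_lineDeriv_coord_le (lipschitzWith_coord hX 1) 1 x
  exact (abs_add_le _ _).trans (by linarith)

lemma planeDiv_congr {X Y : Plane → Plane} {x : Plane} (h : X =ᶠ[𝓝 x] Y) :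
    planeDiv X x = planeDiv Y x := by
  refine Finset.sum_congr rfl fun i _ => ?_
  refine Filter.EventuallyEq.lineDeriv_eq ?_
  filter_upwards [h] with z hz
  rw [hz]

lemma planeDiv_sub_const (a x : Plane) : planeDiv (fun z => z - a) x = 2 := by
  have : ∀ i : Fin 2,
      lineDeriv ℝ (fun z : Plane => (z - a) i) x (EuclideanSpace.single i 1) = 1 := by
    intro i
    have hd : HasFDerivAt (fun z : Plane => (z - a) i) (EuclideanSpace.proj i : Plane →L[ℝ] ℝ) x :=
      ((EuclideanSpace.proj i : Plane →L[ℝ] ℝ).hasFDerivAt (x := x)).sub_const (a i)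
    rw [(hd.hasLineDerivAt _).lineDeriv]
    simp
  rw [planeDiv, Fin.sum_univ_two, this, this]; norm_num

lemma planeDiv_zero (x : Plane) : planeDiv (fun _ => 0) x = 0 := by
  have : ∀ i : Fin 2,
      lineDeriv ℝ (fun _ : Plane => (0 : Plane) i) x (EuclideanSpace.single i 1) = 0 := fun i =>
    ((hasFDerivAt_const ((0 : Plane) i) x).hasLineDerivAt _).lineDeriv
  rw [planeDiv, Fin.sum_univ_two, this, this, add_zero]

lemma apply_eq_sum_coord (T : Plane →L[ℝ] ℝ) (v : Plane) :
    T v = v 0 * T (EuclideanSpace.single 0 1) + v 1 * T (EuclideanSpace.single 1 1) := by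
  have : v = v 0 • EuclideanSpace.single 0 (1 : ℝ) + v 1 • EuclideanSpace.single 1 (1 : ℝ) := by
    ext i; fin_cases i <;> simp
  conv_lhs => rw [this]
  simp

namespace IsLiouvilleSolution

variable {b C A s : ℝ} {u V : Plane → ℝ} {M : ℝ} {x₀ : Plane}

lemma exp_sub_one_nonneg (h : IsLiouvilleSolution b C A s u V) {x : Plane}
    (hx : x ∈ ball (0 : Plane) 1) : 0 ≤ exp (u x) - 1 := by
  linarith [add_one_le_exp (u x), h.u_nonneg hx]

lemma integrableOn_exp_sub_one (h : IsLiouvilleSolution b C A s u V) :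
    IntegrableOn (fun x => exp (u x) - 1) (ball (0 : Plane) 1) :=
  h.integrableOn_exp.sub (integrableOn_const measure_ball_lt_top.ne)

lemma aestronglyMeasurable_fderiv (h : IsLiouvilleSolution b C A s u V) :
    AEStronglyMeasurable (fderiv ℝ u) (volume.restrict (ball (0 : Plane) 1)) :=
  (h.reg.continuousOn_fderiv_of_isOpen isOpen_ball (by norm_num)).aestronglyMeasurable
    measurableSet_ball

lemma integrableOn_exp_mul_fderiv (h : IsLiouvilleSolution b C A s u V) (hp : IsPeak u M x₀)
    {X : Plane → Plane} (hX : AEStronglyMeasurable X (volume.restrict (ball (0 : Plane) 1))) {N : ℝ}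
    (hN : ∀ x ∈ ball (0 : Plane) 1, ‖X x‖ ≤ N) :
    IntegrableOn (fun x => exp (u x) * fderiv ℝ u x (X x)) (ball 0 1) := by
  have hm : AEStronglyMeasurable (fun x => fderiv ℝ u x (X x))
      (volume.restrict (ball (0 : Plane) 1)) :=
    (ContinuousLinearMap.apply ℝ ℝ : Plane →L[ℝ] _).aestronglyMeasurable_comp₂ hX
      h.aestronglyMeasurable_fderiv
  refine h.integrableOn_exp.mul_bdd (c := gradConst b C * M * N) hm ?_
  filter_upwards [ae_restrict_mem measurableSet_ball] with x hx
  have := h.gradConst_pos; have := hp.pos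
  exact ((fderiv ℝ u x).le_opNorm _).trans
    (mul_le_mul (h.norm_fderiv_le hp hx) (hN x hx) (norm_nonneg _) (by positivity))

lemma integrableOn_exp_sub_one_mul_lineDeriv (h : IsLiouvilleSolution b C A s u V)
    {g : Plane → ℝ} {K : NNReal} (hg : LipschitzWith K g) (i : Fin 2) :
    IntegrableOn (fun x => (exp (u x) - 1) * lineDeriv ℝ g x (EuclideanSpace.single i 1))
      (ball (0 : Plane) 1) :=
  h.integrableOn_exp_sub_one.mul_bdd (c := K)
    (measurable_lineDeriv hg.continuous).aestronglyMeasurable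
    (Eventually.of_forall fun x => abs_lineDeriv_coord_le hg i x)

/-- Divergence theorem for `(e^u - 1) X`. -/
lemma integral_exp_mul_fderiv (h : IsLiouvilleSolution b C A s u V) (hp : IsPeak u M x₀)
    {X : Plane → Plane} {K : NNReal} (hX : ∀ i, LipschitzWith K (fun z => X z i)) :
    ∫ x in ball (0 : Plane) 1, exp (u x) * fderiv ℝ u x (X x)
      = -∫ x in ball (0 : Plane) 1, (exp (u x) - 1) * planeDiv X x := by
  have hi : ∀ i : Fin 2, IntegrableOn (fun x => X x i *
      (exp (u x) * fderiv ℝ u x (EuclideanSpace.single i 1))) (ball 0 1) := fun i => by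
    obtain ⟨F, hF⟩ := (isCompact_closedBall (0 : Plane) 1).exists_bound_of_continuousOn
      (hX i).continuous.continuousOn
    refine Integrable.bdd_mul (c := F) (h.integrableOn_exp_mul_fderiv hp
      (X := fun _ => EuclideanSpace.single i 1) aestronglyMeasurable_const (N := 1) (by simp))
      (hX i).continuous.aestronglyMeasurable ?_
    filter_upwards [ae_restrict_mem measurableSet_ball] with x hx
    exact hF x (ball_subset_closedBall hx)
  have e1 : ∀ x, exp (u x) * fderiv ℝ u x (X x)
      = X x 0 * (exp (u x) * fderiv ℝ u x (EuclideanSpace.single 0 1))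
        + X x 1 * (exp (u x) * fderiv ℝ u x (EuclideanSpace.single 1 1)) := fun x => by
    rw [apply_eq_sum_coord]; ring
  simp only [e1, planeDiv, Fin.sum_univ_two, mul_add]
  rw [integral_add (hi 0) (hi 1), integral_add (h.integrableOn_exp_sub_one_mul_lineDeriv (hX 0) 0)
    (h.integrableOn_exp_sub_one_mul_lineDeriv (hX 1) 1), h.integral_mul_fderiv_exp hp (hX 0),
    h.integral_mul_fderiv_exp hp (hX 1)]
  ring

lemma integrableOn_exp_sub_one_mul_planeDiv (h : IsLiouvilleSolution b C A s u V)
    {X : Plane → Plane} {K : NNReal} (hX : ∀ i, LipschitzWith K (fun z => X z i)) :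
    IntegrableOn (fun x => (exp (u x) - 1) * planeDiv X x) (ball (0 : Plane) 1) := by
  simp only [planeDiv, Fin.sum_univ_two, mul_add]
  exact (h.integrableOn_exp_sub_one_mul_lineDeriv (hX 0) 0).add
    (h.integrableOn_exp_sub_one_mul_lineDeriv (hX 1) 1)

end IsLiouvilleSolution

/-- The field `x - x₀`, cut off between the radii `R` and `2 * R`. -/
noncomputable def cutField (x₀ : Plane) (R : ℝ) (x : Plane) : Plane :=
  max 0 (min 1 (2 - ‖x - x₀‖ / R)) • (x - x₀)

section cutField

variable {x₀ : Plane} {R : ℝ}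

lemma cutField_of_le (hR : 0 < R) {x : Plane} (hx : ‖x - x₀‖ ≤ R) : cutField x₀ R x = x - x₀ := by
  have : ‖x - x₀‖ / R ≤ 1 := (div_le_one hR).2 hx
  rw [cutField, min_eq_left (by linarith), max_eq_right zero_le_one, one_smul]

lemma cutField_of_ge (hR : 0 < R) {x : Plane} (hx : 2 * R ≤ ‖x - x₀‖) : cutField x₀ R x = 0 := by
  have : 2 ≤ ‖x - x₀‖ / R := (le_div_iff₀ hR).2 hx
  rw [cutField, min_eq_right (by linarith), max_eq_left (by linarith), zero_smul]

lemma norm_cutField_le (hR : 0 < R) (x : Plane) : ‖cutField x₀ R x‖ ≤ 2 * R := by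
  rcases le_total (2 * R) ‖x - x₀‖ with hx | hx
  · rw [cutField_of_ge hR hx, norm_zero]; positivity
  · rw [cutField, norm_smul, norm_of_nonneg (le_max_left _ _)]
    have : max 0 (min 1 (2 - ‖x - x₀‖ / R)) ≤ 1 := max_le zero_le_one (min_le_left _ _)
    exact (mul_le_of_le_one_left (norm_nonneg _) this).trans hx

lemma lipschitzWith_cutField (hR : 0 < R) : LipschitzWith 3 (cutField x₀ R) := by
  have key : ∀ x y : Plane, ‖y - x₀‖ ≤ 2 * R →
      ‖cutField x₀ R x - cutField x₀ R y‖ ≤ 3 * ‖x - y‖ := by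
    intro x y hy
    set p := max 0 (min 1 (2 - ‖x - x₀‖ / R)) with hp
    set q := max 0 (min 1 (2 - ‖y - x₀‖ / R)) with hq
    have hpq : |p - q| ≤ ‖x - y‖ / R := by
      have h2 : |p - q| ≤ |2 - ‖x - x₀‖ / R - (2 - ‖y - x₀‖ / R)| := by
        rw [hp, hq, max_comm 0, max_comm 0, min_comm 1, min_comm 1]
        exact (abs_max_sub_max_le_abs _ _ 0).trans
            (abs_min_sub_min_le_max _ _ _ _ |>.trans (by simp))
      refine h2.trans ?_
      have h1 : 2 - ‖x - x₀‖ / R - (2 - ‖y - x₀‖ / R) = (‖y - x₀‖ - ‖x - x₀‖) / R := by ring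
      rw [h1, abs_div, abs_of_pos hR]
      gcongr
      refine (abs_norm_sub_norm_le _ _).trans (le_of_eq ?_)
      rw [sub_sub_sub_cancel_right, norm_sub_rev]
    have hp1 : p ≤ 1 := max_le zero_le_one (min_le_left _ _)
    have hp0 : 0 ≤ p := le_max_left _ _
    have e : cutField x₀ R x - cutField x₀ R y = p • (x - y) + (p - q) • (y - x₀) := by
      rw [cutField, cutField, ← hp, ← hq]; module
    rw [e]
    calc _ ≤ p * ‖x - y‖ + |p - q| * ‖y - x₀‖ := by
          refine (norm_add_le _ _).trans (le_of_eq ?_)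
          rw [norm_smul, norm_smul, norm_of_nonneg hp0, norm_eq_abs]
      _ ≤ 1 * ‖x - y‖ + ‖x - y‖ / R * (2 * R) := by gcongr
      _ = _ := by field_simp; ring
  refine LipschitzWith.of_dist_le_mul fun x y => ?_
  rw [dist_eq_norm, dist_eq_norm]
  simp only [NNReal.coe_ofNat]
  rcases le_total ‖y - x₀‖ (2 * R) with hy | hy
  · exact key x y hy
  · rcases le_total ‖x - x₀‖ (2 * R) with hx | hx
    · rw [norm_sub_rev, norm_sub_rev x]; exact key y x hx
    · rw [cutField_of_ge hR hx, cutField_of_ge hR hy, sub_zero, norm_zero]; positivity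

lemma planeDiv_cutField_of_lt (hR : 0 < R) {x : Plane} (hx : x ∈ ball x₀ R) :
    planeDiv (cutField x₀ R) x = 2 := by
  rw [← planeDiv_sub_const x₀ x]
  refine planeDiv_congr ?_
  filter_upwards [isOpen_ball.mem_nhds hx] with z hz
  rw [mem_ball, dist_eq_norm] at hz
  exact cutField_of_le hR hz.le

lemma planeDiv_cutField_of_gt (hR : 0 < R) {x : Plane} (hx : x ∉ closedBall x₀ (2 * R)) :
    planeDiv (cutField x₀ R) x = 0 := by
  rw [← planeDiv_zero x]
  refine planeDiv_congr ?_
  filter_upwards [isClosed_closedBall.isOpen_compl.mem_nhds hx] with z hz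
  rw [Set.mem_compl_iff, mem_closedBall, not_le, dist_eq_norm] at hz
  exact cutField_of_ge hR hz.le

end cutField

/-- The symmetrised interaction kernel. -/
lemma inner_gradGreen_add (x y v w : Plane) :
    inner ℝ (gradGreen 0 x y) v + inner ℝ (gradGreen 0 y x) w
      = (2 * π)⁻¹ * ((imageSq x y)⁻¹ * (inner ℝ (‖y‖ ^ 2 • x - y) v + inner ℝ (‖x‖ ^ 2 • y - x) w)
        - (‖x - y‖ ^ 2)⁻¹ * inner ℝ (x - y) (v - w)) := by
  have h1 : inner ℝ (y - x) w = -inner ℝ (x - y) w := by rw [← inner_neg_left, neg_sub]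
  rw [gradGreen, gradGreen, imageSq_comm y x, norm_sub_rev y x]
  simp only [inner_smul_left, inner_sub_left (E := Plane) (_ • _) (_ • _), inner_sub_right,
    RCLike.conj_to_real, h1]
  simp only [ne_eq, OfNat.ofNat_ne_zero, not_false_eq_true, zero_pow, add_zero]
  ring

lemma abs_inv_imageSq_mul_inner_le {x y v : Plane} (hx : ‖x‖ < 1) (hy : ‖y‖ ≤ 1) {δ N : ℝ}
    (hδ : 0 < δ) (hv : ‖v‖ ≤ N) (hxδ : v ≠ 0 → δ ≤ 1 - ‖x‖) :
    |(imageSq x y)⁻¹ * inner ℝ (‖y‖ ^ 2 • x - y) v| ≤ N / δ := by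
  have hN : 0 ≤ N := (norm_nonneg v).trans hv
  rcases eq_or_ne v 0 with rfl | h0
  · simp; positivity
  · have hs := sqrt_imageSq_pos hx hy
    have hP := imageSq_pos hx hy
    have h1 := (hxδ h0).trans (one_sub_norm_le_sqrt_imageSq hx.le hy)
    rw [abs_mul, abs_of_pos (inv_pos.2 hP)]
    calc _ ≤ (imageSq x y)⁻¹ * (‖‖y‖ ^ 2 • x - y‖ * ‖v‖) := by
          gcongr; exact abs_real_inner_le_norm _ _
      _ ≤ (imageSq x y)⁻¹ * (1 * √(imageSq x y) * N) := by
          rw [norm_sq_smul_sub]; gcongr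
      _ = N / √(imageSq x y) := by
          rw [div_eq_mul_inv, mul_comm N]
          nth_rewrite 1 [← sq_sqrt hP.le]
          field_simp
      _ ≤ N / δ := by gcongr

lemma inv_sq_mul_inner_le {a v : Plane} {t : ℝ} (ha : 0 < ‖a‖) (hv : ‖v‖ ≤ t * ‖a‖) :
    (‖a‖ ^ 2)⁻¹ * inner ℝ a v ≤ t := by
  rw [inv_mul_le_iff₀ (by positivity)]
  have := real_inner_le_norm a v
  nlinarith

/-- The annulus between the radii `R` and `R'`. -/
def annulus (x₀ : Plane) (R R' : ℝ) : Set Plane := ball x₀ R' \ ball x₀ R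

lemma measurableSet_annulus (x₀ : Plane) (R R' : ℝ) : MeasurableSet (annulus x₀ R R') :=
  measurableSet_ball.diff measurableSet_ball

lemma cutField_singular_le {x₀ x y : Plane} {R L : ℝ} (hR : 0 < R) (hL : 3 ≤ L) (hxy : x ≠ y) :
    (‖x - y‖ ^ 2)⁻¹ * inner ℝ (x - y) (cutField x₀ R x - cutField x₀ R y)
      ≤ (ball x₀ R).indicator 1 x * (ball x₀ R).indicator 1 y
        + 3 * ((annulus x₀ R (L * R)).indicator 1 x + (annulus x₀ R (L * R)).indicator 1 y)
        + 1 / (L - 1) := by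
  have hd : 0 < ‖x - y‖ := norm_pos_iff.2 (sub_ne_zero.2 hxy)
  have hL1 : 0 < L - 1 := by linarith
  have hi : ∀ (T : Set Plane) z, (0 : ℝ) ≤ T.indicator 1 z := fun T z =>
    Set.indicator_nonneg (fun _ _ => zero_le_one) z
  have hbd : ∀ z, z ∈ ball x₀ R ↔ ‖z - x₀‖ < R := fun z => by rw [mem_ball, dist_eq_norm]
  have hpp := mul_nonneg (hi (ball x₀ R) x) (hi (ball x₀ R) y)
  have hq := inv_pos.2 hL1
  have hRL : 2 * R ≤ L * R := by nlinarith
  have hnear : ∀ z w : Plane, ‖z - x₀‖ < R → L * R ≤ ‖w - x₀‖ →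
      ‖z - x₀‖ ≤ 1 / (L - 1) * ‖z - w‖ := by
    intro z w hz hw
    rw [one_div, ← div_eq_inv_mul, le_div_iff₀ hL1]
    have h1 : ‖w - x₀‖ ≤ ‖z - x₀‖ + ‖z - w‖ := by
      have := norm_sub_le (z - x₀) (z - w)
      rwa [sub_sub_sub_cancel_left] at this
    nlinarith
  by_cases hxS : x ∈ annulus x₀ R (L * R) ∨ y ∈ annulus x₀ R (L * R)
  · have h1 : (1 : ℝ) ≤ (annulus x₀ R (L * R)).indicator 1 x
        + (annulus x₀ R (L * R)).indicator 1 y := by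
      rcases hxS with h | h
      · rw [Set.indicator_of_mem h]; have := hi (annulus x₀ R (L * R)) y
        simp only [Pi.one_apply]; linarith
      · rw [Set.indicator_of_mem h]; have := hi (annulus x₀ R (L * R)) x
        simp only [Pi.one_apply]; linarith
    have h2 := (lipschitzWith_cutField (x₀ := x₀) hR).dist_le_mul x y
    rw [dist_eq_norm, dist_eq_norm] at h2
    have h3 := inv_sq_mul_inner_le hd h2
    have h4 : ((3 : NNReal) : ℝ) = 3 := rfl
    rw [one_div]
    linarith
  · rw [not_or] at hxS
    have hout : ∀ z, z ∉ annulus x₀ R (L * R) → z ∉ ball x₀ R → L * R ≤ ‖z - x₀‖ := by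
      intro z hz hzR
      by_contra hc
      exact hz ⟨by rw [mem_ball, dist_eq_norm]; exact not_le.1 hc, hzR⟩
    rw [Set.indicator_of_notMem hxS.1, Set.indicator_of_notMem hxS.2]
    by_cases hx : x ∈ ball x₀ R <;> by_cases hy : y ∈ ball x₀ R
    · rw [cutField_of_le hR ((hbd x).1 hx).le, cutField_of_le hR ((hbd y).1 hy).le,
        sub_sub_sub_cancel_right, real_inner_self_eq_norm_sq, inv_mul_cancel₀ (by positivity),
        Set.indicator_of_mem hx, Set.indicator_of_mem hy]
      simp only [Pi.one_apply, one_div]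
      linarith
    · have h1 := hout y hxS.2 hy
      rw [cutField_of_le hR ((hbd x).1 hx).le, cutField_of_ge hR (hRL.trans h1), sub_zero]
      have := inv_sq_mul_inner_le hd (hnear x y ((hbd x).1 hx) h1)
      linarith
    · have h1 := hout x hxS.1 hx
      rw [cutField_of_le hR ((hbd y).1 hy).le, cutField_of_ge hR (hRL.trans h1), zero_sub]
      have h2 := hnear y x ((hbd y).1 hy) h1
      rw [norm_sub_rev y x, ← norm_neg] at h2
      have := inv_sq_mul_inner_le hd h2
      linarith
    · rw [cutField_of_ge hR (hRL.trans (hout x hxS.1 hx)),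
        cutField_of_ge hR (hRL.trans (hout y hxS.2 hy)), sub_zero, inner_zero_right, mul_zero]
      rw [one_div]
      linarith

namespace IsLiouvilleSolution

variable {b C A s : ℝ} {u V : Plane → ℝ} {M : ℝ} {x₀ : Plane}

lemma integral_density_cutField_ge (h : IsLiouvilleSolution b C A s u V) (hp : IsPeak u M x₀)
    {R L : ℝ} (hR : 0 < R) (hL : 3 ≤ L) (hRd : L * R ≤ (1 - ‖x₀‖) / 4) :
    -(4 * π)⁻¹ * (∫ y in ball x₀ R, density u V y) ^ 2
      - 3 * (2 * π)⁻¹ * (b * C) * (∫ y in annulus x₀ R (L * R), density u V y)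
      - (4 * π)⁻¹ * (1 / (L - 1) + 8 * (R / (1 - ‖x₀‖))) * (b * C) ^ 2
      ≤ ∫ x in ball (0 : Plane) 1, density u V x * fderiv ℝ u x (cutField x₀ R x) := by
  have hn0 := norm_lt_one_of_mem hp.mem
  have hd : 0 < 1 - ‖x₀‖ := by linarith
  have hRL : 3 * R ≤ L * R := by nlinarith
  have hsub : ball x₀ (L * R) ⊆ ball (0 : Plane) 1 := ball_subset_of_le (by linarith)
  have hsubR : ball x₀ R ⊆ ball (0 : Plane) 1 := ball_subset_of_le (by linarith)
  have hsubS : annulus x₀ R (L * R) ⊆ ball (0 : Plane) 1 := Set.sdiff_subset.trans hsub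
  have himg : ∀ x ∈ ball (0 : Plane) 1, ∀ y ∈ ball (0 : Plane) 1,
      |(imageSq x y)⁻¹ * inner ℝ (‖y‖ ^ 2 • x - y) (cutField x₀ R x)| ≤ 4 * (R / (1 - ‖x₀‖)) := by
    intro x hx y hy
    have := abs_inv_imageSq_mul_inner_le (norm_lt_one_of_mem hx) (norm_lt_one_of_mem hy).le
      (half_pos hd) (norm_cutField_le (x₀ := x₀) hR x) (fun h0 => by
        by_contra hc
        refine h0 (cutField_of_ge hR ?_)
        have := norm_sub_norm_le x x₀
        linarith)
    refine this.trans (le_of_eq ?_)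
    field_simp; norm_num
  have key := h.le_integral_density_mul_inner hp (X := cutField x₀ R)
    (lipschitzWith_cutField hR).continuous.measurable (fun x _ => norm_cutField_le hR x)
    measurableSet_ball (measurableSet_annulus x₀ R (L * R)) hsubR hsubS
    (α := -(2 * π)⁻¹) (β := 3 * (2 * π)⁻¹) (γ := (2 * π)⁻¹ * (1 / (L - 1) + 8 * (R / (1 - ‖x₀‖))))
    (fun x hx y hy hxy => by
      rw [inner_gradGreen_add]
      have h1 := (abs_le.1 (himg x hx y hy)).1
      have h2 := (abs_le.1 (himg y hy x hx)).1
      have h3 := cutField_singular_le (x₀ := x₀) hR hL hxy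
      rw [imageSq_comm y x] at h2
      have h4 : -((ball x₀ R).indicator 1 x * (ball x₀ R).indicator 1 y
        + 3 * ((annulus x₀ R (L * R)).indicator 1 x + (annulus x₀ R (L * R)).indicator 1 y)
        + (1 / (L - 1) + 8 * (R / (1 - ‖x₀‖)))) ≤ (imageSq x y)⁻¹ *
          (inner ℝ (‖y‖ ^ 2 • x - y) (cutField x₀ R x)
            + inner ℝ (‖x‖ ^ 2 • y - x) (cutField x₀ R y))
        - (‖x - y‖ ^ 2)⁻¹ * inner ℝ (x - y) (cutField x₀ R x - cutField x₀ R y) := by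
        rw [mul_add]; linarith
      have h5 := mul_le_mul_of_nonneg_left h4 (by positivity : 0 ≤ (2 * π)⁻¹)
      refine le_trans (le_of_eq ?_) h5
      ring)
  refine le_trans ?_ key
  have hm := h.integral_density_le
  have hm0 := h.setIntegral_density_nonneg measurableSet_ball (subset_refl (ball (0 : Plane) 1))
  have hη := h.setIntegral_density_nonneg (measurableSet_annulus x₀ R (L * R)) hsubS
  set m := ∫ y in ball (0 : Plane) 1, density u V y
  set η := ∫ y in annulus x₀ R (L * R), density u V y
  set μ := ∫ y in ball x₀ R, density u V y
  have hL1 : 0 < L - 1 := by linarith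
  have h1 : 3 * (2 * π)⁻¹ * m * η ≤ 3 * (2 * π)⁻¹ * (b * C) * η := by gcongr
  have h2 : (4 * π)⁻¹ * (1 / (L - 1) + 8 * (R / (1 - ‖x₀‖))) * m ^ 2
    ≤ (4 * π)⁻¹ * (1 / (L - 1) + 8 * (R / (1 - ‖x₀‖))) * (b * C) ^ 2 := by gcongr
  have h3 : (-(2 * π)⁻¹ * μ ^ 2 - 2 * (3 * (2 * π)⁻¹) * m * η
      - (2 * π)⁻¹ * (1 / (L - 1) + 8 * (R / (1 - ‖x₀‖))) * m ^ 2) / 2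
    = -(4 * π)⁻¹ * μ ^ 2 - 3 * (2 * π)⁻¹ * m * η
      - (4 * π)⁻¹ * (1 / (L - 1) + 8 * (R / (1 - ‖x₀‖))) * m ^ 2 := by
    field_simp; ring
  linarith

end IsLiouvilleSolution

namespace IsLiouvilleSolution

variable {b C A s : ℝ} {u V : Plane → ℝ} {M : ℝ} {x₀ : Plane}

lemma abs_sub_le_of_norm_le (h : IsLiouvilleSolution b C A s u V) {x y : Plane}
    (hx : x ∈ closedBall (0 : Plane) 1) (hy : y ∈ closedBall (0 : Plane) 1) {r : ℝ}
    (hr : ‖x - y‖ ≤ r) : |V x - V y| ≤ A * r ^ s :=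
  (h.holder x hx y hy).trans (mul_le_mul_of_nonneg_left
    (rpow_le_rpow (norm_nonneg _) hr h.s_pos.le) h.A_pos.le)

lemma integral_density_cutField_le (h : IsLiouvilleSolution b C A s u V) (hp : IsPeak u M x₀)
    {R L : ℝ} (hR : 0 < R) (hL : 3 ≤ L) (hRd : L * R ≤ (1 - ‖x₀‖) / 4) :
    ∫ x in ball (0 : Plane) 1, density u V x * fderiv ℝ u x (cutField x₀ R x)
      ≤ -2 * (∫ y in ball x₀ R, density u V y) + 2 * π * b * R ^ 2
        + 6 * (∫ y in annulus x₀ R (L * R), density u V y)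
        + A * C * (8 + 2 * gradConst b C * (R * M)) * (L * R) ^ s := by
  have hn0 := norm_lt_one_of_mem hp.mem
  have hb := h.b_pos
  have hA := h.A_pos
  have hM := hp.pos
  have hc := h.gradConst_pos
  have hRL : 3 * R ≤ L * R := by nlinarith
  have hsub : ball x₀ (L * R) ⊆ ball (0 : Plane) 1 := ball_subset_of_le (by linarith)
  have hsubR : ball x₀ R ⊆ ball (0 : Plane) 1 := ball_subset_of_le (by linarith)
  have hsubS : annulus x₀ R (L * R) ⊆ ball (0 : Plane) 1 := Set.sdiff_subset.trans hsub
  have hx₀ := ball_subset_closedBall hp.mem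
  have hδ : 0 ≤ (L * R) ^ s := rpow_nonneg (by linarith) s
  set δ := (L * R) ^ s with hδdef
  set X := cutField x₀ R with hXdef
  have hX3 : LipschitzWith 3 X := lipschitzWith_cutField hR
  have hXm : AEStronglyMeasurable X (volume.restrict (ball (0 : Plane) 1)) :=
    hX3.continuous.aestronglyMeasurable
  have hXN : ∀ x ∈ ball (0 : Plane) 1, ‖X x‖ ≤ 2 * R := fun x _ => norm_cutField_le hR x
  have hXc : ∀ i, LipschitzWith 3 (fun z => X z i) := lipschitzWith_coord hX3
  have iE := h.integrableOn_exp
  have iT := h.integrableOn_exp_mul_fderiv hp hXm hXN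
  have iD := h.integrableOn_exp_sub_one_mul_planeDiv hXc
  have iR : IntegrableOn ((ball x₀ R).indicator fun y => -2 * density u V y + 2 * b) (ball 0 1) :=
    ((h.integrableOn_density.const_mul (-2)).add
      (integrableOn_const measure_ball_lt_top.ne)).indicator measurableSet_ball
  have iS : IntegrableOn ((annulus x₀ R (L * R)).indicator fun y => 6 * density u V y)
    (ball 0 1) := (h.integrableOn_density.const_mul 6).indicator (measurableSet_annulus _ _ _)
  have hosc : ∀ x ∈ ball x₀ (L * R), |V x - V x₀| ≤ A * δ := fun x hx => by
    refine h.abs_sub_le_of_norm_le (ball_subset_closedBall (hsub hx)) hx₀ ?_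
    rw [mem_ball, dist_eq_norm] at hx; exact hx.le
  have hfar : ∀ x, x ∉ ball x₀ (L * R) → X x = 0 ∧ planeDiv X x = 0 := fun x hx => by
    rw [mem_ball, dist_eq_norm, not_lt] at hx
    refine ⟨cutField_of_ge hR (by linarith), planeDiv_cutField_of_gt hR ?_⟩
    rw [mem_closedBall, dist_eq_norm]
    linarith
  have hpt1 : ∀ x ∈ ball (0 : Plane) 1, (V x - V x₀) * (exp (u x) * fderiv ℝ u x (X x))
      ≤ A * δ * (gradConst b C * M * (2 * R)) * exp (u x) := by
    intro x hx
    by_cases hxL : x ∈ ball x₀ (L * R)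
    · refine (le_abs_self _).trans ?_
      rw [abs_mul, abs_mul, abs_of_pos (exp_pos _)]
      have h1 := hosc x hxL
      have h2 : |fderiv ℝ u x (X x)| ≤ gradConst b C * M * (2 * R) :=
        ((fderiv ℝ u x).le_opNorm _).trans
          (mul_le_mul (h.norm_fderiv_le hp hx) (hXN x hx) (norm_nonneg _) (by positivity))
      calc _ ≤ A * δ * (exp (u x) * (gradConst b C * M * (2 * R))) := by gcongr
        _ = _ := by ring
    · rw [(hfar x hxL).1, map_zero, mul_zero, mul_zero]
      positivity
  have hpt2 : ∀ x ∈ ball (0 : Plane) 1, -(V x₀ * ((exp (u x) - 1) * planeDiv X x))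
      ≤ (ball x₀ R).indicator (fun y => -2 * density u V y + 2 * b) x
        + (annulus x₀ R (L * R)).indicator (fun y => 6 * density u V y) x
        + 8 * (A * δ) * exp (u x) := by
    intro x hx
    have hE := exp_pos (u x)
    have hw := h.exp_sub_one_nonneg hx
    have hV0 := h.nonneg x₀ hx₀
    have hVb := h.le x₀ hx₀
    have hAE : 0 ≤ A * δ * exp (u x) := by positivity
    by_cases hxL : x ∈ ball x₀ (L * R)
    · have h1 : V x₀ * exp (u x) ≤ density u V x + A * δ * exp (u x) := by
        have := (abs_le.1 (hosc x hxL)).1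
        rw [density, ← add_mul]
        exact mul_le_mul_of_nonneg_right (by linarith) hE.le
      have h1' : density u V x ≤ V x₀ * exp (u x) + A * δ * exp (u x) := by
        have := (abs_le.1 (hosc x hxL)).2
        rw [density, ← add_mul]
        exact mul_le_mul_of_nonneg_right (by linarith) hE.le
      by_cases hxR : x ∈ ball x₀ R
      · have hxS : x ∉ annulus x₀ R (L * R) := fun hc => hc.2 hxR
        rw [Set.indicator_of_mem hxR, Set.indicator_of_notMem hxS,
          planeDiv_cutField_of_lt hR hxR]
        linarith
      · have hxS : x ∈ annulus x₀ R (L * R) := ⟨hxL, hxR⟩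
        rw [Set.indicator_of_notMem hxR, Set.indicator_of_mem hxS]
        have h2 := (abs_le.1 (abs_planeDiv_le hX3 x)).1
        have h3 : ((3 : NNReal) : ℝ) = 3 := rfl
        rw [h3] at h2
        have h4 := mul_le_mul_of_nonneg_left h2 (mul_nonneg hV0 hw)
        linarith
    · have hxR : x ∉ ball x₀ R := fun hc => hxL (ball_subset_ball (by linarith) hc)
      have hxS : x ∉ annulus x₀ R (L * R) := fun hc => hxL hc.1
      rw [Set.indicator_of_notMem hxR, Set.indicator_of_notMem hxS, (hfar x hxL).2]
      linarith
  have i1 : IntegrableOn (fun x => (V x - V x₀) * (exp (u x) * fderiv ℝ u x (X x))) (ball 0 1) := by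
    refine iT.bdd_mul (c := 2 * b) ((aestronglyMeasurable_of_continuousOn h.continuousOn_V).sub
      aestronglyMeasurable_const) ?_
    filter_upwards [ae_restrict_mem measurableSet_ball] with x hx
    have hx' := ball_subset_closedBall hx
    rw [norm_eq_abs, abs_le]
    have := h.nonneg x hx'; have := h.le x hx'; have := h.nonneg x₀ hx₀; have := h.le x₀ hx₀
    constructor <;> linarith
  have iRS : IntegrableOn (fun x => (ball x₀ R).indicator (fun y => -2 * density u V y + 2 * b) x
        + (annulus x₀ R (L * R)).indicator (fun y => 6 * density u V y) x) (ball 0 1) := iR.add iS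
  have iRSE : IntegrableOn (fun x => (ball x₀ R).indicator (fun y => -2 * density u V y + 2 * b) x
        + (annulus x₀ R (L * R)).indicator (fun y => 6 * density u V y) x
        + 8 * (A * δ) * exp (u x)) (ball 0 1) := iRS.add (iE.const_mul _)
  have e1 : ∫ x in ball (0 : Plane) 1, density u V x * fderiv ℝ u x (X x)
      = (∫ x in ball (0 : Plane) 1, (V x - V x₀) * (exp (u x) * fderiv ℝ u x (X x)))
        + ∫ x in ball (0 : Plane) 1, -(V x₀ * ((exp (u x) - 1) * planeDiv X x)) := by
    rw [integral_neg, integral_const_mul, ← mul_neg, ← h.integral_exp_mul_fderiv hp hXc,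
      ← integral_const_mul, ← integral_add i1 (iT.const_mul _)]
    congr 1; ext x; rw [density]; ring
  have b1 : (∫ x in ball (0 : Plane) 1, (V x - V x₀) * (exp (u x) * fderiv ℝ u x (X x)))
      ≤ A * δ * (gradConst b C * M * (2 * R)) * C := by
    refine (setIntegral_mono_on i1 (iE.const_mul _) measurableSet_ball hpt1).trans ?_
    rw [integral_const_mul]
    exact mul_le_mul_of_nonneg_left h.int (by positivity)
  have b2 : (∫ x in ball (0 : Plane) 1, -(V x₀ * ((exp (u x) - 1) * planeDiv X x)))
      ≤ -2 * (∫ y in ball x₀ R, density u V y) + 2 * π * b * R ^ 2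
        + 6 * (∫ y in annulus x₀ R (L * R), density u V y) + 8 * (A * δ) * C := by
    refine (setIntegral_mono_on (iD.const_mul _).neg iRSE measurableSet_ball hpt2).trans ?_
    rw [integral_add iRS (iE.const_mul _), integral_add iR iS, integral_const_mul,
      setIntegral_indicator measurableSet_ball, Set.inter_eq_self_of_subset_right hsubR,
      setIntegral_indicator (measurableSet_annulus _ _ _), Set.inter_eq_self_of_subset_right hsubS,
      integral_add ((h.integrableOn_density.mono_set hsubR).const_mul _)
        (integrableOn_const measure_ball_lt_top.ne), integral_const_mul, integral_const_mul,
        integral_const_mul,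
      setIntegral_const, volume_real_ball_plane _ hR.le, smul_eq_mul]
    have := mul_le_mul_of_nonneg_left h.int (by positivity : 0 ≤ 8 * (A * δ))
    linarith
  rw [e1]
  linarith

/-- Local Pohozaev inequality: up to small errors the mass at the peak is at least `8π`. -/
lemma two_mul_mass_le (h : IsLiouvilleSolution b C A s u V) (hp : IsPeak u M x₀)
    {R L : ℝ} (hR : 0 < R) (hL : 3 ≤ L) (hRd : L * R ≤ (1 - ‖x₀‖) / 4) :
    2 * (∫ y in ball x₀ R, density u V y) ≤ (4 * π)⁻¹ * (∫ y in ball x₀ R, density u V y) ^ 2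
      + (3 * (2 * π)⁻¹ * (b * C) + 6) * (∫ y in annulus x₀ R (L * R), density u V y)
      + (4 * π)⁻¹ * (1 / (L - 1) + 8 * (R / (1 - ‖x₀‖))) * (b * C) ^ 2
      + A * C * (8 + 2 * gradConst b C * (R * M)) * (L * R) ^ s + 2 * π * b * R ^ 2 := by
  have h1 := h.integral_density_cutField_ge hp hR hL hRd
  have h2 := h.integral_density_cutField_le hp hR hL hRd
  linarith

end IsLiouvilleSolution

lemma inner_gradGreen_radial {x y : Plane} (hx : ‖x‖ < 1) (hy : ‖y‖ ≤ 1) (hxy : x ≠ y) :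
    inner ℝ (gradGreen 0 x y) (-x) + inner ℝ (gradGreen 0 y x) (-y)
      = (2 * π)⁻¹ * ((1 - ‖x‖ ^ 2 * ‖y‖ ^ 2) / imageSq x y) := by
  have hd : 0 < ‖x - y‖ := norm_pos_iff.2 (sub_ne_zero.2 hxy)
  have hP := imageSq_pos hx hy
  have h1 : inner ℝ (x - y) (-x - -y) = -‖x - y‖ ^ 2 := by
    rw [show -x - -y = -(x - y) by abel, inner_neg_right, real_inner_self_eq_norm_sq]
  have h2 : inner ℝ (‖y‖ ^ 2 • x - y) (-x) + inner ℝ (‖x‖ ^ 2 • y - x) (-y)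
      = 1 - ‖x‖ ^ 2 * ‖y‖ ^ 2 - imageSq x y := by
    simp only [inner_neg_right, inner_sub_left, inner_smul_left, real_inner_self_eq_norm_sq,
      real_inner_comm x y, imageSq]
    simp; ring
  rw [inner_gradGreen_add, h1, h2]
  field_simp
  ring

lemma radial_kernel_ge {x₀ x y : Plane} {R : ℝ} (hx₀ : ‖x₀‖ < 1) (hRd : R ≤ (1 - ‖x₀‖) / 4)
    (hx : x ∈ ball x₀ R) (hy : y ∈ ball x₀ R) :
    1 / (20 * (1 - ‖x₀‖)) ≤ (1 - ‖x‖ ^ 2 * ‖y‖ ^ 2) / imageSq x y := by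
  rw [mem_ball, dist_eq_norm] at hx hy
  have hd : 0 < 1 - ‖x₀‖ := by linarith
  set d := 1 - ‖x₀‖ with hdef
  have h1 := norm_sub_norm_le x x₀
  have h2 := norm_sub_norm_le y x₀
  have h3 := norm_sub_norm_le x₀ x
  have h4 := norm_sub_norm_le x₀ y
  rw [norm_sub_rev] at h3 h4
  have hx1 : ‖x‖ < 1 := by linarith
  have hy1 : ‖y‖ < 1 := by linarith
  have hP := imageSq_pos hx1 hy1.le
  have hx0 := norm_nonneg x
  have hy0 := norm_nonneg y
  have hxy : ‖x - y‖ ≤ d / 2 := by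
    have := norm_sub_le (x - x₀) (y - x₀)
    rw [sub_sub_sub_cancel_right] at this
    linarith
  have hxd : 1 - ‖x‖ ^ 2 ≤ 5 / 2 * d := by nlinarith
  have hyd : 1 - ‖y‖ ^ 2 ≤ 5 / 2 * d := by nlinarith
  have hyd0 : 0 ≤ 1 - ‖y‖ ^ 2 := by nlinarith
  have hP10 : imageSq x y ≤ 10 * d ^ 2 := by
    rw [imageSq_eq]
    have e1 : ‖x - y‖ ^ 2 ≤ (d / 2) ^ 2 := by gcongr
    have e2 : (1 - ‖x‖ ^ 2) * (1 - ‖y‖ ^ 2) ≤ 5 / 2 * d * (5 / 2 * d) := by gcongr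
    nlinarith
  have hnum : d / 2 ≤ 1 - ‖x‖ ^ 2 * ‖y‖ ^ 2 := by
    have e1 : ‖x‖ ^ 2 * ‖y‖ ^ 2 ≤ ‖x‖ ^ 2 := by nlinarith [sq_nonneg ‖x‖]
    nlinarith
  rw [div_le_div_iff₀ (by positivity) hP]
  nlinarith

lemma rpow_le_add_rpow_mul {s ρ t : ℝ} (hs : 0 < s) (hs1 : s ≤ 1) (hρ : 0 < ρ) (ht : 0 ≤ t) :
    t ^ s ≤ ρ ^ s + ρ ^ (s - 1) * t := by
  have h1 := rpow_nonneg hρ.le s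
  have h2 := rpow_nonneg hρ.le (s - 1)
  rcases le_total t ρ with h | h
  · have := rpow_le_rpow ht h hs.le
    have := mul_nonneg h2 ht
    linarith
  · have ht0 : 0 < t := hρ.trans_le h
    have h3 : t ^ s = t ^ (s - 1) * t := by
      rw [← rpow_add_one ht0.ne', sub_add_cancel]
    have h4 : t ^ (s - 1) ≤ ρ ^ (s - 1) := rpow_le_rpow_of_nonpos hρ h (by linarith)
    have := mul_le_mul_of_nonneg_right h4 ht
    linarith

namespace IsLiouvilleSolution

variable {b C A s : ℝ} {u V : Plane → ℝ} {M : ℝ} {x₀ : Plane}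

/-- Lipschitz approximation from below of the potential `V`. -/
lemma exists_lipschitz_approx (h : IsLiouvilleSolution b C A s u V) {ρ : ℝ} (hρ : 0 < ρ) :
    ∃ W : Plane → ℝ, (∀ x ∈ closedBall (0 : Plane) 1, 0 ≤ W x ∧ W x ≤ V x ∧ V x - A * ρ ^ s ≤ W x) ∧
      ∀ x y, |W x - W y| ≤ A * ρ ^ (s - 1) * ‖x - y‖ := by
  have hA := h.A_pos
  set B := A * ρ ^ (s - 1) with hB
  have hB0 : 0 ≤ B := by positivity
  have : Nonempty (closedBall (0 : Plane) 1) := ⟨⟨0, by simp⟩⟩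
  have hbdd : ∀ x : Plane, BddBelow (Set.range fun y : closedBall (0 : Plane) 1 =>
      V y + B * ‖x - y‖) := fun x => by
    refine ⟨0, ?_⟩
    rintro _ ⟨y, rfl⟩
    have := h.nonneg y y.2
    positivity
  refine ⟨fun x => ⨅ y : closedBall (0 : Plane) 1, (V y + B * ‖x - y‖),
      fun x hx => ⟨?_, ?_, ?_⟩, ?_⟩
  · refine le_ciInf fun y => ?_
    have := h.nonneg y y.2
    positivity
  · refine (ciInf_le (hbdd x) ⟨x, hx⟩).trans ?_
    simp
  · refine le_ciInf fun y => ?_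
    have h1 := (abs_le.1 (h.holder x hx y y.2)).2
    have h2 := mul_le_mul_of_nonneg_left
      (rpow_le_add_rpow_mul h.s_pos h.s_le hρ (norm_nonneg (x - y))) hA.le
    rw [hB]
    linarith
  · have key : ∀ x y : Plane, (⨅ z : closedBall (0 : Plane) 1, (V z + B * ‖x - z‖))
        - (⨅ z : closedBall (0 : Plane) 1, (V z + B * ‖y - z‖)) ≤ B * ‖x - y‖ := fun x y => by
      rw [sub_le_comm]
      refine le_ciInf fun z => ?_
      have h1 := ciInf_le (hbdd x) z
      have h2 : ‖x - z‖ ≤ ‖x - y‖ + ‖y - z‖ := norm_sub_le_norm_sub_add_norm_sub x y z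
      have h3 := mul_le_mul_of_nonneg_left h2 hB0
      linarith
    intro x y
    rw [abs_le]
    have h1 := key x y
    have h2 := key y x
    rw [norm_sub_rev] at h2
    constructor <;> linarith

lemma integral_density_radial_ge (h : IsLiouvilleSolution b C A s u V) (hp : IsPeak u M x₀)
    {R : ℝ} (hRd : R ≤ (1 - ‖x₀‖) / 4) :
    (∫ y in ball x₀ R, density u V y) ^ 2 / (80 * π * (1 - ‖x₀‖))
      ≤ ∫ x in ball (0 : Plane) 1, density u V x * fderiv ℝ u x (-x) := by
  have hn0 := norm_lt_one_of_mem hp.mem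
  have hd : 0 < 1 - ‖x₀‖ := by linarith
  have key := h.le_integral_density_mul_inner hp (X := fun x => -x) measurable_neg (N := 1)
    (fun x hx => by rw [norm_neg]; exact (norm_lt_one_of_mem hx).le) (P := ball x₀ R) (Q := ∅)
    measurableSet_ball MeasurableSet.empty (ball_subset_of_le (by linarith))
    (Set.empty_subset _) (α := (2 * π)⁻¹ * (1 / (20 * (1 - ‖x₀‖)))) (β := 0) (γ := 0)
    (fun x hx y hy hxy => by
      have hx1 := norm_lt_one_of_mem hx
      have hy1 := norm_lt_one_of_mem hy
      rw [inner_gradGreen_radial hx1 hy1.le hxy, zero_mul, sub_zero, sub_zero, mul_assoc]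
      refine mul_le_mul_of_nonneg_left ?_ (by positivity)
      by_cases hxy' : x ∈ ball x₀ R ∧ y ∈ ball x₀ R
      · rw [Set.indicator_of_mem hxy'.1, Set.indicator_of_mem hxy'.2]
        simpa using radial_kernel_ge hn0 hRd hxy'.1 hxy'.2
      · have h0 : (ball x₀ R).indicator (1 : Plane → ℝ) x * (ball x₀ R).indicator 1 y = 0 := by
          rcases not_and_or.1 hxy' with h1 | h1 <;> simp [h1]
        rw [h0, mul_zero]
        refine div_nonneg ?_ (imageSq_nonneg x y)
        have h1 : ‖x‖ ^ 2 ≤ 1 := pow_le_one₀ (norm_nonneg x) hx1.le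
        have h2 : ‖y‖ ^ 2 ≤ 1 := pow_le_one₀ (norm_nonneg y) hy1.le
        nlinarith [sq_nonneg ‖x‖])
  refine le_trans (le_of_eq ?_) key
  field_simp
  ring

lemma integral_density_radial_le (h : IsLiouvilleSolution b C A s u V) (hp : IsPeak u M x₀) :
    ∫ x in ball (0 : Plane) 1, density u V x * fderiv ℝ u x (-x)
      ≤ C * (A * gradConst b C + 2 * (b + A)) * M ^ (1 - s) := by
  have hM := hp.pos
  have hA := h.A_pos
  have hb := h.b_pos
  have hC := h.C_pos
  have hc := h.gradConst_pos
  obtain ⟨W, hW, hWl⟩ := h.exists_lipschitz_approx (inv_pos.2 hM)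
  have hρ1 : M⁻¹ ^ (s - 1) = M ^ (1 - s) := by
    rw [inv_rpow hM.le, ← rpow_neg hM.le, neg_sub]
  have hρ2 : M⁻¹ ^ s * M = M ^ (1 - s) := by
    rw [inv_rpow hM.le, rpow_sub hM, rpow_one]; field_simp
  rw [hρ1] at hWl
  set T := M ^ (1 - s) with hT
  have hT1 : 1 ≤ T := one_le_rpow hp.one_lt.le (by linarith [h.s_le])
  set K := b + A * T with hK
  have hK0 : 0 ≤ K := by positivity
  have hcoord : ∀ i : Fin 2, LipschitzOnWith K.toNNReal (fun x : Plane => W x * -(x i))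
      (closedBall 0 1) := by
    intro i
    refine LipschitzOnWith.of_dist_le_mul fun x hx y hy => ?_
    rw [Real.coe_toNNReal _ hK0, dist_eq_norm, dist_eq_norm, norm_eq_abs]
    have e : W x * -(x i) - W y * -(y i) = -((W x - W y) * x i) - W y * (x - y) i := by
      simp; ring
    have h1 : |x i| ≤ 1 := (PiLp.norm_apply_le x i).trans (by simpa using hx)
    have h2 : |(x - y) i| ≤ ‖x - y‖ := PiLp.norm_apply_le (x - y) i
    have h3 : |W y| ≤ b := by
      rw [abs_of_nonneg (hW y hy).1]; exact (hW y hy).2.1.trans (h.le y hy)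
    have h4 := hWl x y
    rw [e]
    calc _ ≤ |W x - W y| * |x i| + |W y| * |(x - y) i| := by
          refine (abs_sub _ _).trans (le_of_eq ?_)
          rw [abs_neg, abs_mul, abs_mul]
      _ ≤ A * T * ‖x - y‖ * 1 + b * ‖x - y‖ := by gcongr
      _ = _ := by rw [hK]; ring
  choose G hG hGe using fun i => (hcoord i).extend_real
  set Y : Plane → Plane := fun x => WithLp.toLp 2 fun i => G i x with hY
  have hYc : ∀ i, LipschitzWith K.toNNReal (fun z => Y z i) := fun i => hG i
  have hYe : ∀ x ∈ ball (0 : Plane) 1, Y x = W x • -x := fun x hx => by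
    ext i
    have := hGe i (ball_subset_closedBall hx)
    simp only at this
    simp [hY, ← this]
  have hXm : AEStronglyMeasurable (fun x : Plane => -x) (volume.restrict (ball (0 : Plane) 1)) :=
    continuous_neg.aestronglyMeasurable
  have iE := h.integrableOn_exp
  have iT := h.integrableOn_exp_mul_fderiv hp hXm (N := 1)
    (fun x hx => by rw [norm_neg]; exact (norm_lt_one_of_mem hx).le)
  have hWc : Continuous W := by
    refine (LipschitzWith.of_dist_le_mul (K := (A * T).toNNReal) fun x y => ?_).continuous
    rw [Real.coe_toNNReal _ (by positivity), dist_eq_norm, dist_eq_norm]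
    exact hWl x y
  have iV : IntegrableOn (fun x => (V x - W x) * (exp (u x) * fderiv ℝ u x (-x))) (ball 0 1) := by
    refine iT.bdd_mul (c := b) ((aestronglyMeasurable_of_continuousOn h.continuousOn_V).sub
      hWc.aestronglyMeasurable) ?_
    filter_upwards [ae_restrict_mem measurableSet_ball] with x hx
    have hx' := ball_subset_closedBall hx
    have h1 := hW x hx'
    rw [norm_of_nonneg (by linarith)]
    linarith [h.le x hx']
  have iW : IntegrableOn (fun x => W x * (exp (u x) * fderiv ℝ u x (-x))) (ball 0 1) := by
    refine iT.bdd_mul (c := b) hWc.aestronglyMeasurable ?_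
    filter_upwards [ae_restrict_mem measurableSet_ball] with x hx
    have hx' := ball_subset_closedBall hx
    rw [norm_of_nonneg (hW x hx').1]
    exact (hW x hx').2.1.trans (h.le x hx')
  have e1 : ∫ x in ball (0 : Plane) 1, density u V x * fderiv ℝ u x (-x)
      = (∫ x in ball (0 : Plane) 1, (V x - W x) * (exp (u x) * fderiv ℝ u x (-x)))
        + ∫ x in ball (0 : Plane) 1, W x * (exp (u x) * fderiv ℝ u x (-x)) := by
    rw [← integral_add iV iW]
    congr 1; ext x; rw [density]; ring
  have e2 : ∫ x in ball (0 : Plane) 1, W x * (exp (u x) * fderiv ℝ u x (-x))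
      = ∫ x in ball (0 : Plane) 1, -((exp (u x) - 1) * planeDiv Y x) := by
    rw [integral_neg, ← h.integral_exp_mul_fderiv hp hYc]
    refine setIntegral_congr_fun measurableSet_ball fun x hx => ?_
    simp only [hYe x hx, map_smul, smul_eq_mul]
    ring
  have b1 : ∫ x in ball (0 : Plane) 1, (V x - W x) * (exp (u x) * fderiv ℝ u x (-x))
      ≤ A * gradConst b C * T * C := by
    calc _ ≤ ∫ x in ball (0 : Plane) 1, A * gradConst b C * T * exp (u x) := by
          refine setIntegral_mono_on iV (iE.const_mul _) measurableSet_ball fun x hx => ?_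
          have hx' := ball_subset_closedBall hx
          have h1 := hW x hx'
          have h2 : |V x - W x| ≤ A * M⁻¹ ^ s := by
            rw [abs_of_nonneg (by linarith)]; linarith
          have h3 : |fderiv ℝ u x (-x)| ≤ gradConst b C * M * 1 :=
            ((fderiv ℝ u x).le_opNorm _).trans (mul_le_mul (h.norm_fderiv_le hp hx)
              (by rw [norm_neg]; exact (norm_lt_one_of_mem hx).le) (norm_nonneg _) (by positivity))
          refine (le_abs_self _).trans ?_
          rw [abs_mul, abs_mul, abs_of_pos (exp_pos _)]
          calc _ ≤ A * M⁻¹ ^ s * (exp (u x) * (gradConst b C * M * 1)) := by gcongr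
            _ = A * gradConst b C * (M⁻¹ ^ s * M) * exp (u x) := by ring
            _ = _ := by rw [hρ2]
      _ ≤ _ := by
          rw [integral_const_mul]
          exact mul_le_mul_of_nonneg_left h.int (by positivity)
  have b2 : ∫ x in ball (0 : Plane) 1, -((exp (u x) - 1) * planeDiv Y x) ≤ 2 * K * C := by
    calc _ ≤ ∫ x in ball (0 : Plane) 1, 2 * K * exp (u x) := by
          refine setIntegral_mono_on (h.integrableOn_exp_sub_one_mul_planeDiv hYc).neg
            (iE.const_mul _) measurableSet_ball fun x hx => ?_
          have hw := h.exp_sub_one_nonneg hx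
          have h2 : |planeDiv Y x| ≤ 2 * K := by
            rw [planeDiv, Fin.sum_univ_two]
            have h0 := abs_lineDeriv_coord_le (hYc 0) 0 x
            have h1 := abs_lineDeriv_coord_le (hYc 1) 1 x
            rw [Real.coe_toNNReal _ hK0] at h0 h1
            exact (abs_add_le _ _).trans (by linarith)
          have h3 := mul_le_mul_of_nonneg_left (abs_le.1 h2).1 hw
          linarith
      _ ≤ _ := by
          rw [integral_const_mul]
          exact mul_le_mul_of_nonneg_left h.int (by positivity)
  rw [e1, e2]
  have h5 : b * C * 1 ≤ b * C * T := by gcongr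
  rw [hK] at b2
  linarith

/-- Global Pohozaev inequality: the peak cannot be close to the boundary. -/
lemma mass_sq_le (h : IsLiouvilleSolution b C A s u V) (hp : IsPeak u M x₀)
    {R : ℝ} (hRd : R ≤ (1 - ‖x₀‖) / 4) :
    (∫ y in ball x₀ R, density u V y) ^ 2
      ≤ 80 * π * (1 - ‖x₀‖) * (C * (A * gradConst b C + 2 * (b + A)) * M ^ (1 - s)) := by
  have hd : 0 < 1 - ‖x₀‖ := by linarith [norm_lt_one_of_mem hp.mem]
  have := (h.integral_density_radial_ge hp hRd).trans (h.integral_density_radial_le hp)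
  rwa [div_le_iff₀' (by positivity)] at this

end IsLiouvilleSolution

lemma two_pi_mul_le_of_quadratic {μ κ E : ℝ} (hμ : 2 * π < μ) (hκ : κ < 4)
    (hq : 2 * μ ≤ (4 * π)⁻¹ * μ ^ 2 + E) (hE : E ≤ π * (4 - κ)) : 2 * π * κ ≤ μ := by
  by_contra! hlt
  have hπ := pi_pos
  have h8 : 0 < 8 * π - μ := by nlinarith
  have h1 : 8 * π * μ ≤ μ ^ 2 + 4 * π * E := by
    calc 8 * π * μ = 4 * π * (2 * μ) := by ring
      _ ≤ 4 * π * ((4 * π)⁻¹ * μ ^ 2 + E) := by gcongr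
      _ = _ := by field_simp
  have h2 : 2 * π * (8 * π - μ) < 4 * π * E := by nlinarith
  nlinarith

/-- The largeness conditions on the height of a peak, for fixed constants. -/
lemma eventually_large {s κ : ℝ} (hs : 0 < s) (hκ : 2 / κ < s) {ε ℓ : ℝ} (hε : 0 < ε)
    (c D D' D'' q : ℝ) (hq : 0 < q) :
    ∀ᶠ M in atTop, 1 < M ∧ 2 * c * ℓ ≤ log M ∧ D / log M ≤ ε ∧ D' * (ℓ / M) ^ s ≤ ε ∧
      D'' * (ℓ / M) ^ 2 ≤ ε ∧ ℓ * M ^ (2 / κ) ≤ q * M ^ s := by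
  have t1 : Tendsto (fun M : ℝ => D / log M) atTop (𝓝 0) :=
    tendsto_log_atTop.const_div_atTop D
  have t0 : Tendsto (fun M : ℝ => ℓ / M) atTop (𝓝 0) := tendsto_id.const_div_atTop ℓ
  have t2 : Tendsto (fun M : ℝ => D' * (ℓ / M) ^ s) atTop (𝓝 0) := by
    have := (t0.rpow_const (p := s) (Or.inr hs.le)).const_mul D'
    rwa [zero_rpow hs.ne', mul_zero] at this
  have t3 : Tendsto (fun M : ℝ => D'' * (ℓ / M) ^ 2) atTop (𝓝 0) := by
    have := (t0.pow 2).const_mul D''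
    rwa [zero_pow two_ne_zero, mul_zero] at this
  have t4 : Tendsto (fun M : ℝ => M ^ (s - 2 / κ)) atTop atTop :=
    tendsto_rpow_atTop (by linarith)
  filter_upwards [eventually_gt_atTop 1, tendsto_log_atTop.eventually_ge_atTop (2 * c * ℓ),
    t1.eventually_le_const hε, t2.eventually_le_const hε, t3.eventually_le_const hε,
    t4.eventually_ge_atTop (ℓ / q)] with M h1 h2 h3 h4 h5 h6
  refine ⟨h1, h2, h3, h4, h5, ?_⟩
  have hM : 0 < M := by linarith
  rw [rpow_sub hM, div_le_div_iff₀ hq (by positivity)] at h6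
  linarith

namespace IsLiouvilleSolution

variable {b C A s M : ℝ} {u V : Plane → ℝ} {x₀ : Plane}

lemma annulus_mass_eq (h : IsLiouvilleSolution b C A s u V) {R R' : ℝ} (hR : R ≤ R')
    (hRd : R' ≤ 1 - ‖x₀‖) :
    ∫ y in annulus x₀ R R', density u V y
      = (∫ y in ball x₀ R', density u V y) - ∫ y in ball x₀ R, density u V y :=
  setIntegral_sdiff measurableSet_ball
    (h.integrableOn_density.mono_set (ball_subset_of_le hRd)) (ball_subset_ball hR)

/-- Among `K` successive annuli one carries at most the fraction `1 / K` of the mass. -/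
lemma exists_annulus_mass_le (h : IsLiouvilleSolution b C A s u V) {L R : ℝ} (hL : 1 ≤ L)
    (hR : 0 < R) {K : ℕ} (hK : 0 < K) (hRd : L ^ K * R ≤ 1 - ‖x₀‖) :
    ∃ k < K, ∫ y in annulus x₀ (L ^ k * R) (L * (L ^ k * R)), density u V y ≤ b * C / K := by
  by_contra! hlt
  have hK' : (0 : ℝ) < K := by exact_mod_cast hK
  have hmono {i j : ℕ} (hij : i ≤ j) : L ^ i * R ≤ L ^ j * R := by gcongr
  have hsum : (∑ k ∈ Finset.range K, b * C / K) < ∑ k ∈ Finset.range K,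
      ((∫ y in ball x₀ (L ^ (k + 1) * R), density u V y)
        - ∫ y in ball x₀ (L ^ k * R), density u V y) := by
    refine Finset.sum_lt_sum_of_nonempty (Finset.nonempty_range_iff.2 hK.ne') fun k hk => ?_
    have hk' := Finset.mem_range.1 hk
    have := hlt k hk'
    rw [show L * (L ^ k * R) = L ^ (k + 1) * R by ring] at this
    rwa [h.annulus_mass_eq (hmono k.le_succ) ((hmono hk').trans hRd)] at this
  rw [Finset.sum_range_sub (fun k => ∫ y in ball x₀ (L ^ k * R), density u V y),
    Finset.sum_const, Finset.card_range, nsmul_eq_mul, mul_div_cancel₀ _ hK'.ne'] at hsum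
  have h1 := h.setIntegral_density_le (ball_subset_of_le hRd)
  have h2 := h.setIntegral_density_nonneg (S := ball x₀ (L ^ 0 * R)) measurableSet_ball
    (ball_subset_of_le ((hmono K.zero_le).trans hRd))
  linarith

/-- A peak carrying mass at least `2πκ` in the ball of radius `ℓ / M` is close to the boundary. -/
lemma dist_mul_le (h : IsLiouvilleSolution b C A s u V) (hp : IsPeak u M x₀) {ℓ κ : ℝ}
    (hℓ : 0 < ℓ) (hκ : 0 < κ) (hRd : ℓ / M ≤ 1 - ‖x₀‖)
    (hμ : 2 * π * κ ≤ ∫ y in ball x₀ (ℓ / M), density u V y) :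
    (1 - ‖x₀‖) * M ≤ ℓ * M ^ (2 / κ) := by
  have hM := hp.pos
  have hR : 0 < ℓ / M := by positivity
  have hd : 0 < 1 - ‖x₀‖ := by linarith
  have hlog : 0 ≤ log ((1 - ‖x₀‖) / (ℓ / M)) := log_nonneg ((one_le_div hR).2 hRd)
  have h1 := h.mass_mul_log_le hp hR hRd
  have h2 : κ * log ((1 - ‖x₀‖) / (ℓ / M)) ≤ 2 * log M := by
    refine le_trans ?_ h1
    calc κ * log ((1 - ‖x₀‖) / (ℓ / M))
        = 2 * π * κ * ((2 * π)⁻¹ * log ((1 - ‖x₀‖) / (ℓ / M))) := by field_simp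
      _ ≤ _ := by gcongr
  have h3 : log ((1 - ‖x₀‖) / (ℓ / M)) ≤ log (M ^ (2 / κ)) := by
    rw [log_rpow hM, div_mul_eq_mul_div, le_div_iff₀ hκ]
    linarith
  rw [log_le_log_iff (by positivity) (by positivity)] at h3
  rw [div_le_iff₀ hR] at h3
  calc (1 - ‖x₀‖) * M ≤ M ^ (2 / κ) * (ℓ / M) * M := by gcongr
    _ = _ := by field_simp

/-- A peak carrying mass more than `2π` is at distance at least of order `M ^ (s - 1)` from the
boundary. -/
lemma lt_dist_mul (h : IsLiouvilleSolution b C A s u V) (hp : IsPeak u M x₀) {R : ℝ}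
    (hRd : R ≤ (1 - ‖x₀‖) / 4) (hμ : 2 * π < ∫ y in ball x₀ R, density u V y) :
    π / (20 * (C * (A * gradConst b C + 2 * (b + A)))) * M ^ s < (1 - ‖x₀‖) * M := by
  have hM := hp.pos
  have hb := h.b_pos
  have hC := h.C_pos
  have hA := h.A_pos
  have hg := h.gradConst_pos
  have hπ := pi_pos
  have h1 := h.mass_sq_le hp hRd
  set D := C * (A * gradConst b C + 2 * (b + A)) with hD
  have hD0 : 0 < D := by positivity
  have h2 : (2 * π) ^ 2 < 80 * π * (1 - ‖x₀‖) * (D * M ^ (1 - s)) :=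
    (pow_lt_pow_left₀ hμ (by positivity) two_ne_zero).trans_le h1
  rw [rpow_sub hM, rpow_one] at h2
  have hMs : 0 < M ^ s := rpow_pos_of_pos hM s
  have h3 : (2 * π) ^ 2 * M ^ s < 80 * π * (1 - ‖x₀‖) * (D * M) := by
    calc _ < 80 * π * (1 - ‖x₀‖) * (D * (M / M ^ s)) * M ^ s := by gcongr
      _ = _ := by field_simp
  rw [div_mul_eq_mul_div, div_lt_iff₀ (by positivity)]
  nlinarith

/-- The local and the global Pohozaev inequalities are incompatible at a high peak. -/
lemma not_isPeak (h : IsLiouvilleSolution b C A s u V) {κ ε L ℓ₀ ℓ : ℝ} {K : ℕ}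
    (hκ4 : κ < 4) (hκ0 : 0 < κ) (hεκ : 5 * ε ≤ π * (4 - κ)) (hL3 : 3 ≤ L)
    (hLε : (4 * π)⁻¹ * (b * C) ^ 2 / (L - 1) ≤ ε) (hK' : 0 < K)
    (hKε : (3 * (2 * π)⁻¹ * (b * C) + 6) * (b * C / K) ≤ ε) (hℓ₀1 : 1 < ℓ₀)
    (hℓ₀ : 32 * C * exp (b + 3 * (b * C) / (8 * π)) < ℓ₀) (hℓdef : ℓ = L ^ K * ℓ₀)
    (hM1 : 1 < M) (hlog : 2 * gradConst b C * ℓ ≤ log M)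
    (hε3 : (4 * π)⁻¹ * 8 * (ℓ * gradConst b C / 2) * (b * C) ^ 2 / log M ≤ ε)
    (hε4 : A * C * (8 + 2 * gradConst b C * ℓ) * (ℓ / M) ^ s ≤ ε)
    (hε5 : 2 * π * b * (ℓ / M) ^ 2 ≤ ε)
    (hfin : ℓ * M ^ (2 / κ)
      ≤ π / (20 * (C * (A * gradConst b C + 2 * (b + A)))) * M ^ s) : ¬ IsPeak u M x₀ := by
  intro hp
  have hb := h.b_pos
  have hC := h.C_pos
  have hA := h.A_pos
  have hs0 := h.s_pos
  have hg := h.gradConst_pos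
  have hπ := pi_pos
  have hM : 0 < M := hp.pos
  have hlogM : 0 < log M := log_pos hM1
  have hℓ0 : 0 < ℓ := by rw [hℓdef]; positivity
  set d := 1 - ‖x₀‖ with hd
  have hdM := h.two_mul_log_le hp
  have hd0 : 0 < d := by linarith [norm_lt_one_of_mem hp.mem]
  have hℓd : ℓ / M ≤ d / 4 := by
    rw [div_le_iff₀ hM]
    have h1 : gradConst b C * ℓ ≤ gradConst b C * (d / 4 * M) := by linarith
    exact le_of_mul_le_mul_left h1 hg
  obtain ⟨k, hkK, hη⟩ := h.exists_annulus_mass_le (x₀ := x₀) (L := L) (R := ℓ₀ / M) (K := K)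
    (by linarith) (by positivity) hK'
    (by rw [← mul_div_assoc, ← hℓdef]; linarith)
  have hL1 : 1 ≤ L ^ k := one_le_pow₀ (by linarith)
  set r := L ^ k * ℓ₀ with hr
  have hrr : L ^ k * (ℓ₀ / M) = r / M := by rw [hr, mul_div_assoc]
  rw [hrr] at hη
  have hr0 : ℓ₀ ≤ r := le_mul_of_one_le_left (by linarith) hL1
  have hLr : L * r ≤ ℓ := by
    rw [hr, ← mul_assoc, ← pow_succ', hℓdef]
    have := pow_le_pow_right₀ (by linarith : 1 ≤ L) hkK
    gcongr
  have hrpos : 0 < r := by linarith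
  have hrℓ : r ≤ ℓ := by nlinarith
  have hrM : r / M * M = r := div_mul_cancel₀ _ hM.ne'
  have hrd : r / M ≤ d / 4 := le_trans (by gcongr) hℓd
  have hLrM : L * (r / M) ≤ ℓ / M := by rw [← mul_div_assoc]; gcongr
  have hμ2 := h.two_pi_lt_mass hp (R := r / M) (by positivity) hrd (by rw [hrM]; linarith)
    (by
      rw [hrM]
      have : 3 < π := pi_gt_three
      nlinarith)
  have hmain := h.two_mul_mass_le hp (R := r / M) (by positivity) hL3 (hLrM.trans hℓd)
  rw [← hd, hrM] at hmain
  have e1 : (3 * (2 * π)⁻¹ * (b * C) + 6)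
      * (∫ y in annulus x₀ (r / M) (L * (r / M)), density u V y) ≤ ε :=
    le_trans (by gcongr) hKε
  have e2 : (4 * π)⁻¹ * (1 / (L - 1) + 8 * (r / M / d)) * (b * C) ^ 2 ≤ ε + ε := by
    have h1 : r / M / d ≤ ℓ * gradConst b C / 2 / log M := by
      rw [div_div, div_le_div_iff₀ (by positivity) hlogM]
      calc r * log M ≤ ℓ * log M := by gcongr
        _ ≤ ℓ * (gradConst b C * (M * d) / 2) := by gcongr; linarith
        _ = _ := by ring
    calc (4 * π)⁻¹ * (1 / (L - 1) + 8 * (r / M / d)) * (b * C) ^ 2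
        ≤ (4 * π)⁻¹ * (1 / (L - 1) + 8 * (ℓ * gradConst b C / 2 / log M)) * (b * C) ^ 2 := by
          gcongr
      _ = (4 * π)⁻¹ * (b * C) ^ 2 / (L - 1)
          + (4 * π)⁻¹ * 8 * (ℓ * gradConst b C / 2) * (b * C) ^ 2 / log M := by ring
      _ ≤ _ := add_le_add hLε hε3
  have e4 : A * C * (8 + 2 * gradConst b C * r) * (L * (r / M)) ^ s ≤ ε :=
    le_trans (by gcongr) hε4
  have e5 : 2 * π * b * (r / M) ^ 2 ≤ ε := le_trans (by gcongr) hε5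
  have hμκ := two_pi_mul_le_of_quadratic (κ := κ) hμ2 hκ4
    (E := 5 * ε) (by linarith) hεκ
  have hup := h.dist_mul_le hp hrpos hκ0 (by linarith) hμκ
  have hlow := h.lt_dist_mul hp hrd hμ2
  have : r * M ^ (2 / κ) ≤ ℓ * M ^ (2 / κ) := by gcongr
  linarith

/-- Heights of peaks are bounded in terms of the constants. -/
lemma exists_peak_height_lt {b C A s : ℝ} (hb : 0 < b) (hC : 0 < C) (hA : 0 < A)
    (hs : 1 / 2 < s) : ∃ M₀ : ℝ, 1 < M₀ ∧ ∀ {u V : Plane → ℝ} {M : ℝ} {x₀ : Plane},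
      IsLiouvilleSolution b C A s u V → IsPeak u M x₀ → M < M₀ := by
  have hπ := pi_pos
  have hs0 : 0 < s := by linarith
  have hg : 0 < gradConst b C := by rw [gradConst]; positivity
  have hD0 : 0 < C * (A * gradConst b C + 2 * (b + A)) := by positivity
  have hs' : 1 / s < 2 := by rw [div_lt_iff₀ hs0]; linarith
  have hs1 : 0 < 1 / s := by positivity
  set κ := 1 / s + 2 with hκdef
  have hκ4 : κ < 4 := by linarith
  have hκ0 : 0 < κ := by linarith
  have hκ : 2 / κ < s := by
    rw [div_lt_iff₀ hκ0, hκdef, mul_add, mul_one_div_cancel hs0.ne']; linarith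
  set ε := π * (4 - κ) / 5 with hεdef
  have hε : 0 < ε := by have : 0 < 4 - κ := by linarith
                        positivity
  obtain ⟨L, hL3, hLε⟩ : ∃ L : ℝ, 3 ≤ L ∧ (4 * π)⁻¹ * (b * C) ^ 2 / (L - 1) ≤ ε := by
    refine ⟨3 + (4 * π)⁻¹ * (b * C) ^ 2 / ε, by
      have : 0 ≤ (4 * π)⁻¹ * (b * C) ^ 2 / ε := by positivity
      linarith, ?_⟩
    rw [div_le_iff₀ (by have : 0 ≤ (4 * π)⁻¹ * (b * C) ^ 2 / ε := by positivity
                        linarith)]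
    have : ε * ((4 * π)⁻¹ * (b * C) ^ 2 / ε) = (4 * π)⁻¹ * (b * C) ^ 2 := by field_simp
    linarith
  obtain ⟨K, hK⟩ := exists_nat_gt ((3 * (2 * π)⁻¹ * (b * C) + 6) * (b * C) / ε)
  have hK' : (0 : ℝ) < K := lt_of_le_of_lt (by positivity) hK
  have hKε : (3 * (2 * π)⁻¹ * (b * C) + 6) * (b * C / K) ≤ ε := by
    rw [div_lt_iff₀ hε] at hK
    rw [← mul_div_assoc, div_le_iff₀ hK']
    linarith
  set ℓ₀ := 1 + 32 * C * exp (b + 3 * (b * C) / (8 * π)) with hℓ₀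
  have hℓ₀1 : 1 < ℓ₀ := by 
    have : 0 < 32 * C * exp (b + 3 * (b * C) / (8 * π)) := by positivity
    linarith
  set ℓ := L ^ K * ℓ₀ with hℓdef
  have hℓ0 : 0 < ℓ := by positivity
  obtain ⟨M₀, hM₀⟩ := eventually_atTop.1 (eventually_large hs0 hκ (ℓ := ℓ) hε (gradConst b C)
    ((4 * π)⁻¹ * 8 * (ℓ * gradConst b C / 2) * (b * C) ^ 2)
    (A * C * (8 + 2 * gradConst b C * ℓ)) (2 * π * b)
    (π / (20 * (C * (A * gradConst b C + 2 * (b + A))))) (by positivity))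
  refine ⟨M₀, (hM₀ M₀ le_rfl).1, fun {u V M x₀} h hp => ?_⟩
  by_contra! hMM
  obtain ⟨hM1, hlog, hε3, hε4, hε5, hfin⟩ := hM₀ M hMM
  exact h.not_isPeak hκ4 hκ0 (by rw [hεdef]; linarith) hL3 hLε (by exact_mod_cast hK') hKε hℓ₀1
    (by linarith) hℓdef hM1 hlog hε3 hε4 hε5 hfin hp

/-- Solutions are bounded above in terms of the constants. -/
lemma exists_upper_bound {b C A s : ℝ} (hb : 0 < b) (hC : 0 < C) (hA : 0 < A) (hs : 1 / 2 < s) :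
    ∃ T : ℝ, ∀ {u V : Plane → ℝ}, IsLiouvilleSolution b C A s u V →
      ∀ x ∈ ball (0 : Plane) 1, u x ≤ T := by
  obtain ⟨M₀, hM₀, hlt⟩ := exists_peak_height_lt (s := s) hb hC hA hs
  refine ⟨2 * log M₀, fun {u V} h x hx => ?_⟩
  obtain ⟨x₀, hx₀, hmax⟩ := (isCompact_closedBall (0 : Plane) 1).exists_isMaxOn
    ⟨0, mem_closedBall_self zero_le_one⟩ h.cont
  refine (hmax (ball_subset_closedBall hx)).trans ?_
  by_contra! hgt
  have hlog : 0 < log M₀ := log_pos hM₀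
  have hball : x₀ ∈ ball (0 : Plane) 1 := by
    by_contra hnot
    have hsph : x₀ ∈ sphere (0 : Plane) 1 :=
      le_antisymm (mem_closedBall.1 hx₀) (not_lt.1 hnot)
    linarith [h.bdry x₀ hsph]
  have hval : 2 * log (exp (u x₀ / 2)) = u x₀ := by rw [log_exp]; ring
  have hM : M₀ < exp (u x₀ / 2) := (log_lt_iff_lt_exp (by linarith)).1 (by linarith)
  exact (hlt h ⟨hM₀.trans hM, hball, fun y hy => (hmax hy).trans_eq hval.symm, hval.symm⟩).not_gt hM

end IsLiouvilleSolution

/-- Theorem 1: along a subsequence, `V_i e^{u_i}` converges weakly to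
`V e^u + Σ_{j=1}^m 8π δ_{x_j}` where the `x_j` are (exterior) blow-up points on the
boundary of the unit ball, each carrying mass exactly `8π`. -/
theorem exterior_blowup_mass
    (b C A s : ℝ) (hb : 0 < b) (hC : 0 < C) (hA : 0 < A)
    (hs1 : 1 / 2 < s) (hs2 : s ≤ 1)
    (u V : ℕ → EuclideanSpace ℝ (Fin 2) → ℝ)
    (hu_reg : ∀ i, ContDiffOn ℝ 2 (u i) (ball (0 : EuclideanSpace ℝ (Fin 2)) 1))
    (hu_cont : ∀ i, ContinuousOn (u i) (closedBall (0 : EuclideanSpace ℝ (Fin 2)) 1))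
    (hV_nonneg : ∀ i, ∀ x ∈ closedBall (0 : EuclideanSpace ℝ (Fin 2)) 1, 0 ≤ V i x)
    (hV_le : ∀ i, ∀ x ∈ closedBall (0 : EuclideanSpace ℝ (Fin 2)) 1, V i x ≤ b)
    (hV_holder : ∀ i, ∀ x ∈ closedBall (0 : EuclideanSpace ℝ (Fin 2)) 1,
      ∀ y ∈ closedBall (0 : EuclideanSpace ℝ (Fin 2)) 1,
        |V i x - V i y| ≤ A * ‖x - y‖ ^ s)
    (hpde : ∀ i, ∀ x ∈ ball (0 : EuclideanSpace ℝ (Fin 2)) 1,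
      -lap (u i) x = V i x * exp (u i x))
    (hbdry : ∀ i, ∀ x ∈ sphere (0 : EuclideanSpace ℝ (Fin 2)) 1, u i x = 0)
    (hint : ∀ i, ∫ y in ball (0 : EuclideanSpace ℝ (Fin 2)) 1, exp (u i y) ≤ C)
    (hblow : Tendsto (fun i => sSup (u i '' ball (0 : EuclideanSpace ℝ (Fin 2)) 1))
      atTop atTop) :
    ∃ φ : ℕ → ℕ, StrictMono φ ∧
    ∃ u₀ : EuclideanSpace ℝ (Fin 2) → ℝ,
    ∃ V₀ : EuclideanSpace ℝ (Fin 2) → ℝ,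
      ContinuousOn V₀ (closedBall (0 : EuclideanSpace ℝ (Fin 2)) 1) ∧
      TendstoUniformlyOn (fun i => V (φ i)) V₀ atTop
        (closedBall (0 : EuclideanSpace ℝ (Fin 2)) 1) ∧
    ∃ m : ℕ, 1 ≤ m ∧
    ∃ x : Fin m → EuclideanSpace ℝ (Fin 2),
      (∀ j, x j ∈ sphere (0 : EuclideanSpace ℝ (Fin 2)) 1) ∧
      ∀ f : EuclideanSpace ℝ (Fin 2) → ℝ,
        ContinuousOn f (closedBall (0 : EuclideanSpace ℝ (Fin 2)) 1) →
        Tendsto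
          (fun i => ∫ y in ball (0 : EuclideanSpace ℝ (Fin 2)) 1,
            f y * (V (φ i) y * exp (u (φ i) y)))
          atTop
          (𝓝 ((∫ y in ball (0 : EuclideanSpace ℝ (Fin 2)) 1, f y * (V₀ y * exp (u₀ y)))
            + 8 * π * ∑ j, f (x j))) := by
  exfalso
  obtain ⟨T, hT⟩ := IsLiouvilleSolution.exists_upper_bound hb hC hA hs1
  obtain ⟨i, hi⟩ := (hblow.eventually_gt_atTop T).exists
  have h : IsLiouvilleSolution b C A s (u i) (V i) :=
    ⟨hb, hC, hA, by linarith, hs2, hu_reg i, hu_cont i, hV_nonneg i, hV_le i, hV_holder i,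
      hpde i, hbdry i, hint i⟩
  refine hi.not_ge (csSup_le ((nonempty_ball.2 one_pos).image _) ?_)
  rintro _ ⟨x, hx, rfl⟩
  exact hT h x hx
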